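/- arXiv:2206.09050 — 3 statements merged into one kernel-verified Lean document; each statement's English description precedes it below -/
import Mathlib

section
/- Let β > 0 and set e_1 = (8/3)β³. Then for every continuously differentiable function u : ℝ → ℝ with u and u′ square-integrable and with ∫_ℝ (1/2) u(x)² dx = e_1, one has ∫_ℝ [ (1/2) u′(x)² + u(x)³ ] dx ≥ −(32/5) β⁵, with equality if and only if u(x) = −2β² sech²( β(x − c) ) for some c ∈ ℝ. -/
open MeasureTheory

open Filter Topology Set in
lemma aux_tanh_lim : Tendsto Real.tanh atTop (𝓝 1) := by
  have h : Real.tanh = fun x => 1 - 2 / (Real.exp (2 * x) + 1) := by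
    funext x
    have h1 : Real.exp (2 * x) = Real.exp x * Real.exp x := by rw [← Real.exp_add]; ring_nf
    rw [Real.tanh_eq_sinh_div_cosh, Real.sinh_eq, Real.cosh_eq, h1, Real.exp_neg]
    have := Real.exp_pos x
    field_simp
    ring
  rw [h]
  have h2 : Tendsto (fun x : ℝ => Real.exp (2 * x) + 1) atTop atTop :=
    tendsto_atTop_add_const_right _ _
      (Real.tendsto_exp_atTop.comp (tendsto_id.const_mul_atTop (by norm_num : (0:ℝ) < 2)))
  have h3 := (h2.const_div_atTop 2).const_sub 1
  simpa using h3

lemma aux_sech (x : ℝ) : (1 / Real.cosh x) ^ 2 = 1 - Real.tanh x ^ 2 := by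
  rw [Real.tanh_eq_sinh_div_cosh]
  have := Real.cosh_pos x
  field_simp
  linarith [Real.cosh_sq x]

lemma aux_tanh_deriv (b c x : ℝ) :
    HasDerivAt (fun x => Real.tanh (b * (x - c))) (b * (1 - Real.tanh (b * (x - c)) ^ 2)) x := by
  have h0 : HasDerivAt Real.tanh (1 - Real.tanh (b * (x - c)) ^ 2) (b * (x - c)) := by
    have := (Real.hasDerivAt_sinh (b * (x - c))).div (Real.hasDerivAt_cosh (b * (x - c)))
      (Real.cosh_pos _).ne'
    have e : Real.tanh = Real.sinh / Real.cosh := by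
      funext x; simp [Real.tanh_eq_sinh_div_cosh]
    rw [Real.tanh_eq_sinh_div_cosh, e]
    refine this.congr_deriv ?_
    have := Real.cosh_pos (b * (x - c))
    field_simp
  have h1 : HasDerivAt (fun x : ℝ => b * (x - c)) b x := by
    simpa using ((hasDerivAt_id x).sub_const c).const_mul b
  have := h0.comp x h1
  rw [mul_comm]
  exact this

open Filter Topology Set in
lemma aux_tanh_lim' (b c : ℝ) (hb : 0 < b) :
    Tendsto (fun x => Real.tanh (b * (x - c))) atTop (𝓝 1) :=
  aux_tanh_lim.comp ((tendsto_atTop_add_const_right _ (-c) tendsto_id).const_mul_atTop hb)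

open Filter Topology Set in
lemma aux_tanh_lim_bot (b c : ℝ) (hb : 0 < b) :
    Tendsto (fun x => Real.tanh (b * (x - c))) atBot (𝓝 (-1)) := by
  have h := ((aux_tanh_lim' b (-c) hb).comp tendsto_neg_atBot_atTop).neg
  refine h.congr fun x => ?_
  simp only [Function.comp]
  rw [← Real.tanh_neg]; ring_nf

open Filter Topology Set in
/-- decay at infinity -/
lemma aux_decay (u : ℝ → ℝ) (hu : ContDiff ℝ 1 u)
    (hu2 : Integrable (fun x => u x ^ 2)) (hdu2 : Integrable (fun x => deriv u x ^ 2)) :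
    Tendsto u atTop (𝓝 0) := by
  have hd : Differentiable ℝ u := hu.differentiable (by norm_num)
  have hc : Continuous (deriv u) := hu.continuous_deriv (by norm_num)
  have hder : ∀ x, HasDerivAt (fun x => u x ^ 2) (2 * u x * deriv u x) x := fun x => by
    refine ((hd x).hasDerivAt.pow 2).congr_deriv ?_
    simp
  have hint : Integrable (fun x => 2 * u x * deriv u x) := by
    refine (hu2.add hdu2).mono' (by have := hu.continuous; fun_prop) (ae_of_all _ fun x => ?_)
    simp only [Pi.add_apply, Real.norm_eq_abs]
    rw [abs_le]; constructor <;> nlinarith [sq_nonneg (u x + deriv u x), sq_nonneg (u x - deriv u x)]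
  have h := tendsto_zero_of_hasDerivAt_of_integrableOn_Ioi (a := 0) (fun x _ => hder x)
    hint.integrableOn hu2.integrableOn
  have h2 := (Real.continuous_sqrt.tendsto 0).comp h
  simp only [Real.sqrt_zero] at h2
  refine (tendsto_zero_iff_abs_tendsto_zero u).2 (h2.congr fun x => ?_)
  simp [Real.sqrt_sq_eq_abs]

open Filter Topology Set in
lemma aux_right (u : ℝ → ℝ) (b x0 : ℝ) (hb : 0 < b) (hu : ContDiff ℝ 1 u)
    (hu2 : Integrable (fun x => u x ^ 2)) (hdu2 : Integrable (fun x => deriv u x ^ 2))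
    (hu3 : Integrable (fun x => u x ^ 3))
    (hlim : Tendsto u atTop (𝓝 0)) (hmin : ∀ x, -2 * b ^ 2 ≤ u x) (hx0 : u x0 = -2 * b ^ 2) :
    32 / 15 * b ^ 5 ≤ ∫ x in Ioi x0, (1 / 2 * deriv u x ^ 2 + u x ^ 3 + 2 * b ^ 2 * u x ^ 2) ∧
    ((∫ x in Ioi x0, (1 / 2 * deriv u x ^ 2 + u x ^ 3 + 2 * b ^ 2 * u x ^ 2)) = 32 / 15 * b ^ 5 →
      ∃ x1, x0 ≤ x1 ∧ ∀ x, x1 ≤ x → u x = -2 * b ^ 2 * (1 / Real.cosh (b * (x - x1))) ^ 2) := by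
  have hd : Differentiable ℝ u := hu.differentiable (by norm_num)
  have hc : Continuous (deriv u) := hu.continuous_deriv (by norm_num)
  have huc := hu.continuous
  set w : ℝ → ℝ := fun x => √(2 * (u x + 2 * b ^ 2)) with hw
  have hwc : Continuous w := by fun_prop
  have hw2 : ∀ x, w x ^ 2 = 2 * (u x + 2 * b ^ 2) := fun x =>
    Real.sq_sqrt (by linarith [hmin x])
  have hw0 : ∀ x, 0 ≤ w x := fun x => Real.sqrt_nonneg _
  have hf : Integrable (fun x => 1 / 2 * deriv u x ^ 2 + u x ^ 3 + 2 * b ^ 2 * u x ^ 2) :=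
    ((hdu2.const_mul _).add hu3).add (hu2.const_mul _)
  have hsq : ∀ x, 1 / 2 * deriv u x ^ 2 + u x ^ 3 + 2 * b ^ 2 * u x ^ 2
      = 1 / 2 * (deriv u x + u x * w x) ^ 2 + (- (deriv u x * u x * w x)) := fun x => by
    linear_combination (-1 / 2 * u x ^ 2) * hw2 x
  have hsq' : ∀ x, 1 / 2 * deriv u x ^ 2 + u x ^ 3 + 2 * b ^ 2 * u x ^ 2
      = 1 / 2 * (deriv u x - u x * w x) ^ 2 + ((deriv u x * u x * w x)) := fun x => by
    linear_combination (-1 / 2 * u x ^ 2) * hw2 x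
  have hG' : Integrable (fun x => - (deriv u x * u x * w x)) := by
    refine hf.mono' (by fun_prop) (ae_of_all _ fun x => ?_)
    rw [Real.norm_eq_abs, abs_le]
    constructor
    · nlinarith [hsq' x, sq_nonneg (deriv u x - u x * w x)]
    · nlinarith [hsq x, sq_nonneg (deriv u x + u x * w x)]
  have hw3 : ∀ x, HasDerivAt (fun x => w x ^ 3) (3 * w x * deriv u x) x := fun x => by
    have h1 : HasDerivAt (fun x => 2 * (u x + 2 * b ^ 2)) (2 * deriv u x) x :=
      ((hd x).hasDerivAt.add_const _).const_mul 2
    have h2 := h1.rpow_const (p := 3 / 2) (Or.inr (by norm_num))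
    have e : (fun x => w x ^ 3) = fun x => (2 * (u x + 2 * b ^ 2)) ^ (3 / 2 : ℝ) := by
      funext y
      simp only [hw]
      rw [Real.sqrt_eq_rpow, ← Real.rpow_natCast, ← Real.rpow_mul (by linarith [hmin y])]
      norm_num
    rw [e]
    convert h2 using 1
    simp only [hw]
    rw [Real.sqrt_eq_rpow]
    norm_num
    ring
  have hG : ∀ x, HasDerivAt (fun x => w x ^ 3 * (2 * b ^ 2 / 3 - 2 * (u x + 2 * b ^ 2) / 10))
      (- (deriv u x * u x * w x)) x := fun x => by
    have h1 : HasDerivAt (fun x => 2 * b ^ 2 / 3 - 2 * (u x + 2 * b ^ 2) / 10)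
      (- (2 * deriv u x / 10)) x :=
      ((((hd x).hasDerivAt.add_const _).const_mul 2).div_const 10).const_sub _
    refine ((hw3 x).mul h1).congr_deriv ?_
    linear_combination (- w x * deriv u x / 5) * hw2 x
  have hwl : Tendsto w atTop (𝓝 (2 * b)) := by
    have : Tendsto w atTop (𝓝 (√(2 * (0 + 2 * b ^ 2)))) :=
      (Real.continuous_sqrt.tendsto _).comp ((hlim.add_const _).const_mul 2)
    rwa [show 2 * (0 + 2 * b ^ 2) = (2 * b) ^ 2 by ring, Real.sqrt_sq (by linarith)] at this
  have hGl : Tendsto (fun x => w x ^ 3 * (2 * b ^ 2 / 3 - 2 * (u x + 2 * b ^ 2) / 10)) atTop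
      (𝓝 (32 / 15 * b ^ 5)) := by
    have := (hwl.pow 3).mul ((((hlim.add_const (2 * b ^ 2)).const_mul 2).div_const 10).const_sub
      (2 * b ^ 2 / 3))
    convert this using 2
    ring
  have hwx0 : w x0 = 0 := by simp [hw, hx0]
  have hGint : ∫ x in Ioi x0, - (deriv u x * u x * w x) = 32 / 15 * b ^ 5 := by
    rw [integral_Ioi_of_hasDerivAt_of_tendsto' (fun x _ => hG x) hG'.integrableOn hGl, hwx0]
    ring
  have hS : Integrable (fun x => 1 / 2 * (deriv u x + u x * w x) ^ 2) := by
    refine (hf.sub hG').congr (ae_of_all _ fun x => ?_)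
    simp only [Pi.sub_apply]
    linarith [hsq x]
  have hsplit : ∫ x in Ioi x0, (1 / 2 * deriv u x ^ 2 + u x ^ 3 + 2 * b ^ 2 * u x ^ 2)
      = (∫ x in Ioi x0, 1 / 2 * (deriv u x + u x * w x) ^ 2) + 32 / 15 * b ^ 5 := by
    simp_rw [hsq]
    rw [integral_add hS.integrableOn hG'.integrableOn, hGint]
  have hSn : 0 ≤ ∫ x in Ioi x0, 1 / 2 * (deriv u x + u x * w x) ^ 2 :=
    integral_nonneg fun x => by positivity
  refine ⟨by linarith, fun heq => ?_⟩
  have hS0 : ∫ x in Ioi x0, 1 / 2 * (deriv u x + u x * w x) ^ 2 = 0 := by linarith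
  rw [integral_eq_zero_iff_of_nonneg (fun x => by simp only [Pi.zero_apply]; positivity) hS.integrableOn] at hS0
  have hEq := Measure.eqOn_open_of_ae_eq hS0 isOpen_Ioi (by fun_prop) (by fun_prop)
  have hode : ∀ x, x0 < x → deriv u x = - (u x * w x) := fun x hx => by
    have := hEq hx
    simp only [Pi.zero_apply] at this
    have h2 : deriv u x + u x * w x = 0 := by
      apply pow_eq_zero_iff (two_ne_zero) |>.1; linarith
    linarith
  -- last minimum point
  have hKne : {x | u x = -2 * b ^ 2}.Nonempty := ⟨x0, hx0⟩
  have hKb : BddAbove {x | u x = -2 * b ^ 2} := by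
    have : ∀ᶠ x in atTop, -2 * b ^ 2 < u x :=
      hlim.eventually (lt_mem_nhds (by nlinarith [sq_pos_of_pos hb]))
    obtain ⟨a, ha⟩ := eventually_atTop.1 this
    refine ⟨a, fun x hx => ?_⟩
    by_contra! h
    have := ha x h.le
    simp only [mem_ofPred_eq] at hx
    linarith
  have hKc : IsClosed {x | u x = -2 * b ^ 2} := isClosed_eq huc continuous_const
  obtain ⟨x1, hx1⟩ : ∃ x1, IsGreatest {x | u x = -2 * b ^ 2} x1 :=
    ⟨_, hKc.csSup_mem hKne hKb, fun x hx => le_csSup hKb hx⟩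
  have hx01 : x0 ≤ x1 := hx1.2 hx0
  refine ⟨x1, hx01, ?_⟩
  have hwx1 : w x1 = 0 := by simp [hw, show u x1 = -2 * b ^ 2 from hx1.1]
  have hupos : ∀ x, x1 < x → 0 < 2 * (u x + 2 * b ^ 2) := fun x hx => by
    rcases (hmin x).lt_or_eq with h | h
    · linarith
    · exact absurd (hx1.2 h.symm) (not_le.2 hx)
  have hwd : ∀ x, x1 < x → HasDerivAt w (2 * b ^ 2 - w x ^ 2 / 2) x := fun x hx => by
    have h1 : HasDerivAt (fun x => 2 * (u x + 2 * b ^ 2)) (2 * deriv u x) x :=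
      ((hd x).hasDerivAt.add_const _).const_mul 2
    refine (h1.sqrt (hupos x hx).ne').congr_deriv ?_
    have hwp : 0 < w x := Real.sqrt_pos.2 (hupos x hx)
    change 2 * deriv u x / (2 * w x) = _
    rw [hode x (hx01.trans_lt hx), hw2]
    field_simp
    ring
  set W : ℝ → ℝ := fun x => 2 * b * Real.tanh (b * (x - x1)) with hW
  have hWd : ∀ x, HasDerivAt W (2 * b ^ 2 - W x ^ 2 / 2) x := fun x => by
    refine ((aux_tanh_deriv b x1 x).const_mul (2 * b)).congr_deriv ?_
    simp only [hW]; ring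
  have hWc : Continuous W := continuous_iff_continuousAt.2 fun x => (hWd x).continuousAt
  have hWn : ∀ x, x1 ≤ x → 0 ≤ W x := fun x hx => by
    have : 0 ≤ Real.sinh (b * (x - x1)) :=
      Real.sinh_nonneg_iff.2 (mul_nonneg hb.le (by linarith))
    have h2 := Real.cosh_pos (b * (x - x1))
    simp only [hW]
    rw [Real.tanh_eq_sinh_div_cosh]
    positivity
  have hanti : AntitoneOn (fun x => (w x - W x) ^ 2) (Ici x1) := by
    have hD : ∀ x, x1 < x → HasDerivAt (fun x => (w x - W x) ^ 2)
        (- ((w x + W x) * (w x - W x) ^ 2)) x := fun x hx => by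
      refine (((hwd x hx).sub (hWd x)).pow 2).congr_deriv ?_
      simp only [Pi.sub_apply]; push_cast; ring
    refine antitoneOn_of_deriv_nonpos (convex_Ici _) (by fun_prop) ?_ ?_
    · intro x hx
      rw [interior_Ici] at hx
      exact (hD x hx).differentiableAt.differentiableWithinAt
    · intro x hx
      rw [interior_Ici] at hx
      rw [(hD x hx).deriv]
      have := hw0 x
      have := hWn x (le_of_lt hx)
      have : 0 ≤ (w x + W x) * (w x - W x) ^ 2 := by positivity
      linarith
  intro x hx
  have h1 := hanti (mem_Ici.2 le_rfl) (mem_Ici.2 hx) hx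
  have h2 : W x1 = 0 := by simp [hW]
  simp only [hwx1, h2, sub_zero] at h1
  have h3 : w x - W x = 0 := pow_eq_zero_iff two_ne_zero |>.1 (le_antisymm (by simpa using h1) (sq_nonneg _))
  have h4 : w x = 2 * b * Real.tanh (b * (x - x1)) := by simp only [hW] at h3; linarith
  have h5 := hw2 x
  rw [h4] at h5
  rw [aux_sech]
  linarith

open Filter Topology Set in
lemma aux_mass (u : ℝ → ℝ) (b x1 : ℝ) (hb : 0 < b)
    (hu2 : Integrable (fun x => u x ^ 2))
    (h : ∀ x, x1 ≤ x → u x = -2 * b ^ 2 * (1 / Real.cosh (b * (x - x1))) ^ 2) :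
    ∫ x in Ioi x1, u x ^ 2 = 8 / 3 * b ^ 3 := by
  have hder : ∀ x ∈ Ici x1, HasDerivAt (fun x => 4 * b ^ 3 * (Real.tanh (b * (x - x1))
      - Real.tanh (b * (x - x1)) ^ 3 / 3)) (u x ^ 2) x := fun x hx => by
    have := aux_tanh_deriv b x1 x
    refine ((this.sub ((this.pow 3).div_const 3)).const_mul (4 * b ^ 3)).congr_deriv ?_
    rw [h x hx, aux_sech]; push_cast; ring
  have hl := aux_tanh_lim' b x1 hb
  rw [integral_Ioi_of_hasDerivAt_of_tendsto' hder hu2.integrableOn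
    ((hl.sub ((hl.pow 3).div_const 3)).const_mul (4 * b ^ 3))]
  simp; ring

open Filter Topology Set in
lemma aux_energy (u : ℝ → ℝ) (b c : ℝ) (hb : 0 < b)
    (hf : Integrable (fun x => (1 / 2) * deriv u x ^ 2 + u x ^ 3))
    (h : ∀ x, u x = -2 * b ^ 2 * (1 / Real.cosh (b * (x - c))) ^ 2) :
    ∫ x, ((1 / 2) * deriv u x ^ 2 + u x ^ 3) = -(32 / 5) * b ^ 5 := by
  have hu : u = fun x => -2 * b ^ 2 * (1 - Real.tanh (b * (x - c)) ^ 2) := by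
    funext x; rw [h, aux_sech]
  have hdu : ∀ x, deriv u x = 4 * b ^ 3 * Real.tanh (b * (x - c))
      * (1 - Real.tanh (b * (x - c)) ^ 2) := fun x => by
    have := (((aux_tanh_deriv b c x).pow 2).const_sub 1).const_mul (-2 * b ^ 2)
    rw [hu]
    refine (this.congr_deriv ?_).deriv
    push_cast; ring
  have hder : ∀ x, HasDerivAt (fun x => 8 * b ^ 5 * (Real.tanh (b * (x - c)) ^ 3
      - Real.tanh (b * (x - c)) - 2 / 5 * Real.tanh (b * (x - c)) ^ 5))
      ((1 / 2) * deriv u x ^ 2 + u x ^ 3) x := fun x => by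
    have := aux_tanh_deriv b c x
    refine ((((this.pow 3).sub this).sub ((this.pow 5).const_mul (2 / 5))).const_mul
      (8 * b ^ 5)).congr_deriv ?_
    rw [hdu, h x, aux_sech]; push_cast; ring
  have hl := aux_tanh_lim' b c hb
  have hl' := aux_tanh_lim_bot b c hb
  rw [integral_of_hasDerivAt_of_tendsto hder hf
    ((((hl'.pow 3).sub hl').sub ((hl'.pow 5).const_mul (2 / 5))).const_mul (8 * b ^ 5))
    ((((hl.pow 3).sub hl).sub ((hl.pow 5).const_mul (2 / 5))).const_mul (8 * b ^ 5))]
  ring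

open Filter Topology Set in
theorem stmt_main (β : ℝ) (hβ : 0 < β) (u : ℝ → ℝ)
    (hu : ContDiff ℝ 1 u)
    (hu2 : Integrable (fun x => u x ^ 2))
    (hdu2 : Integrable (fun x => deriv u x ^ 2))
    (hcon : (∫ x : ℝ, (1 / 2) * u x ^ 2) = (8 / 3) * β ^ 3) :
    -(32 / 5) * β ^ 5 ≤ (∫ x : ℝ, ((1 / 2) * deriv u x ^ 2 + u x ^ 3)) ∧
    ((∫ x : ℝ, ((1 / 2) * deriv u x ^ 2 + u x ^ 3)) = -(32 / 5) * β ^ 5 ↔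
      ∃ c : ℝ, ∀ x, u x = -2 * β ^ 2 * (1 / Real.cosh (β * (x - c))) ^ 2) := by
  have huc := hu.continuous
  have hc : Continuous (deriv u) := hu.continuous_deriv (by norm_num)
  -- reflected function
  set v : ℝ → ℝ := fun x => u (-x) with hv
  have hvs : ContDiff ℝ 1 v := hu.comp contDiff_neg
  have hdv : ∀ x, deriv v x = - deriv u (-x) := fun x => deriv_comp_neg u x
  have hv2 : Integrable (fun x => v x ^ 2) := hu2.comp_neg
  have hdv2 : Integrable (fun x => deriv v x ^ 2) := by
    refine (hdu2.comp_neg).congr (ae_of_all _ fun x => ?_)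
    simp [hdv]
  have hlim := aux_decay u hu hu2 hdu2
  have hlimv := aux_decay v hvs hv2 hdv2
  have hlimb : Tendsto u atBot (𝓝 0) := by
    refine (hlimv.comp tendsto_neg_atBot_atTop).congr fun x => ?_
    simp [hv]
  have hlimc : Tendsto u (cocompact ℝ) (𝓝 0) := by
    rw [cocompact_eq_atBot_atTop]
    exact hlimb.sup hlim
  obtain ⟨C, hC⟩ : ∃ C, ∀ x, |u x| ≤ C := by
    have hfc : Continuous fun x => max |u x| 1 := by fun_prop
    obtain ⟨y, hy⟩ := hfc.exists_forall_ge' 0 (by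
      have : ∀ᶠ x in cocompact ℝ, |u x| < 1 := by
        have h := hlimc.abs
        rw [abs_zero] at h
        exact h.eventually (gt_mem_nhds one_pos)
      filter_upwards [this] with x hx
      exact max_le (hx.le.trans (le_max_right _ _)) (le_max_right _ _))
    exact ⟨_, fun x => (le_max_left _ _).trans (hy x)⟩
  have hu3 : Integrable (fun x => u x ^ 3) := by
    refine (hu2.const_mul C).mono' (by fun_prop) (ae_of_all _ fun x => ?_)
    rw [Real.norm_eq_abs, pow_succ, abs_mul, abs_of_nonneg (sq_nonneg _), mul_comm]
    exact mul_le_mul_of_nonneg_right (hC x) (sq_nonneg _)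
  have hv3 : Integrable (fun x => v x ^ 3) := hu3.comp_neg
  have hE : Integrable (fun x => (1 / 2) * deriv u x ^ 2 + u x ^ 3) := (hdu2.const_mul _).add hu3
  have hmass : ∫ x, u x ^ 2 = 16 / 3 * β ^ 3 := by
    rw [integral_const_mul] at hcon
    linarith
  have hβ5 : 0 < β ^ 5 := by positivity
  by_cases hneg : ∃ z, u z < 0
  swap
  · push Not at hneg
    have hpos : 0 ≤ ∫ x : ℝ, ((1 / 2) * deriv u x ^ 2 + u x ^ 3) :=
      integral_nonneg fun x => by have := hneg x; simp only [Pi.zero_apply]; positivity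
    refine ⟨by linarith, fun h => by linarith, fun ⟨c, h⟩ => ?_⟩
    exact aux_energy u β c hβ hE h
  obtain ⟨z, hz⟩ := hneg
  obtain ⟨x0, hx0⟩ := huc.exists_forall_le' z
    ((hlimc.eventually (lt_mem_nhds hz)).mono fun x hx => hx.le)
  obtain ⟨b, hb, hbx⟩ : ∃ b : ℝ, 0 < b ∧ u x0 = -2 * b ^ 2 := by
    have h0 : 0 < -u x0 / 2 := by linarith [hx0 z]
    refine ⟨√(-u x0 / 2), Real.sqrt_pos.2 h0, ?_⟩
    rw [Real.sq_sqrt h0.le]; ring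
  have hmin : ∀ x, -2 * b ^ 2 ≤ u x := fun x => hbx ▸ hx0 x
  obtain ⟨hR, hR'⟩ := aux_right u b x0 hb hu hu2 hdu2 hu3 hlim hmin hbx
  obtain ⟨hL, hL'⟩ := aux_right v b (-x0) hb hvs hv2 hdv2 hv3 hlimv (fun x => hmin (-x))
    (by simpa [hv] using hbx)
  have hrefl : ∫ x in Ioi (-x0), (1 / 2 * deriv v x ^ 2 + v x ^ 3 + 2 * b ^ 2 * v x ^ 2)
      = ∫ x in Iic x0, (1 / 2 * deriv u x ^ 2 + u x ^ 3 + 2 * b ^ 2 * u x ^ 2) := by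
    have := integral_comp_neg_Ioi (-x0)
      (fun x => 1 / 2 * deriv u x ^ 2 + u x ^ 3 + 2 * b ^ 2 * u x ^ 2)
    rw [neg_neg] at this
    rw [← this]
    simp only [hdv, neg_sq]
    rfl
  rw [hrefl] at hL hL'
  have hF : Integrable (fun x => 1 / 2 * deriv u x ^ 2 + u x ^ 3 + 2 * b ^ 2 * u x ^ 2) :=
    hE.add (hu2.const_mul _)
  have hsum := intervalIntegral.integral_Iic_add_Ioi (b := x0) hF.integrableOn hF.integrableOn
  have htot : ∫ x, (1 / 2 * deriv u x ^ 2 + u x ^ 3 + 2 * b ^ 2 * u x ^ 2)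
      = (∫ x, (1 / 2 * deriv u x ^ 2 + u x ^ 3)) + 2 * b ^ 2 * (16 / 3 * β ^ 3) := by
    rw [integral_add hE (hu2.const_mul _), integral_const_mul, hmass]
  -- algebraic inequality
  have hid : 64 / 15 * b ^ 5 - 32 / 3 * b ^ 2 * β ^ 3 + 32 / 5 * β ^ 5
      = 32 / 15 * (b - β) ^ 2 * (2 * b ^ 3 + 4 * b ^ 2 * β + 6 * b * β ^ 2 + 3 * β ^ 3) := by ring
  have hp : 0 < 2 * b ^ 3 + 4 * b ^ 2 * β + 6 * b * β ^ 2 + 3 * β ^ 3 := by positivity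
  have halg : 0 ≤ 64 / 15 * b ^ 5 - 32 / 3 * b ^ 2 * β ^ 3 + 32 / 5 * β ^ 5 := by
    rw [hid]; positivity
  refine ⟨by linarith, fun heq => ?_, fun ⟨c, h⟩ => aux_energy u β c hβ hE h⟩
  have hbβ : b = β := by
    have h0 : 32 / 15 * (b - β) ^ 2 * (2 * b ^ 3 + 4 * b ^ 2 * β + 6 * b * β ^ 2 + 3 * β ^ 3) = 0 := by
      rw [← hid]; linarith
    rcases mul_eq_zero.1 h0 with h | h
    · have : (b - β) ^ 2 = 0 := by linarith
      have := pow_eq_zero_iff two_ne_zero |>.1 this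
      linarith
    · linarith
  subst hbβ
  obtain ⟨x1, hx1, hu1⟩ := hR' (by nlinarith)
  obtain ⟨x2, hx2, hu2'⟩ := hL' (by nlinarith)
  have hm1 := aux_mass u b x1 hb hu2 hu1
  have hm2 := aux_mass v b x2 hb hv2 hu2'
  have hm3 : ∫ x in Iic (-x2), u x ^ 2 = 8 / 3 * b ^ 3 := by
    rw [← hm2]
    exact (integral_comp_neg_Ioi x2 (fun x => u x ^ 2)).symm
  have hs1 := intervalIntegral.integral_Iic_add_Ioi (b := x1) hu2.integrableOn hu2.integrableOn
  have hs2 := intervalIntegral.integral_Iic_sub_Iic (a := -x2) (b := x1)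
    hu2.integrableOn hu2.integrableOn
  have hmid : ∫ x in (-x2)..x1, u x ^ 2 = 0 := by linarith
  have hx12 : -x2 = x1 := by
    by_contra hne
    have hlt : -x2 < x1 := lt_of_le_of_ne (by linarith) hne
    have : 0 < ∫ x in (-x2)..x1, u x ^ 2 := by
      refine intervalIntegral.integral_pos hlt (by fun_prop) (fun x _ => sq_nonneg _)
        ⟨x1, ⟨hlt.le, le_rfl⟩, ?_⟩
      rw [hu1 x1 le_rfl]
      simp
      positivity
    linarith
  refine ⟨x1, fun x => ?_⟩
  rcases le_total x1 x with h | h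
  · exact hu1 x h
  · have := hu2' (-x) (by linarith)
    simp only [hv, neg_neg] at this
    rw [this, ← Real.cosh_neg]
    congr 4
    rw [← hx12]; ring

/-- **Variational characterization of the single soliton (`n = 1` case).**
Let `β > 0` and `e₁ = (8/3)β³`.  For every `C¹` function `u : ℝ → ℝ` with `u` and `u′`
square-integrable and `∫ (1/2)u² = e₁`, one has `∫ [(1/2)(u′)² + u³] ≥ -(32/5)β⁵`,
with equality if and only if `u(x) = -2β² sech²(β(x - c))` for some `c ∈ ℝ`. -/
theorem stmt_16 (β : ℝ) (hβ : 0 < β) (u : ℝ → ℝ)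
    (hu : ContDiff ℝ 1 u)
    (hu2 : Integrable (fun x => u x ^ 2))
    (hdu2 : Integrable (fun x => deriv u x ^ 2))
    (hcon : (∫ x : ℝ, (1 / 2) * u x ^ 2) = (8 / 3) * β ^ 3) :
    -(32 / 5) * β ^ 5 ≤ (∫ x : ℝ, ((1 / 2) * deriv u x ^ 2 + u x ^ 3)) ∧
    ((∫ x : ℝ, ((1 / 2) * deriv u x ^ 2 + u x ^ 3)) = -(32 / 5) * β ^ 5 ↔
      ∃ c : ℝ, ∀ x, u x = -2 * β ^ 2 * (1 / Real.cosh (β * (x - c))) ^ 2) := 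
  stmt_main β hβ u hu hu2 hdu2 hcon
end

section
/- For N ∈ {1, 2}, parameters β_1 > ⋯ > β_N > 0 and c ∈ ℝ^N, define the multisoliton Q_{β,c}(x) = −2 (d²/dx²) log det A(x), where A(x) is the N × N matrix with entries A_{jk}(x) = δ_{jk} + (β_j + β_k)^{−1} e^{−β_j(x − c_j) − β_k(x − c_k)}; for N = 0 set Q = 0. Define E_1(u) = ∫ (1/2)u² dx, E_2(u) = ∫ [(1/2)(u′)² + u³] dx, E_3(u) = ∫ [(1/2)(u″)² + 5u(u′)² + (5/2)u⁴] dx. Suppose (e_1, e_2) ∈ ℝ² is such that E_1(Q_{β,c}) = e_1 and E_2(Q_{β,c}) = e_2 for some N ∈ {0, 1, 2}, some β_1 > ⋯ > β_N > 0, and some c ∈ ℝ^N. Then: (i) the integer N and the parameters β_1 > ⋯ > β_N > 0 with this property are unique (and the values E_1(Q_{β,c}), E_2(Q_{β,c}), E_3(Q_{β,c}) do not depend on c); and (ii) for every twice continuously differentiable u : ℝ → ℝ with u, u′, u″ square-integrable, E_1(u) = e_1, and E_2(u) = e_2, one has E_3(u) ≥ E_3(Q_{β,c}), with equality if and only if u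 = Q_{β,c} for some c ∈ ℝ^N. -/
open MeasureTheory

/-- The matrix `A(x)` with entries
`A_{jk}(x) = δ_{jk} + (β_j + β_k)⁻¹ e^{-β_j(x - c_j) - β_k(x - c_k)}`. -/
noncomputable def solitonMatrix (N : ℕ) (β c : Fin N → ℝ) (x : ℝ) :
    Matrix (Fin N) (Fin N) ℝ :=
  fun j k => (if j = k then 1 else 0) +
    (β j + β k)⁻¹ * Real.exp (-(β j) * (x - c j) - β k * (x - c k))

/-- The multisoliton `Q_{β,c}(x) = -2 (d²/dx²) log det A(x)` (equal to `0` when `N = 0`,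
since the determinant of the empty matrix is `1`). -/
noncomputable def Qsol (N : ℕ) (β c : Fin N → ℝ) (x : ℝ) : ℝ :=
  -2 * deriv (deriv fun y => Real.log (solitonMatrix N β c y).det) x

/-- `E₁(u) = ∫ (1/2)u² dx`. -/
noncomputable def E1 (u : ℝ → ℝ) : ℝ := ∫ x : ℝ, (1 / 2) * u x ^ 2

/-- `E₂(u) = ∫ [(1/2)(u′)² + u³] dx`. -/
noncomputable def E2 (u : ℝ → ℝ) : ℝ :=
  ∫ x : ℝ, ((1 / 2) * deriv u x ^ 2 + u x ^ 3)

/-- `E₃(u) = ∫ [(1/2)(u″)² + 5u(u′)² + (5/2)u⁴] dx`. -/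
noncomputable def E3 (u : ℝ → ℝ) : ℝ :=
  ∫ x : ℝ, ((1 / 2) * deriv (deriv u) x ^ 2 + 5 * u x * deriv u x ^ 2 +
    (5 / 2) * u x ^ 4)


open Filter Topology Set

namespace KdV

/-- Continuous and square integrable. -/
structure L2 (f : ℝ → ℝ) : Prop where
  c : Continuous f
  i : Integrable (fun x => f x ^ 2)

/-- Continuous and bounded. -/
structure Bd (f : ℝ → ℝ) : Prop where
  c : Continuous f
  b : ∃ M, ∀ x, |f x| ≤ M

theorem L2.mul {f g : ℝ → ℝ} (hf : L2 f) (hg : L2 g) : Integrable (fun x => f x * g x) := by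
  refine ((hf.i.add hg.i)).mono' (hf.c.mul hg.c).aestronglyMeasurable (ae_of_all _ fun x => ?_)
  simp only [Pi.add_apply, Real.norm_eq_abs]
  rw [abs_le]; constructor <;> nlinarith [sq_nonneg (f x + g x), sq_nonneg (f x - g x), sq_nonneg (f x), sq_nonneg (g x)]

theorem L2.bmul {f g : ℝ → ℝ} (hf : Bd f) (hg : L2 g) : L2 (fun x => f x * g x) := by
  obtain ⟨M, hM⟩ := hf.b
  refine ⟨hf.c.mul hg.c, ?_⟩
  refine ((hg.i.const_mul (M^2))).mono' (by have := hf.c; have := hg.c; fun_prop) (ae_of_all _ fun x => ?_)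
  rw [Real.norm_eq_abs, abs_of_nonneg (sq_nonneg _), mul_pow]
  apply mul_le_mul_of_nonneg_right _ (sq_nonneg _)
  rw [← sq_abs]; exact pow_le_pow_left₀ (abs_nonneg _) (hM x) 2

theorem L2.add {f g : ℝ → ℝ} (hf : L2 f) (hg : L2 g) : L2 (fun x => f x + g x) := by
  refine ⟨hf.c.add hg.c, ?_⟩
  have := (hf.i.add hg.i).add ((hf.mul hg).const_mul 2)
  refine this.congr (ae_of_all _ fun x => ?_)
  simp only [Pi.add_apply]; ring

theorem L2.smul {f : ℝ → ℝ} (hf : L2 f) (k : ℝ) : L2 (fun x => k * f x) := by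
  refine ⟨hf.c.const_mul k |>.congr (fun _ => rfl), ?_⟩
  refine (hf.i.const_mul (k^2)).congr (ae_of_all _ fun x => ?_)
  simp only; ring

theorem L2.congr {f g : ℝ → ℝ} (hf : L2 f) (h : ∀ x, f x = g x) : L2 g := by
  have : f = g := funext h
  rwa [← this]

theorem Bd.congr {f g : ℝ → ℝ} (hf : Bd f) (h : ∀ x, f x = g x) : Bd g := by
  have : f = g := funext h
  rwa [← this]

theorem Bd.mul {f g : ℝ → ℝ} (hf : Bd f) (hg : Bd g) : Bd (fun x => f x * g x) := by
  obtain ⟨M, hM⟩ := hf.b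
  obtain ⟨M', hM'⟩ := hg.b
  refine ⟨hf.c.mul hg.c, M * M', fun x => ?_⟩
  rw [abs_mul]
  exact mul_le_mul (hM x) (hM' x) (abs_nonneg _) ((abs_nonneg _).trans (hM x))

theorem Bd.add {f g : ℝ → ℝ} (hf : Bd f) (hg : Bd g) : Bd (fun x => f x + g x) := by
  obtain ⟨M, hM⟩ := hf.b
  obtain ⟨M', hM'⟩ := hg.b
  exact ⟨hf.c.add hg.c, M + M', fun x => (abs_add_le _ _).trans (add_le_add (hM x) (hM' x))⟩

theorem Bd.const (k : ℝ) : Bd (fun _ => k) := ⟨continuous_const, |k|, fun _ => le_rfl⟩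

theorem Bd.pow {f : ℝ → ℝ} (hf : Bd f) (n : ℕ) : Bd (fun x => f x ^ n) := by
  induction n with
  | zero => exact (Bd.const 1).congr (by simp)
  | succ n ih => exact (ih.mul hf).congr (fun x => (pow_succ _ _).symm)

theorem tendsto_of_sq {f : ℝ → ℝ} {l : Filter ℝ} (h : Tendsto (fun x => f x ^ 2) l (𝓝 0)) :
    Tendsto f l (𝓝 0) := by
  have h2 := h.sqrt
  simp only [Real.sqrt_sq_eq_abs, Real.sqrt_zero] at h2
  exact (tendsto_zero_iff_abs_tendsto_zero _).2 h2

theorem sq_lim {f f' : ℝ → ℝ} (hf : L2 f) (hf' : L2 f') (hd : ∀ x, HasDerivAt f (f' x) x) :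
    Tendsto f atTop (𝓝 0) ∧ Tendsto f atBot (𝓝 0) := by
  have hd2 : ∀ x, HasDerivAt (fun x => f x ^ 2) (2 * (f x * f' x)) x := fun x => by
    have := (hd x).pow 2
    refine this.congr_deriv ?_
    push_cast; ring
  have hi : Integrable (fun x => 2 * (f x * f' x)) := (hf.mul hf').const_mul 2
  exact ⟨tendsto_of_sq (tendsto_zero_of_hasDerivAt_of_integrableOn_Ioi (a := 0) (fun x _ => hd2 x)
      hi.integrableOn hf.i.integrableOn),
    tendsto_of_sq (tendsto_zero_of_hasDerivAt_of_integrableOn_Iic (a := 0) (fun x _ => hd2 x)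
      hi.integrableOn hf.i.integrableOn)⟩

theorem bd_of_lim {f : ℝ → ℝ} (hc : Continuous f) {a b : ℝ} (h1 : Tendsto f atTop (𝓝 a))
    (h2 : Tendsto f atBot (𝓝 b)) : Bd f := by
  refine ⟨hc, ?_⟩
  obtain ⟨A, hA⟩ := (h1.abs.eventually (gt_mem_nhds (lt_add_one |a|))).exists_forall_of_atTop
  obtain ⟨B, hB⟩ := (h2.abs.eventually (gt_mem_nhds (lt_add_one |b|))).exists_forall_of_atBot
  obtain ⟨C, hC⟩ := (isCompact_Icc (a := B) (b := A)).exists_bound_of_continuousOn hc.continuousOn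
  refine ⟨max C (max (|a| + 1) (|b| + 1)), fun x => ?_⟩
  by_cases hx : A ≤ x
  · exact (hA x hx).le.trans ((le_max_left _ _).trans (le_max_right _ _))
  by_cases hx' : x ≤ B
  · exact (hB x hx').le.trans ((le_max_right _ _).trans (le_max_right _ _))
  · exact (hC x ⟨(not_le.1 hx').le, (not_le.1 hx).le⟩).trans (le_max_left _ _)

theorem sq_bd {f f' : ℝ → ℝ} (hf : L2 f) (hf' : L2 f') (hd : ∀ x, HasDerivAt f (f' x) x) :
    Bd f := by
  have := sq_lim hf hf' hd
  exact bd_of_lim hf.c this.1 this.2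

/-- The admissible class, in terms of explicit derivatives. -/
structure X3 (u u1 u2 : ℝ → ℝ) : Prop where
  d0 : ∀ x, HasDerivAt u (u1 x) x
  d1 : ∀ x, HasDerivAt u1 (u2 x) x
  l0 : L2 u
  l1 : L2 u1
  l2 : L2 u2

/-- The admissible class. -/
def XC (u : ℝ → ℝ) : Prop := ∃ u1 u2, X3 u u1 u2

theorem XC.of {u : ℝ → ℝ} (h : ContDiff ℝ 2 u) (h0 : Integrable (fun x => u x ^ 2))
    (h1 : Integrable (fun x => deriv u x ^ 2))
    (h2 : Integrable (fun x => deriv (deriv u) x ^ 2)) : XC u := by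
  have hd : ContDiff ℝ 1 (deriv u) := by
    have : ContDiff ℝ (1 + 1) u := by simpa [one_add_one_eq_two] using h
    exact (contDiff_succ_iff_deriv.1 this).2.2
  refine ⟨deriv u, deriv (deriv u), ⟨fun x => ?_, fun x => ?_, ⟨h.continuous, h0⟩,
    ⟨hd.continuous, h1⟩, ⟨hd.continuous_deriv le_rfl, h2⟩⟩⟩
  · exact (h.differentiable (by norm_num) x).hasDerivAt
  · exact (hd.differentiable (by norm_num) x).hasDerivAt

theorem X3.deriv1 {u u1 u2 : ℝ → ℝ} (h : X3 u u1 u2) : deriv u = u1 :=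
  funext fun x => (h.d0 x).deriv
theorem X3.deriv2 {u u1 u2 : ℝ → ℝ} (h : X3 u u1 u2) : deriv (deriv u) = u2 := by
  rw [h.deriv1]; exact funext fun x => (h.d1 x).deriv
theorem X3.b0 {u u1 u2 : ℝ → ℝ} (h : X3 u u1 u2) : Bd u := sq_bd h.l0 h.l1 h.d0
theorem X3.b1 {u u1 u2 : ℝ → ℝ} (h : X3 u u1 u2) : Bd u1 := sq_bd h.l1 h.l2 h.d1

theorem X3.E1 {u u1 u2 : ℝ → ℝ} (_h : X3 u u1 u2) : E1 u = ∫ x, (1/2) * u x ^ 2 := rfl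
theorem X3.E2 {u u1 u2 : ℝ → ℝ} (h : X3 u u1 u2) :
    E2 u = ∫ x, ((1/2) * u1 x ^ 2 + u x ^ 3) := by
  unfold _root_.E2; rw [h.deriv1]
theorem X3.E3 {u u1 u2 : ℝ → ℝ} (h : X3 u u1 u2) :
    E3 u = ∫ x, ((1/2) * u2 x ^ 2 + 5 * u x * u1 x ^ 2 + (5 / 2) * u x ^ 4) := by
  unfold _root_.E3; rw [h.deriv2, h.deriv1]

theorem X3.i1 {u u1 u2 : ℝ → ℝ} (h : X3 u u1 u2) : Integrable (fun x => (1/2) * u x ^ 2) :=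
  h.l0.i.const_mul _
theorem X3.i2 {u u1 u2 : ℝ → ℝ} (h : X3 u u1 u2) :
    Integrable (fun x => ((1/2) * u1 x ^ 2 + u x ^ 3)) := by
  refine ((h.l1.i.const_mul (1/2)).add (h.l0.mul (h.l0.bmul h.b0))).congr
    (ae_of_all _ fun x => ?_)
  simp only [Pi.add_apply]; ring
theorem X3.i3 {u u1 u2 : ℝ → ℝ} (h : X3 u u1 u2) :
    Integrable (fun x => ((1/2) * u2 x ^ 2 + 5 * u x * u1 x ^ 2 + (5 / 2) * u x ^ 4)) := by
  refine (((h.l2.i.const_mul (1/2)).add ((h.l1.mul (h.l1.bmul h.b0)).const_mul 5)).add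
    (((h.l0.bmul h.b0).i.const_mul (5/2)))).congr
    (ae_of_all _ fun x => ?_)
  simp only [Pi.add_apply]; ring

/-- Bounded global solutions of the Riccati equation at level `κ`. -/
structure Ric (u : ℝ → ℝ) (κ : ℝ) (w : ℝ → ℝ) : Prop where
  b : ∃ M, ∀ x, |w x| ≤ M
  d : ∀ x, HasDerivAt w (u x + κ ^ 2 - w x ^ 2) x

theorem Ric.bd {u w : ℝ → ℝ} {κ : ℝ} (h : Ric u κ w) : Bd w :=
  ⟨continuous_iff_continuousAt.2 fun x => (h.d x).continuousAt, h.b⟩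

/-- The Darboux transform. -/
def dar (u : ℝ → ℝ) (κ : ℝ) (w : ℝ → ℝ) : ℝ → ℝ := fun x => u x - 2 * (u x + κ ^ 2 - w x ^ 2)

theorem Ric.neg {u w : ℝ → ℝ} {κ : ℝ} (h : Ric u κ w) : Ric (dar u κ w) κ (fun x => - w x) := by
  refine ⟨?_, fun x => ?_⟩
  · obtain ⟨M, hM⟩ := h.b
    exact ⟨M, fun x => by simpa using hM x⟩
  · refine (h.d x).neg.congr_deriv ?_
    unfold dar; ring

theorem dar_dar {u w : ℝ → ℝ} {κ : ℝ} : dar (dar u κ w) κ (fun x => - w x) = u := by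
  funext x; unfold dar; ring

/-- All derivative data attached to a Riccati solution. -/
structure RD (u u1 u2 : ℝ → ℝ) (κ : ℝ) (w w1 w2 w3 g : ℝ → ℝ) : Prop where
  bw : Bd w
  hg : ∀ x, g x = w x ^ 2 - κ ^ 2
  d0 : ∀ x, HasDerivAt w (w1 x) x
  d1 : ∀ x, HasDerivAt w1 (w2 x) x
  d2 : ∀ x, HasDerivAt w2 (w3 x) x
  l1 : L2 w1
  l2 : L2 w2
  l3 : L2 w3
  lg : L2 g
  e0 : ∀ x, u x = w1 x + g x
  e1 : ∀ x, u1 x = w2 x + 2 * w x * w1 x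
  e2 : ∀ x, u2 x = w3 x + 2 * w1 x ^ 2 + 2 * w x * w2 x

theorem rd_of {u u1 u2 w : ℝ → ℝ} {κ : ℝ} (hu : X3 u u1 u2) (h : Ric u κ w) :
    ∃ w1 w2 w3 g, RD u u1 u2 κ w w1 w2 w3 g := by
  set w1 : ℝ → ℝ := fun x => u x + κ ^ 2 - w x ^ 2 with hw1
  set w2 : ℝ → ℝ := fun x => u1 x - 2 * w x * w1 x with hw2
  set w3 : ℝ → ℝ := fun x => u2 x - 2 * w1 x ^ 2 - 2 * w x * w2 x with hw3
  set g : ℝ → ℝ := fun x => w x ^ 2 - κ ^ 2 with hg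
  have bw := h.bd
  have cw := bw.c
  have d0 : ∀ x, HasDerivAt w (w1 x) x := h.d
  have d1 : ∀ x, HasDerivAt w1 (w2 x) x := fun x => by
    have := ((hu.d0 x).add_const (κ^2)).sub ((d0 x).pow 2)
    refine this.congr_deriv ?_
    simp only [hw2]; push_cast; ring
  have d2 : ∀ x, HasDerivAt w2 (w3 x) x := fun x => by
    have := (hu.d1 x).sub (((d0 x).const_mul 2).mul (d1 x))
    refine this.congr_deriv ?_
    simp only [hw3]; ring
  have c1 : Continuous w1 := by have := hu.l0.c; simp only [hw1]; fun_prop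
  have cg : Continuous g := by simp only [hg]; fun_prop
  have key : Integrable (fun x => w1 x ^ 2 + g x ^ 2) := by
    obtain ⟨M, hM⟩ := h.b
    have hM0 : 0 ≤ M := (abs_nonneg _).trans (hM 0)
    set I := (∫ x, u x ^ 2) + 4 * (M ^ 3 / 3 + κ ^ 2 * M)
    refine integrable_of_intervalIntegral_norm_bounded (a := fun n : ℝ => -n) (b := fun n : ℝ => n) (l := atTop)
      I (fun n => ?_) tendsto_neg_atTop_atBot tendsto_id ?_
    · exact ((c1.pow 2).add (cg.pow 2)).integrableOn_Ioc
    · filter_upwards [eventually_ge_atTop 0] with n hn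
      have e : ∀ x, ‖w1 x ^ 2 + g x ^ 2‖ = u x ^ 2 - 2 * (w x ^ 2 - κ ^ 2) * w1 x := fun x => by
        rw [Real.norm_eq_abs, abs_of_nonneg (by positivity)]
        have : u x = w1 x + g x := by simp only [hw1, hg]; ring
        rw [this]; ring
      simp_rw [e]
      have hF : ∀ x, HasDerivAt (fun x => 2 * (w x ^ 3 / 3 - κ ^ 2 * w x)) (2 * (w x ^ 2 - κ ^ 2) * w1 x) x := fun x => by
        have := ((((d0 x).pow 3).div_const 3).sub ((d0 x).const_mul (κ^2))).const_mul 2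
        refine this.congr_deriv ?_
        push_cast; ring
      have hcu : Continuous (fun x => u x ^ 2) := hu.l0.c.pow 2
      have hcF : Continuous (fun x => 2 * (w x ^ 2 - κ ^ 2) * w1 x) := by fun_prop
      rw [intervalIntegral.integral_sub (hcu.intervalIntegrable _ _) (hcF.intervalIntegrable _ _),
        intervalIntegral.integral_eq_sub_of_hasDerivAt (fun x _ => hF x) (hcF.intervalIntegrable _ _)]
      have h1 : ∫ x in (-n)..n, u x ^ 2 ≤ ∫ x, u x ^ 2 := by
        rw [intervalIntegral.integral_of_le (by linarith)]
        exact setIntegral_le_integral hu.l0.i (ae_of_all _ fun x => sq_nonneg _)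
      have hb : ∀ x, |2 * (w x ^ 3 / 3 - κ ^ 2 * w x)| ≤ 2 * (M ^ 3 / 3 + κ ^ 2 * M) := fun x => by
        rw [abs_mul, abs_two]
        apply mul_le_mul_of_nonneg_left _ (by norm_num)
        refine (abs_sub _ _).trans ?_
        rw [abs_div, abs_pow, abs_mul, abs_of_pos (by norm_num : (0:ℝ) < 3), abs_of_nonneg (sq_nonneg κ)]
        have := pow_le_pow_left₀ (abs_nonneg _) (hM x) 3
        have := mul_le_mul_of_nonneg_left (hM x) (sq_nonneg κ)
        linarith
      have := abs_le.1 (hb n)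
      have := abs_le.1 (hb (-n))
      simp only [I]; linarith
  have l1 : L2 w1 := ⟨c1, key.mono' (c1.pow 2).aestronglyMeasurable (ae_of_all _ fun x => by
    rw [Real.norm_eq_abs, abs_of_nonneg (sq_nonneg _)]; nlinarith [sq_nonneg (g x)])⟩
  have lg : L2 g := ⟨cg, key.mono' (cg.pow 2).aestronglyMeasurable (ae_of_all _ fun x => by
    rw [Real.norm_eq_abs, abs_of_nonneg (sq_nonneg _)]; nlinarith [sq_nonneg (w1 x)])⟩
  have l2 : L2 w2 := (hu.l1.add ((l1.bmul bw).smul (-2))).congr fun x => by simp only [hw2]; ring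
  have b1 : Bd w1 := sq_bd l1 l2 d1
  have l3 : L2 w3 := ((hu.l2.add ((l1.bmul b1).smul (-2))).add ((l2.bmul bw).smul (-2))).congr
    fun x => by simp only [hw3]; ring
  refine ⟨w1, w2, w3, g, bw, fun _ => rfl, d0, d1, d2, l1, l2, l3, lg, ?_, ?_, ?_⟩
  · intro x; simp only [hw1, hg]; ring
  · intro x; simp only [hw2]; ring
  · intro x; simp only [hw3]; ring

section
variable {u u1 u2 w w1 w2 w3 g : ℝ → ℝ} {κ : ℝ}

theorem RD.b1 (h : RD u u1 u2 κ w w1 w2 w3 g) : Bd w1 := sq_bd h.l1 h.l2 h.d1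
theorem RD.b2 (h : RD u u1 u2 κ w w1 w2 w3 g) : Bd w2 := sq_bd h.l2 h.l3 h.d2
theorem RD.lim1 (h : RD u u1 u2 κ w w1 w2 w3 g) :
    Tendsto w1 atTop (𝓝 0) ∧ Tendsto w1 atBot (𝓝 0) := sq_lim h.l1 h.l2 h.d1
theorem RD.lim2 (h : RD u u1 u2 κ w w1 w2 w3 g) :
    Tendsto w2 atTop (𝓝 0) ∧ Tendsto w2 atBot (𝓝 0) := sq_lim h.l2 h.l3 h.d2
theorem RD.limg (h : RD u u1 u2 κ w w1 w2 w3 g) :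
    Tendsto g atTop (𝓝 0) ∧ Tendsto g atBot (𝓝 0) := by
  refine sq_lim (f' := fun x => 2 * (w x * w1 x)) h.lg ((h.l1.bmul h.bw).smul 2) fun x => ?_
  have : g = fun x => w x ^ 2 - κ ^ 2 := funext h.hg
  rw [this]
  refine (((h.d0 x).pow 2).sub_const _).congr_deriv ?_
  push_cast; ring

theorem RD.dar (h : RD u u1 u2 κ w w1 w2 w3 g) :
    X3 (dar u κ w) (fun x => - w2 x + 2 * w x * w1 x)
      (fun x => - w3 x + 2 * w1 x ^ 2 + 2 * w x * w2 x) := by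
  have e : KdV.dar u κ w = fun x => - w1 x + (w x ^ 2 - κ ^ 2) := by
    funext x; unfold KdV.dar; rw [h.e0 x, h.hg x]; ring
  rw [e]
  refine ⟨fun x => ?_, fun x => ?_, ?_, ?_, ?_⟩
  · refine ((h.d1 x).neg.add (((h.d0 x).pow 2).sub_const (κ^2))).congr_deriv ?_
    push_cast; ring
  · refine ((h.d2 x).neg.add (((h.d0 x).const_mul 2).mul (h.d1 x))).congr_deriv ?_
    ring
  · exact ((h.l1.smul (-1)).add h.lg).congr fun x => by rw [h.hg]; ring
  · exact ((h.l2.smul (-1)).add ((h.l1.bmul h.bw).smul 2)).congr fun x => by ring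
  · exact (((h.l3.smul (-1)).add ((h.l1.bmul h.b1).smul 2)).add ((h.l2.bmul h.bw).smul 2)).congr
      fun x => by ring

end
end KdV

namespace KdV

theorem sgn_top {w : ℝ → ℝ} {κ : ℝ} (hκ : 0 < κ) (hc : Continuous w)
    (h : Tendsto (fun x => w x ^ 2) atTop (𝓝 (κ ^ 2))) :
    Tendsto w atTop (𝓝 κ) ∨ Tendsto w atTop (𝓝 (-κ)) := by
  obtain ⟨A, hA⟩ := (h.eventually (lt_mem_nhds (show 0 < κ ^ 2 by positivity))).exists_forall_of_atTop
  have hs := h.sqrt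
  simp only [Real.sqrt_sq_eq_abs, abs_of_pos hκ] at hs
  have hne : ∀ x, A ≤ x → w x ≠ 0 := fun x hx h0 => by
    have := hA x hx; rw [h0] at this; norm_num at this
  have hsign : (∀ x, A ≤ x → 0 < w x) ∨ (∀ x, A ≤ x → w x < 0) := by
    by_contra hcon
    push Not at hcon
    obtain ⟨⟨x, hx, hx0⟩, ⟨y, hy, hy0⟩⟩ := hcon
    have : (0:ℝ) ∈ w '' Ici A :=
      (isPreconnected_Ici (a := A)).image w hc.continuousOn |>.ordConnected.out
        (mem_image_of_mem w hx) (mem_image_of_mem w hy) ⟨hx0, hy0⟩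
    obtain ⟨z, hz, hz0⟩ := this
    exact hne z hz hz0
  rcases hsign with hp | hn
  · left
    refine hs.congr' ?_
    filter_upwards [eventually_ge_atTop A] with x hx
    exact abs_of_pos (hp x hx)
  · right
    refine hs.neg.congr' ?_
    filter_upwards [eventually_ge_atTop A] with x hx
    rw [abs_of_neg (hn x hx), neg_neg]

theorem sgn_bot {w : ℝ → ℝ} {κ : ℝ} (hκ : 0 < κ) (hc : Continuous w)
    (h : Tendsto (fun x => w x ^ 2) atBot (𝓝 (κ ^ 2))) :
    Tendsto w atBot (𝓝 κ) ∨ Tendsto w atBot (𝓝 (-κ)) := by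
  have := sgn_top (w := fun x => w (-x)) hκ (hc.comp continuous_neg)
    (h.comp tendsto_neg_atTop_atBot)
  rcases this with h | h
  · left; simpa [Function.comp_def] using h.comp tendsto_neg_atBot_atTop
  · right; simpa [Function.comp_def] using h.comp tendsto_neg_atBot_atTop

section
variable {u u1 u2 w w1 w2 w3 g : ℝ → ℝ} {κ : ℝ}

theorem RD.sgn (h : RD u u1 u2 κ w w1 w2 w3 g) (hκ : 0 < κ) :
    (Tendsto w atTop (𝓝 κ) ∨ Tendsto w atTop (𝓝 (-κ))) ∧
    (Tendsto w atBot (𝓝 κ) ∨ Tendsto w atBot (𝓝 (-κ))) := by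
  constructor
  · refine sgn_top hκ h.bw.c ?_
    have := h.limg.1.add_const (κ ^ 2)
    simpa [h.hg] using this
  · refine sgn_bot hκ h.bw.c ?_
    have := h.limg.2.add_const (κ ^ 2)
    simpa [h.hg] using this

theorem Ric.sgn (hu : XC u) (h : Ric u κ w) (hκ : 0 < κ) :
    (Tendsto w atTop (𝓝 κ) ∨ Tendsto w atTop (𝓝 (-κ))) ∧
    (Tendsto w atBot (𝓝 κ) ∨ Tendsto w atBot (𝓝 (-κ))) := by
  obtain ⟨u1, u2, hu⟩ := hu
  obtain ⟨w1, w2, w3, g, hr⟩ := rd_of hu h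
  exact hr.sgn hκ

theorem RD.lim_top (h : RD u u1 u2 κ w w1 w2 w3 g) {p : ℝ} (hp : Tendsto w atTop (𝓝 p))
    {F : ℝ × ℝ × ℝ → ℝ} (hF : Continuous F) :
    Tendsto (fun x => F (w x, w1 x, w2 x)) atTop (𝓝 (F (p, 0, 0))) :=
  (hF.tendsto (p, 0, 0)).comp (hp.prodMk_nhds (h.lim1.1.prodMk_nhds h.lim2.1))

theorem RD.lim_bot (h : RD u u1 u2 κ w w1 w2 w3 g) {p : ℝ} (hp : Tendsto w atBot (𝓝 p))
    {F : ℝ × ℝ × ℝ → ℝ} (hF : Continuous F) :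
    Tendsto (fun x => F (w x, w1 x, w2 x)) atBot (𝓝 (F (p, 0, 0))) :=
  (hF.tendsto (p, 0, 0)).comp (hp.prodMk_nhds (h.lim1.2.prodMk_nhds h.lim2.2))

theorem RD.ftc (h : RD u u1 u2 κ w w1 w2 w3 g) {p q : ℝ} (hp : Tendsto w atTop (𝓝 p))
    (hq : Tendsto w atBot (𝓝 q)) {F : ℝ × ℝ × ℝ → ℝ} (hF : Continuous F) {f : ℝ → ℝ}
    (hf : Integrable f) (hd : ∀ x, HasDerivAt (fun x => F (w x, w1 x, w2 x)) (f x) x) :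
    ∫ x, f x = F (p, 0, 0) - F (q, 0, 0) :=
  integral_of_hasDerivAt_of_tendsto hd hf (h.lim_bot hq hF) (h.lim_top hp hF)

theorem RD.E1_diff (hu : X3 u u1 u2) (h : RD u u1 u2 κ w w1 w2 w3 g) {p q : ℝ}
    (hp : Tendsto w atTop (𝓝 p)) (hq : Tendsto w atBot (𝓝 q)) :
    E1 u - E1 (KdV.dar u κ w) = (2/3 * p ^ 3 - 2 * κ ^ 2 * p) - (2/3 * q ^ 3 - 2 * κ ^ 2 * q) := by
  have hd := h.dar
  rw [hu.E1, hd.E1, ← integral_sub hu.i1 hd.i1]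
  refine h.ftc hp hq (F := fun z => 2/3 * z.1 ^ 3 - 2 * κ ^ 2 * z.1) (by fun_prop)
    (hu.i1.sub hd.i1) fun x => ?_
  refine ((((h.d0 x).pow 3).const_mul (2/3)).sub ((h.d0 x).const_mul (2 * κ^2))).congr_deriv ?_
  simp only [KdV.dar, h.e0, h.hg]; push_cast; ring

theorem RD.E2_diff (hu : X3 u u1 u2) (h : RD u u1 u2 κ w w1 w2 w3 g) {p q : ℝ}
    (hp : Tendsto w atTop (𝓝 p)) (hq : Tendsto w atBot (𝓝 q)) :
    E2 u - E2 (KdV.dar u κ w) = (6/5 * p ^ 5 - 4 * κ ^ 2 * p ^ 3 + 6 * κ ^ 4 * p) -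
      (6/5 * q ^ 5 - 4 * κ ^ 2 * q ^ 3 + 6 * κ ^ 4 * q) := by
  have hd := h.dar
  rw [hu.E2, hd.E2, ← integral_sub hu.i2 hd.i2]
  refine (h.ftc hp hq (F := fun z => 2 * z.1 * z.2.1 ^ 2 + (6/5 * z.1 ^ 5 - 4 * κ ^ 2 * z.1 ^ 3 + 6 * κ ^ 4 * z.1)) (by fun_prop)
    (hu.i2.sub hd.i2) fun x => ?_).trans ?_
  swap
  · simp
  refine ((((h.d0 x).const_mul 2).mul ((h.d1 x).pow 2)).add
    (((((h.d0 x).pow 5).const_mul (6/5)).sub (((h.d0 x).pow 3).const_mul (4 * κ^2))).add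
      ((h.d0 x).const_mul (6 * κ^4)))).congr_deriv ?_
  simp only [KdV.dar, h.e0, h.e1, h.hg, Pi.pow_apply, Pi.sub_apply]; push_cast; ring

theorem RD.E3_diff (hu : X3 u u1 u2) (h : RD u u1 u2 κ w w1 w2 w3 g) {p q : ℝ}
    (hp : Tendsto w atTop (𝓝 p)) (hq : Tendsto w atBot (𝓝 q)) :
    E3 u - E3 (KdV.dar u κ w) =
      (20/7 * p ^ 7 - 12 * κ ^ 2 * p ^ 5 + 20 * κ ^ 4 * p ^ 3 - 20 * κ ^ 6 * p) -
      (20/7 * q ^ 7 - 12 * κ ^ 2 * q ^ 5 + 20 * κ ^ 4 * q ^ 3 - 20 * κ ^ 6 * q) := by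
  have hd := h.dar
  rw [hu.E3, hd.E3, ← integral_sub hu.i3 hd.i3]
  refine (h.ftc hp hq (F := fun z => 2 * z.1 * z.2.2 ^ 2 + 4 * z.2.1 ^ 2 * z.2.2 +
      (20 * z.1 ^ 3 - 20 * κ ^ 2 * z.1) * z.2.1 ^ 2 +
      (20/7 * z.1 ^ 7 - 12 * κ ^ 2 * z.1 ^ 5 + 20 * κ ^ 4 * z.1 ^ 3 - 20 * κ ^ 6 * z.1))
    (by fun_prop) (hu.i3.sub hd.i3) fun x => ?_).trans ?_
  swap
  · simp
  refine ((((((h.d0 x).const_mul 2).mul ((h.d2 x).pow 2)).add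
    ((((h.d1 x).pow 2).const_mul 4).mul (h.d2 x))).add
    (((((h.d0 x).pow 3).const_mul 20).sub ((h.d0 x).const_mul (20 * κ^2))).mul ((h.d1 x).pow 2))).add
    ((((((h.d0 x).pow 7).const_mul (20/7)).sub (((h.d0 x).pow 5).const_mul (12 * κ^2))).add
      (((h.d0 x).pow 3).const_mul (20 * κ^4))).sub ((h.d0 x).const_mul (20 * κ^6)))).congr_deriv ?_
  simp only [KdV.dar, h.e0, h.e1, h.e2, h.hg, Pi.pow_apply, Pi.sub_apply, Pi.add_apply, Pi.mul_apply]; push_cast; ring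

theorem RD.F2 (hu : X3 u u1 u2) (h : RD u u1 u2 κ w w1 w2 w3 g) {p : ℝ}
    (hp : Tendsto w atTop (𝓝 p)) (hq : Tendsto w atBot (𝓝 p)) :
    0 ≤ E2 u + 4 * κ ^ 2 * E1 u := by
  have hl := (h.l2.add ((h.lg.bmul h.bw).smul (-1)))
  have hS : Integrable (fun x => 1/2 * (w2 x + -1 * (w x * g x)) ^ 2 + 2 * (w x * w1 x) ^ 2 +
      1/2 * (w x * g x) ^ 2 + κ ^ 2 * g x ^ 2) :=
    (((hl.i.const_mul _).add ((h.l1.bmul h.bw).i.const_mul _)).add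
      ((h.lg.bmul h.bw).i.const_mul _)).add (h.lg.i.const_mul _)
  have hP := hu.i2.add (hu.i1.const_mul (4 * κ ^ 2))
  have e : E2 u + 4 * κ ^ 2 * E1 u = ∫ x, (((1/2) * u1 x ^ 2 + u x ^ 3) + 4 * κ ^ 2 * ((1/2) * u x ^ 2)) := by
    rw [hu.E2, hu.E1, ← integral_const_mul, ← integral_add hu.i2 (hu.i1.const_mul _)]
  have := h.ftc hp hq (F := fun z => z.1 * z.2.1 ^ 2 + (z.1 ^ 3 - κ ^ 2 * z.1) * z.2.1 +
      (3/5 * z.1 ^ 5 - 2/3 * κ ^ 2 * z.1 ^ 3 - κ ^ 4 * z.1)) (by fun_prop) (hP.sub hS) fun x => by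
    refine ((((h.d0 x).mul ((h.d1 x).pow 2)).add
      ((((h.d0 x).pow 3).sub ((h.d0 x).const_mul (κ^2))).mul (h.d1 x))).add
      (((((h.d0 x).pow 5).const_mul (3/5)).sub (((h.d0 x).pow 3).const_mul (2/3 * κ^2))).sub
        ((h.d0 x).const_mul (κ^4)))).congr_deriv ?_
    simp only [h.e0, h.e1, h.hg, Pi.pow_apply, Pi.sub_apply, Pi.add_apply]; push_cast; ring
  rw [sub_self] at this
  have h2 := integral_sub hP hS
  simp only [Pi.add_apply, Pi.sub_apply] at h2 this
  rw [this] at h2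
  rw [e, sub_eq_zero.1 h2.symm]
  exact integral_nonneg fun x => by positivity

theorem RD.F3 (hu : X3 u u1 u2) (h : RD u u1 u2 κ w w1 w2 w3 g) {p : ℝ}
    (hp : Tendsto w atTop (𝓝 p)) (hq : Tendsto w atBot (𝓝 p)) :
    0 ≤ E3 u + 8 * κ ^ 2 * E2 u + 16 * κ ^ 4 * E1 u := by
  have bw2 : Bd (fun x => w x ^ 2) := h.bw.pow 2
  have lww1 : L2 (fun x => w x ^ 2 * w1 x) := h.l1.bmul bw2
  have lwg : L2 (fun x => w x ^ 2 * g x) := h.lg.bmul bw2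
  have la := (h.l3.add (lww1.smul (-6))).add (h.l1.smul (κ^2))
  have lb := ((h.l2.bmul h.bw).add (lwg.smul (-(6/5)))).add (h.lg.smul (-(11/10)*κ^2))
  have lm := lww1.add (h.l1.smul (-(17/50) * κ^2))
  have hS : Integrable (fun x => 1/2 * (w3 x + -6 * (w x ^ 2 * w1 x) + κ ^ 2 * w1 x) ^ 2 +
      (5 * (w x ^ 2 * w1 x + -(17/50) * κ ^ 2 * w1 x) ^ 2 + (61/500) * κ ^ 4 * w1 x ^ 2) +
      (w x * w2 x + -(6/5) * (w x ^ 2 * g x) + -(11/10) * κ ^ 2 * g x) ^ 2 +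
      1/2 * (w1 x * w1 x) ^ 2 +
      (53/50 * (w x ^ 2 * g x) ^ 2 + 9/25 * κ ^ 2 * (w x * g x) ^ 2 + 129/100 * κ ^ 4 * g x ^ 2)) :=
    ((((la.i.const_mul _).add ((lm.i.const_mul _).add (h.l1.i.const_mul _))).add lb.i).add
      ((h.l1.bmul h.b1).i.const_mul _)).add
      (((lwg.i.const_mul _).add ((h.lg.bmul h.bw).i.const_mul _)).add (h.lg.i.const_mul _))
  have hP := (hu.i3.add (hu.i2.const_mul (8 * κ ^ 2))).add (hu.i1.const_mul (16 * κ ^ 4))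
  have e : E3 u + 8 * κ ^ 2 * E2 u + 16 * κ ^ 4 * E1 u =
      ∫ x, (((1/2) * u2 x ^ 2 + 5 * u x * u1 x ^ 2 + (5 / 2) * u x ^ 4) +
        8 * κ ^ 2 * ((1/2) * u1 x ^ 2 + u x ^ 3) + 16 * κ ^ 4 * ((1/2) * u x ^ 2)) := by
    rw [hu.E3, hu.E2, hu.E1, ← integral_const_mul, ← integral_const_mul,
      ← integral_add hu.i3 (hu.i2.const_mul _), ← integral_add _ (hu.i1.const_mul _)]
    exact hu.i3.add (hu.i2.const_mul _)
  have := h.ftc hp hq (F := fun z => z.1 * z.2.2 ^ 2 + 2 * z.2.1 ^ 2 * z.2.2 +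
      (6 * z.1 ^ 2 - κ ^ 2) * (z.2.1 * z.2.2) + 4 * z.1 * z.2.1 ^ 3 +
      (10 * z.1 ^ 3 - 2 * κ ^ 2 * z.1) * z.2.1 ^ 2 +
      (12/5 * z.1 ^ 5 - 1/5 * κ ^ 2 * z.1 ^ 3 - 11/5 * κ ^ 4 * z.1) * z.2.1 +
      (10/7 * z.1 ^ 7 - 6/5 * κ ^ 2 * z.1 ^ 5 - 2/3 * κ ^ 4 * z.1 ^ 3 - 2 * κ ^ 6 * z.1))
      (by fun_prop) (hP.sub hS) fun x => by
    have w0 := h.d0 x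
    have w1' := h.d1 x
    have w2' := h.d2 x
    refine (((((((w0.mul (w2'.pow 2)).add (((w1'.pow 2).const_mul 2).mul w2')).add
      ((((w0.pow 2).const_mul 6).sub_const (κ^2)).mul (w1'.mul w2'))).add
      ((w0.const_mul 4).mul (w1'.pow 3))).add
      ((((w0.pow 3).const_mul 10).sub (w0.const_mul (2 * κ^2))).mul (w1'.pow 2))).add
      (((((w0.pow 5).const_mul (12/5)).sub ((w0.pow 3).const_mul (1/5 * κ^2))).sub
        (w0.const_mul (11/5 * κ^4))).mul w1')).add
      (((((w0.pow 7).const_mul (10/7)).sub ((w0.pow 5).const_mul (6/5 * κ^2))).sub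
        ((w0.pow 3).const_mul (2/3 * κ^4))).sub (w0.const_mul (2 * κ^6)))).congr_deriv ?_
    simp only [h.e0, h.e1, h.e2, h.hg, Pi.pow_apply, Pi.sub_apply, Pi.add_apply, Pi.mul_apply]
    push_cast; ring
  rw [sub_self] at this
  have h2 := integral_sub hP hS
  simp only [Pi.add_apply, Pi.sub_apply] at h2 this
  rw [this] at h2
  rw [e, sub_eq_zero.1 h2.symm]
  exact integral_nonneg fun x => by positivity
end

/-- Normalised energies drop by a soliton. -/
theorem drop {u w : ℝ → ℝ} {κ : ℝ} (hu : XC u) (h : Ric u κ w)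
    (hp : Tendsto w atTop (𝓝 (-κ))) (hq : Tendsto w atBot (𝓝 κ)) :
    XC (dar u κ w) ∧ E1 u = E1 (dar u κ w) + 8/3 * κ ^ 3 ∧
      E2 u = E2 (dar u κ w) - 32/5 * κ ^ 5 ∧ E3 u = E3 (dar u κ w) + 128/7 * κ ^ 7 := by
  obtain ⟨u1, u2, hu⟩ := hu
  obtain ⟨w1, w2, w3, g, hr⟩ := rd_of hu h
  have a1 := hr.E1_diff hu hp hq
  have a2 := hr.E2_diff hu hp hq
  have a3 := hr.E3_diff hu hp hq
  refine ⟨⟨_, _, hr.dar⟩, ?_, ?_, ?_⟩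
  · linear_combination a1
  · linear_combination a2
  · linear_combination a3

/-- Normalised energies grow by a soliton. -/
theorem grow {u w : ℝ → ℝ} {κ : ℝ} (hu : XC u) (h : Ric u κ w)
    (hp : Tendsto w atTop (𝓝 κ)) (hq : Tendsto w atBot (𝓝 (-κ))) :
    XC (dar u κ w) ∧ E1 (dar u κ w) = E1 u + 8/3 * κ ^ 3 ∧
      E2 (dar u κ w) = E2 u - 32/5 * κ ^ 5 ∧ E3 (dar u κ w) = E3 u + 128/7 * κ ^ 7 := by
  obtain ⟨u1, u2, hu⟩ := hu
  obtain ⟨w1, w2, w3, g, hr⟩ := rd_of hu h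
  have a1 := hr.E1_diff hu hp hq
  have a2 := hr.E2_diff hu hp hq
  have a3 := hr.E3_diff hu hp hq
  refine ⟨⟨_, _, hr.dar⟩, ?_, ?_, ?_⟩
  · linear_combination -a1
  · linear_combination -a2
  · linear_combination -a3

theorem F23 {u w : ℝ → ℝ} {κ : ℝ} (hu : XC u) (h : Ric u κ w)
    (hp : Tendsto w atTop (𝓝 κ)) (hq : Tendsto w atBot (𝓝 κ)) :
    0 ≤ E2 u + 4 * κ ^ 2 * E1 u ∧ 0 ≤ E3 u + 8 * κ ^ 2 * E2 u + 16 * κ ^ 4 * E1 u := by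
  obtain ⟨u1, u2, hu⟩ := hu
  obtain ⟨w1, w2, w3, g, hr⟩ := rd_of hu h
  exact ⟨hr.F2 hu hp hq, hr.F3 hu hp hq⟩

end KdV

namespace KdV

/-- Truncation to `[-M, M]`. -/
noncomputable def tr (M y : ℝ) : ℝ := max (-M) (min y M)

theorem tr_abs {M : ℝ} (hM : 0 < M) (y : ℝ) : |tr M y| ≤ M := by
  unfold tr; rw [abs_le]; constructor
  · exact le_max_left _ _
  · exact max_le (by linarith) (min_le_right _ _)

theorem tr_self {M y : ℝ} (h : |y| ≤ M) : tr M y = y := by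
  unfold tr; rw [abs_le] at h
  rw [min_eq_left h.2, max_eq_right h.1]

theorem tr_neg {M : ℝ} (hM : 0 < M) (y : ℝ) : tr M (-y) = - tr M y := by
  unfold tr
  grind

theorem tr_lip {M : ℝ} (y z : ℝ) : |tr M y - tr M z| ≤ |y - z| := by
  unfold tr
  refine (abs_max_sub_max_le_max _ _ _ _).trans ?_
  rw [sub_self, abs_zero]
  refine max_le (abs_nonneg _) ((abs_min_sub_min_le_max _ _ _ _).trans ?_)
  simp

theorem tr_sq_lip {M : ℝ} (hM : 0 < M) (y z : ℝ) :
    |tr M y ^ 2 - tr M z ^ 2| ≤ 2 * M * |y - z| := by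
  have : tr M y ^ 2 - tr M z ^ 2 = (tr M y + tr M z) * (tr M y - tr M z) := by ring
  rw [this, abs_mul]
  refine mul_le_mul ?_ (tr_lip y z) (abs_nonneg _) (by linarith)
  refine (abs_add_le _ _).trans ?_
  linarith [tr_abs hM y, tr_abs hM z]

/-- The truncated Riccati equation. -/
def Tr (u : ℝ → ℝ) (M l : ℝ) (v : ℝ → ℝ) : Prop :=
  ∀ x, HasDerivAt v (u x + l - tr M (v x) ^ 2) x

theorem fld_lip {u : ℝ → ℝ} {M l : ℝ} (hM : 0 < M) (x : ℝ) :
    LipschitzWith (Real.toNNReal (2 * M)) (fun y => u x + l - tr M y ^ 2) := by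
  refine LipschitzWith.of_dist_le_mul fun y z => ?_
  rw [Real.dist_eq, Real.dist_eq, Real.coe_toNNReal _ (by linarith)]
  have : u x + l - tr M y ^ 2 - (u x + l - tr M z ^ 2) = -(tr M y ^ 2 - tr M z ^ 2) := by ring
  rw [this, abs_neg]
  exact tr_sq_lip hM y z

theorem Tr.unique {u : ℝ → ℝ} {M l : ℝ} (hM : 0 < M) {v v' : ℝ → ℝ} (h : Tr u M l v)
    (h' : Tr u M l v') {x0 : ℝ} (e : v x0 = v' x0) : v = v' :=
  ODE_solution_unique_univ (v := fun x y => u x + l - tr M y ^ 2) (s := fun _ => univ)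
    (fun x => (fld_lip hM x).lipschitzOnWith)
    (fun x => ⟨h x, mem_univ _⟩) (fun x => ⟨h' x, mem_univ _⟩) e

theorem Tr.cont {u : ℝ → ℝ} {M l : ℝ} {v : ℝ → ℝ} (h : Tr u M l v) : Continuous v :=
  continuous_iff_continuousAt.2 fun x => (h x).continuousAt

theorem Tr.lt {u : ℝ → ℝ} {M l : ℝ} (hM : 0 < M) {v v' : ℝ → ℝ} (h : Tr u M l v)
    (h' : Tr u M l v') (e : v 0 < v' 0) (x : ℝ) : v x < v' x := by
  by_contra hx
  push Not at hx
  have hc : Continuous (fun x => v' x - v x) := h'.cont.sub h.cont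
  have : ∃ y, v' y - v y = 0 := by
    have := mem_range_of_exists_le_of_exists_ge hc (c := 0) ⟨x, by linarith⟩ ⟨0, by linarith⟩
    exact this
  obtain ⟨y, hy⟩ := this
  have := h.unique hM h' (x0 := y) (by linarith)
  rw [this] at e
  exact lt_irrefl _ e

theorem Tr.le {u : ℝ → ℝ} {M l : ℝ} (hM : 0 < M) {v v' : ℝ → ℝ} (h : Tr u M l v)
    (h' : Tr u M l v') (e : v 0 ≤ v' 0) (x : ℝ) : v x ≤ v' x := by
  rcases e.lt_or_eq with e | e
  · exact (h.lt hM h' e x).le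
  · rw [h.unique hM h' e]

theorem Tr.ex_local {u : ℝ → ℝ} (hu : Bd u) {M : ℝ} (hM : 0 < M) (l s : ℝ) {R : ℝ} (hR : 0 < R) :
    ∃ v : ℝ → ℝ, v 0 = s ∧ ∀ x ∈ Ioo (-R) R, HasDerivAt v (u x + l - tr M (v x) ^ 2) x := by
  obtain ⟨B, hB⟩ := hu.b
  have hB0 : 0 ≤ B := (abs_nonneg _).trans (hB 0)
  have hL0 : 0 ≤ B + |l| + M ^ 2 := by positivity
  have h0 : (0 : ℝ) ∈ Icc (-R) R := ⟨by linarith, by linarith⟩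
  have key : IsPicardLindelof (fun x y => u x + l - tr M y ^ 2) (⟨0, h0⟩ : Icc (-R) R) s
      (Real.toNNReal ((B + |l| + M ^ 2) * R)) 0 (Real.toNNReal (B + |l| + M ^ 2))
      (Real.toNNReal (2 * M)) := by
    refine ⟨fun t _ => (fld_lip hM t).lipschitzOnWith, fun x _ => ?_, fun t _ x _ => ?_, ?_⟩
    · exact (hu.c.add continuous_const |>.sub continuous_const).continuousOn
    · rw [Real.coe_toNNReal _ hL0, Real.norm_eq_abs]
      refine (abs_sub _ _).trans ?_
      have h1 := abs_add_le (u t) l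
      have h2 : |tr M x ^ 2| ≤ M ^ 2 := by
        rw [abs_pow]; exact pow_le_pow_left₀ (abs_nonneg _) (tr_abs hM x) 2
      linarith [hB t]
    · rw [Real.coe_toNNReal _ hL0, Real.coe_toNNReal _ (by positivity)]
      simp
  obtain ⟨α, h1, h2⟩ := key.exists_eq_forall_mem_Icc_hasDerivWithinAt₀
  exact ⟨α, h1, fun x hx => (h2 x (Ioo_subset_Icc_self hx)).hasDerivAt (Icc_mem_nhds hx.1 hx.2)⟩

theorem Tr.ex {u : ℝ → ℝ} (hu : Bd u) {M : ℝ} (hM : 0 < M) (l s : ℝ) :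
    ∃ v : ℝ → ℝ, v 0 = s ∧ Tr u M l v := by
  have := fun x : ℝ => Tr.ex_local hu hM l s (R := |x| + 1) (by positivity)
  choose α h0 h1 using this
  refine ⟨fun x => α x x, h0 0, fun x => ?_⟩
  have hx : x ∈ Ioo (-(|x| + 1)) (|x| + 1) := by
    have := abs_le.1 (le_refl |x|)
    exact ⟨by linarith, by linarith⟩
  refine (h1 x x hx).congr_of_eventuallyEq ?_
  filter_upwards [Ioo_mem_nhds hx.1 hx.2] with y hy
  have hy' := abs_le.1 (le_refl |y|)
  set m := min (|x| + 1) (|y| + 1) with hm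
  have m1 : m ≤ |x| + 1 := min_le_left _ _
  have m2 : m ≤ |y| + 1 := min_le_right _ _
  have m0 : 0 < m := lt_min (by positivity) (by positivity)
  have hym : |y| < m := lt_min (abs_lt.2 hy) (by linarith)
  refine ODE_solution_unique_of_mem_Ioo (v := fun x y => u x + l - tr M y ^ 2)
    (s := fun _ => univ) (K := Real.toNNReal (2 * M)) (a := -m) (b := m) (t₀ := 0)
    (fun x _ => (fld_lip hM x).lipschitzOnWith)
    ⟨by linarith, m0⟩ (fun z hz => ⟨h1 y z ⟨by linarith [hz.1], by linarith [hz.2]⟩, mem_univ _⟩)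
    (fun z hz => ⟨h1 x z ⟨by linarith [hz.1], by linarith [hz.2]⟩, mem_univ _⟩)
    (by rw [h0, h0]) (abs_lt.1 hym)

theorem Tr.refl {u : ℝ → ℝ} {M l : ℝ} (hM : 0 < M) {v : ℝ → ℝ} (h : Tr u M l v) :
    Tr (fun x => u (-x)) M l (fun x => - v (-x)) := fun x => by
  have := ((h (-x)).comp x (hasDerivAt_neg x)).neg
  refine this.congr_deriv ?_
  rw [tr_neg hM]; ring

theorem Tr.dep_fwd {u : ℝ → ℝ} {M : ℝ} (hM : 0 < M) {x : ℝ} (hx : 0 ≤ x) {l l' : ℝ}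
    {v v' : ℝ → ℝ} (h : Tr u M l v) (h' : Tr u M l' v') :
    |v x - v' x| ≤ (Real.exp (2 * M * x) * (1 + 1 / (2 * M))) * (|v 0 - v' 0| + |l - l'|) := by
  have := dist_le_of_approx_trajectories_ODE (v := fun x y => u x + l - tr M y ^ 2)
    (K := Real.toNNReal (2 * M)) (f := v) (g := v') (a := 0) (b := x) (εf := 0) (εg := |l - l'|)
    (δ := |v 0 - v' 0|) (fun x => fld_lip hM x) h.cont.continuousOn
    (fun t _ => (h t).hasDerivWithinAt) (fun t _ => by simp) h'.cont.continuousOn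
    (fun t _ => (h' t).hasDerivWithinAt) (fun t _ => by
      rw [Real.dist_eq, abs_sub_comm]
      apply le_of_eq; congr 1; ring) (le_of_eq (Real.dist_eq _ _)) x ⟨hx, le_rfl⟩
  rw [Real.coe_toNNReal _ (by linarith), gronwallBound_of_K_ne_0 (by linarith), Real.dist_eq] at this
  refine this.trans ?_
  simp only [zero_add, sub_zero]
  have e1 : 0 < Real.exp (2 * M * x) := Real.exp_pos _
  have : |v 0 - v' 0| * Real.exp (2 * M * x) + |l - l'| / (2 * M) * (Real.exp (2 * M * x) - 1)
    = Real.exp (2 * M * x) * |v 0 - v' 0| + Real.exp (2 * M * x) * (1 / (2 * M)) * |l - l'|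
      - |l - l'| * (1 / (2 * M)) := by ring
  rw [this]
  have p1 : 0 ≤ |l - l'| * (1 / (2 * M)) := by positivity
  have p2 : 0 ≤ Real.exp (2 * M * x) * (1 / (2 * M)) * |v 0 - v' 0| := by positivity
  have p3 : 0 ≤ Real.exp (2 * M * x) * |l - l'| := by positivity
  nlinarith

theorem Tr.dep {u : ℝ → ℝ} {M : ℝ} (hM : 0 < M) (x : ℝ) : ∃ C : ℝ, 0 < C ∧ ∀ (l l' : ℝ)
    (v v' : ℝ → ℝ), Tr u M l v → Tr u M l' v' →
    |v x - v' x| ≤ C * (|v 0 - v' 0| + |l - l'|) := by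
  refine ⟨Real.exp (2 * M * |x|) * (1 + 1 / (2 * M)), by positivity, fun l l' v v' h h' => ?_⟩
  rcases le_total 0 x with hx | hx
  · rw [abs_of_nonneg hx]; exact h.dep_fwd hM hx h'
  · have := (h.refl hM).dep_fwd hM (x := -x) (by linarith) (h'.refl hM)
    rw [abs_of_nonpos hx]
    simp only [neg_neg, neg_zero] at this
    rw [neg_sub_neg, neg_sub_neg, abs_sub_comm, abs_sub_comm (v' 0)] at this
    exact this

/-- Trapping lemmas. -/
theorem up_top {f f' : ℝ → ℝ} (hd : ∀ x, HasDerivAt f (f' x) x) {a m : ℝ}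
    (h : ∀ x, a ≤ x → f x = m → 0 < f' x) (h0 : m ≤ f a) {x : ℝ} (hx : a ≤ x) : m ≤ f x := by
  have hc : Continuous f := continuous_iff_continuousAt.2 fun x => (hd x).continuousAt
  have := image_le_of_deriv_right_lt_deriv_boundary (f := fun x => - f x) (f' := fun x => - f' x)
    (a := a) (b := x) (B := fun _ => -m) (B' := fun _ => 0) hc.neg.continuousOn
    (fun y _ => (hd y).neg.hasDerivWithinAt) (by linarith) (fun y => hasDerivAt_const _ _)
    (fun y hy e => by linarith [h y hy.1 (by linarith)]) ⟨hx, le_rfl⟩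
  linarith

theorem up_bot {f f' : ℝ → ℝ} (hd : ∀ x, HasDerivAt f (f' x) x) {a m : ℝ}
    (h : ∀ x, x ≤ a → f x = m → 0 < f' x) (h0 : f a ≤ m) {x : ℝ} (hx : x ≤ a) : f x ≤ m := by
  have := up_top (f := fun x => - f (-x)) (f' := fun x => f' (-x)) (a := -a) (m := -m) (fun x => by
    refine ((hd (-x)).comp x (hasDerivAt_neg x)).neg.congr_deriv ?_
    ring) (fun x hx e => h (-x) (by linarith) (by linarith)) (by simpa using h0) (x := -x)
    (by linarith)
  simp only [neg_neg] at this
  linarith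

theorem dn_top {f f' : ℝ → ℝ} (hd : ∀ x, HasDerivAt f (f' x) x) {a m : ℝ}
    (h : ∀ x, a ≤ x → f x = m → f' x < 0) (h0 : f a ≤ m) {x : ℝ} (hx : a ≤ x) : f x ≤ m := by
  have := up_top (f := fun x => - f x) (f' := fun x => - f' x) (fun x => (hd x).neg) (a := a)
    (m := -m) (fun x hx e => by linarith [h x hx (by linarith)]) (by linarith) hx
  linarith

theorem dn_bot {f f' : ℝ → ℝ} (hd : ∀ x, HasDerivAt f (f' x) x) {a m : ℝ}
    (h : ∀ x, x ≤ a → f x = m → f' x < 0) (h0 : m ≤ f a) {x : ℝ} (hx : x ≤ a) : m ≤ f x := by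
  have := up_bot (f := fun x => - f x) (f' := fun x => - f' x) (fun x => (hd x).neg) (a := a)
    (m := -m) (fun x hx e => by linarith [h x hx (by linarith)]) (by linarith) hx
  linarith

/-- `M` is an admissible truncation level. -/
structure Lev (u : ℝ → ℝ) (M l : ℝ) : Prop where
  p : 0 < M
  h : ∀ x, u x + l + 1 ≤ M ^ 2

theorem Lev.mono {u : ℝ → ℝ} {M l l' : ℝ} (h : Lev u M l) (hl : l' ≤ l) : Lev u M l' :=
  ⟨h.p, fun x => by linarith [h.h x]⟩

theorem Lev.ex {u : ℝ → ℝ} (hu : Bd u) (l : ℝ) : ∃ M, Lev u M l := by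
  obtain ⟨B, hB⟩ := hu.b
  refine ⟨1 + |B| + |l|, by positivity, fun x => ?_⟩
  have := (le_abs_self _).trans ((hB x).trans (le_abs_self _))
  nlinarith [abs_nonneg B, abs_nonneg l, le_abs_self l]

theorem Tr.bar_bot {u : ℝ → ℝ} {M l : ℝ} (hM : Lev u M l) {v : ℝ → ℝ} (h : Tr u M l v) {x1 x : ℝ}
    (h1 : M ≤ v x1) (hx : x ≤ x1) : M ≤ v x :=
  dn_bot h (fun y _ e => by
    rw [e, tr_self (abs_of_pos hM.p).le]; linarith [hM.h y]) h1 hx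

theorem Tr.bar_top {u : ℝ → ℝ} {M l : ℝ} (hM : Lev u M l) {v : ℝ → ℝ} (h : Tr u M l v) {x1 x : ℝ}
    (h1 : v x1 ≤ -M) (hx : x1 ≤ x) : v x ≤ -M :=
  dn_top h (fun y _ e => by
    rw [e, tr_self (by rw [abs_neg, abs_of_pos hM.p]), neg_sq]; linarith [hM.h y]) h1 hx

theorem Ric.lt_M {u : ℝ → ℝ} {M κ : ℝ} (hM : Lev u M (κ ^ 2)) {w : ℝ → ℝ} (h : Ric u κ w) (x : ℝ) :
    w x < M := by
  by_contra hx
  push Not at hx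
  have hb : ∀ y, y ≤ x → M ≤ w y := fun y hy => dn_bot h.d (fun z _ e => by
    rw [e]; linarith [hM.h z]) hx hy
  obtain ⟨B, hB⟩ := h.b
  have hB0 : 0 ≤ B := (abs_nonneg _).trans (hB 0)
  have := Convex.image_sub_le_mul_sub_of_deriv_le (convex_Iic x) (f := w) (C := -1)
    (fun y _ => (h.d y).continuousAt.continuousWithinAt)
    (fun y _ => (h.d y).differentiableAt.differentiableWithinAt) (fun y hy => by
      rw [interior_Iic] at hy
      rw [(h.d y).deriv]
      have := hb y (le_of_lt hy)
      nlinarith [hM.h y, hM.p]) (x - 2 * B - 1) (by simp; linarith) x (by simp) (by linarith)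
  have h1 := abs_le.1 (hB (x - 2 * B - 1))
  have h2 := abs_le.1 (hB x)
  linarith

theorem Ric.gt_M {u : ℝ → ℝ} {M κ : ℝ} (hM : Lev u M (κ ^ 2)) {w : ℝ → ℝ} (h : Ric u κ w) (x : ℝ) :
    -M < w x := by
  have hr : Ric (fun x => u (-x)) κ (fun x => - w (-x)) := by
    refine ⟨?_, fun x => ?_⟩
    · obtain ⟨B, hB⟩ := h.b
      exact ⟨B, fun x => by rw [abs_neg]; exact hB _⟩
    · refine ((h.d (-x)).comp x (hasDerivAt_neg x)).neg.congr_deriv ?_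
      ring
  have := hr.lt_M (M := M) ⟨hM.p, fun x => hM.h _⟩ (-x)
  simp only [neg_neg] at this
  linarith

theorem Ric.tr {u : ℝ → ℝ} {M κ : ℝ} (hM : Lev u M (κ ^ 2)) {w : ℝ → ℝ} (h : Ric u κ w) :
    Tr u M (κ ^ 2) w := fun x => by
  rw [tr_self (abs_le.2 ⟨(h.gt_M hM x).le, (h.lt_M hM x).le⟩)]
  exact h.d x

theorem Tr.ric_of {u : ℝ → ℝ} {M κ : ℝ} {v : ℝ → ℝ} (h : Tr u M (κ ^ 2) v)
    (hb : ∀ x, |v x| ≤ M) : Ric u κ v :=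
  ⟨⟨M, hb⟩, fun x => by have := h x; rwa [tr_self (hb x)] at this⟩

theorem Tr.ric {u : ℝ → ℝ} {M κ : ℝ} (hM : Lev u M (κ ^ 2)) {v : ℝ → ℝ} (h : Tr u M (κ ^ 2) v)
    (hbot : ∃ a, ∀ x, x ≤ a → v x < M) (htop : ∃ a, ∀ x, a ≤ x → -M < v x) : Ric u κ v := by
  refine h.ric_of fun x => abs_le.2 ⟨?_, ?_⟩
  · by_contra hx
    push Not at hx
    obtain ⟨a, ha⟩ := htop
    exact absurd (h.bar_top hM hx.le (le_max_left x a)) (not_le.2 (ha _ (le_max_right _ _)))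
  · by_contra hx
    push Not at hx
    obtain ⟨a, ha⟩ := hbot
    exact absurd (h.bar_bot hM hx.le (min_le_left x a)) (not_le.2 (ha _ (min_le_right _ _)))

/-- Trapping in the asymptotic region. -/
theorem Tr.trap_top {u : ℝ → ℝ} {M l η a : ℝ} {v : ℝ → ℝ} (h : Tr u M l v)
    (hη : |η| ≤ M) (hu : ∀ x, a ≤ x → η ^ 2 < u x + l) (h0 : η ≤ v a) {x : ℝ} (hx : a ≤ x) :
    η ≤ v x :=
  up_top h (fun y hy e => by rw [e, tr_self hη]; linarith [hu y hy]) h0 hx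

theorem Tr.trap_bot {u : ℝ → ℝ} {M l η a : ℝ} {v : ℝ → ℝ} (h : Tr u M l v)
    (hη : |η| ≤ M) (hu : ∀ x, x ≤ a → η ^ 2 < u x + l) (h0 : v a ≤ η) {x : ℝ} (hx : x ≤ a) :
    v x ≤ η :=
  up_bot h (fun y hy e => by rw [e, tr_self hη]; linarith [hu y hy]) h0 hx

end KdV

namespace KdV

theorem XC.bd {u : ℝ → ℝ} (h : XC u) : Bd u := by
  obtain ⟨u1, u2, h⟩ := h; exact h.b0

theorem XC.lim {u : ℝ → ℝ} (h : XC u) : Tendsto u atTop (𝓝 0) ∧ Tendsto u atBot (𝓝 0) := by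
  obtain ⟨u1, u2, h⟩ := h; exact sq_lim h.l0 h.l1 h.d0

theorem ex_large {u : ℝ → ℝ} (hu : Bd u) : ∃ κ > 0, ∃ w, Ric u κ w := by
  obtain ⟨B, hB⟩ := hu.b
  have hB0 : 0 ≤ B := (abs_nonneg _).trans (hB 0)
  refine ⟨B + 1, by linarith, ?_⟩
  obtain ⟨M, hM⟩ := Lev.ex hu ((B + 1) ^ 2)
  obtain ⟨v, hv0, hv⟩ := Tr.ex hu hM.p ((B + 1) ^ 2) 0
  have hp := hM.p
  have hpos : ∀ x, (0 : ℝ) ^ 2 < u x + (B + 1) ^ 2 := fun x => by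
    have := (abs_le.1 (hB x)).1
    nlinarith
  refine ⟨v, hv.ric hM ⟨0, fun x hx => ?_⟩ ⟨0, fun x hx => ?_⟩⟩
  · have := hv.trap_bot (η := 0) (a := 0) (by simp; exact hp.le) (fun y _ => hpos y) hv0.le hx
    linarith
  · have := hv.trap_top (η := 0) (a := 0) (by simp; exact hp.le) (fun y _ => hpos y) hv0.ge hx
    linarith

theorem Tr.closed {u : ℝ → ℝ} {M l s : ℝ} (hM : 0 < M) {v : ℝ → ℝ} (hv : Tr u M l v)
    (hs : v 0 = s)
    (h : ∀ ε > 0, ∃ l' v', |l - l'| < ε ∧ |s - v' 0| < ε ∧ Tr u M l' v' ∧ ∀ x, |v' x| ≤ M) (x : ℝ) :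
    |v x| ≤ M := by
  refine le_of_forall_pos_le_add fun ε hε => ?_
  obtain ⟨C, hC, hd⟩ := Tr.dep (u := u) hM x
  obtain ⟨l', v', h1, h2, h3, h4⟩ := h (ε / (2 * C)) (by positivity)
  have := hd _ _ _ _ hv h3
  rw [hs] at this
  have e : C * (|s - v' 0| + |l - l'|) ≤ ε := by
    calc C * (|s - v' 0| + |l - l'|) ≤ C * (ε / (2 * C) + ε / (2 * C)) := by gcongr
      _ = ε := by field_simp; ring
  have t : |v x| ≤ |v' x| + |v x - v' x| := by
    have := abs_add_le (v' x) (v x - v' x)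
    rwa [add_sub_cancel] at this
  linarith [h4 x]

theorem asym {u : ℝ → ℝ} (hu : XC u) {κ M : ℝ} (hκ : 0 < κ) (hM : Lev u M (κ ^ 2)) :
    κ / 2 ≤ M ∧ ∃ R, (∀ x, R ≤ x → |u x| < κ ^ 2 / 4) ∧ (∀ x, x ≤ -R → |u x| < κ ^ 2 / 4) := by
  have hk : |(0:ℝ)| < κ ^ 2 / 4 := by rw [abs_zero]; positivity
  obtain ⟨A, hA⟩ := (hu.lim.1.abs.eventually (gt_mem_nhds hk)).exists_forall_of_atTop
  obtain ⟨B, hB⟩ := (hu.lim.2.abs.eventually (gt_mem_nhds hk)).exists_forall_of_atBot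
  constructor
  · have h1 := abs_lt.1 (hA A le_rfl)
    have h2 := hM.h A
    by_contra hc
    push Not at hc
    nlinarith [hM.p]
  · exact ⟨max A (-B), fun x hx => hA x ((le_max_left _ _).trans hx), fun x hx => hB x (by
      have := le_max_right A (-B); linarith)⟩

theorem pert {a C : ℝ} (hC : 0 < C) (ha : 0 < a) : ∃ ε > 0, C * (2 * ε) ≤ a :=
  ⟨a / (2 * C), by positivity, by apply le_of_eq; field_simp⟩

theorem max_sol {u : ℝ → ℝ} (hu : XC u) {κ : ℝ} (hκ : 0 < κ) {w0 : ℝ → ℝ} (h0 : Ric u κ w0) :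
    ∃ w, Ric u κ w ∧ Tendsto w atBot (𝓝 κ) ∧ ∀ x, w0 x ≤ w x := by
  obtain ⟨M, hM⟩ := Lev.ex hu.bd (κ ^ 2)
  set S : Set ℝ := {s | ∃ v, Ric u κ v ∧ v 0 = s} with hS
  have hbdd : BddAbove S := ⟨M, by rintro s ⟨v, hv, rfl⟩; exact (hv.lt_M hM 0).le⟩
  have hne : S.Nonempty := ⟨w0 0, w0, h0, rfl⟩
  obtain ⟨v, hv0, hv⟩ := Tr.ex hu.bd hM.p (κ ^ 2) (sSup S)
  have hb : ∀ x, |v x| ≤ M := hv.closed hM.p hv0 fun ε hε => by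
    obtain ⟨s, ⟨v', hv', e⟩, hs⟩ := exists_lt_of_lt_csSup hne (sub_lt_self (sSup S) hε)
    refine ⟨κ ^ 2, v', by simpa using hε, ?_, hv'.tr hM, fun x =>
      abs_le.2 ⟨(hv'.gt_M hM x).le, (hv'.lt_M hM x).le⟩⟩
    have := le_csSup hbdd ⟨v', hv', e⟩
    rw [e, abs_of_nonneg (by linarith)]; linarith
  have hr : Ric u κ v := hv.ric_of hb
  refine ⟨v, hr, ?_, fun x => (h0.tr hM).le hM.p hv (by rw [hv0]; exact le_csSup hbdd ⟨w0, h0, rfl⟩) x⟩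
  rcases (hr.sgn hu hκ).2 with h | h
  · exact h
  exfalso
  obtain ⟨hMk, R, -, hR⟩ := asym hu hκ hM
  obtain ⟨A, hA⟩ := (h.eventually (gt_mem_nhds (show -κ < -(κ/2) by linarith))).exists_forall_of_atBot
  set L := min A (-R)
  have hL : v L < -(κ/2) := hA L (min_le_left _ _)
  obtain ⟨C, hC, hd⟩ := Tr.dep (u := u) hM.p L
  obtain ⟨ε, hε, he⟩ := pert hC (show 0 < -(κ/2) - v L by linarith)
  obtain ⟨z, hz0, hz⟩ := Tr.ex hu.bd hM.p (κ ^ 2) (sSup S + ε)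
  have hdz := hd _ _ _ _ hz hv
  rw [hz0, hv0, sub_self, abs_zero, add_zero, add_sub_cancel_left, abs_of_pos hε] at hdz
  have hzL : z L ≤ -(κ/2) := by
    have := (abs_le.1 hdz).2
    nlinarith
  have hzr : Ric u κ z := hz.ric hM ⟨L, fun x hx => by
      have := hz.trap_bot (η := -(κ/2)) (a := L) (by rw [abs_neg, abs_of_pos (by linarith)]; exact hMk)
        (fun y hy => by
          have := abs_lt.1 (hR y (hy.trans (min_le_right _ _)))
          nlinarith) hzL hx
      linarith [hM.p]⟩ ⟨0, fun x _ => (hr.gt_M hM x).trans (hv.lt hM.p hz (by rw [hv0, hz0]; linarith) x)⟩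
  have := le_csSup hbdd ⟨z, hzr, rfl⟩
  linarith

theorem lower_sol {u : ℝ → ℝ} (hu : XC u) {κ : ℝ} (hκ : 0 < κ) {w : ℝ → ℝ} (h : Ric u κ w)
    (ht : Tendsto w atTop (𝓝 κ)) (hb : Tendsto w atBot (𝓝 κ)) :
    ∃ v, Ric u κ v ∧ Tendsto v atTop (𝓝 κ) ∧ Tendsto v atBot (𝓝 (-κ)) := by
  obtain ⟨M, hM⟩ := Lev.ex hu.bd (κ ^ 2)
  obtain ⟨hMk, R, hR, -⟩ := asym hu hκ hM
  obtain ⟨A, hA⟩ := (ht.eventually (lt_mem_nhds (show κ/2 < κ by linarith))).exists_forall_of_atTop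
  set L := max A R
  have hL : κ/2 < w L := hA L (le_max_left _ _)
  obtain ⟨C, hC, hd⟩ := Tr.dep (u := u) hM.p L
  obtain ⟨ε, hε, he⟩ := pert hC (show 0 < w L - κ/2 by linarith)
  have hw := h.tr hM
  obtain ⟨z, hz0, hz⟩ := Tr.ex hu.bd hM.p (κ ^ 2) (w 0 - ε)
  have hdz := hd _ _ _ _ hw hz
  rw [hz0, sub_self, abs_zero, add_zero, sub_sub_cancel, abs_of_pos hε] at hdz
  have hzL : κ/2 ≤ z L := by
    have := (abs_le.1 hdz).2
    nlinarith
  have htrap : ∀ x, L ≤ x → κ/2 ≤ z x := fun x hx =>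
    hz.trap_top (η := κ/2) (a := L) (by rw [abs_of_pos (by linarith)]; exact hMk)
      (fun y hy => by
        have := abs_lt.1 (hR y ((le_max_right _ _).trans hy))
        nlinarith) hzL hx
  have hlt : ∀ x, z x < w x := hz.lt hM.p hw (by rw [hz0]; linarith)
  have hzr : Ric u κ z := hz.ric hM ⟨0, fun x _ => (hlt x).trans (h.lt_M hM x)⟩
    ⟨L, fun x hx => by linarith [htrap x hx, hM.p]⟩
  refine ⟨z, hzr, ?_, ?_⟩
  · rcases (hzr.sgn hu hκ).1 with h' | h'
    · exact h'
    exfalso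
    have := ge_of_tendsto h' (eventually_atTop.2 ⟨L, htrap⟩)
    linarith
  · rcases (hzr.sgn hu hκ).2 with h' | h'
    swap
    · exact h'
    exfalso
    have hs : Tendsto (fun x => w x + z x) atBot (𝓝 (κ + κ)) := hb.add h'
    obtain ⟨B, hB⟩ := (hs.eventually (lt_mem_nhds (show 0 < κ + κ by linarith))).exists_forall_of_atBot
    have hanti : AntitoneOn (fun x => w x - z x) (Iic B) := by
      refine antitoneOn_of_deriv_nonpos (convex_Iic B)
        ((h.bd.c.sub hzr.bd.c).continuousOn) (fun y _ =>
          ((h.d y).sub (hzr.d y)).differentiableAt.differentiableWithinAt) fun y hy => ?_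
      rw [interior_Iic] at hy
      have e : deriv (fun x => w x - z x) y = -((w y + z y) * (w y - z y)) := by
        exact ((h.d y).sub (hzr.d y)).deriv.trans (by ring)
      rw [e]
      have := mul_pos (hB y (le_of_lt hy)) (sub_pos.2 (hlt y))
      linarith
    have hl : Tendsto (fun x => w x - z x) atBot (𝓝 (κ - κ)) := hb.sub h'
    have := ge_of_tendsto hl (eventually_atBot.2 ⟨B, fun x hx =>
      hanti (a := x) (b := B) hx (by simp) hx⟩)
    simp only at this
    linarith [hlt B]

theorem open_sol {u : ℝ → ℝ} (hu : XC u) {κ : ℝ} (hκ : 0 < κ) {w : ℝ → ℝ} (h : Ric u κ w)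
    (ht : Tendsto w atTop (𝓝 κ)) (hb : Tendsto w atBot (𝓝 κ)) :
    ∃ κ', 0 < κ' ∧ κ' < κ ∧ ∃ v, Ric u κ' v := by
  obtain ⟨v, hv, vt, vb⟩ := lower_sol hu hκ h ht hb
  obtain ⟨M, hM⟩ := Lev.ex hu.bd (κ ^ 2)
  obtain ⟨hMk, R, hR, hR'⟩ := asym hu hκ hM
  obtain ⟨A, hA⟩ := (vt.eventually (lt_mem_nhds (show κ/2 < κ by linarith))).exists_forall_of_atTop
  obtain ⟨A', hA'⟩ := (vb.eventually (gt_mem_nhds (show -κ < -(κ/2) by linarith))).exists_forall_of_atBot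
  set L := max A R
  set L' := min A' (-R)
  have hL : κ/2 < v L := hA L (le_max_left _ _)
  have hL' : v L' < -(κ/2) := hA' L' (min_le_left _ _)
  obtain ⟨C, hC, hd⟩ := Tr.dep (u := u) hM.p L
  obtain ⟨C', hC', hd'⟩ := Tr.dep (u := u) hM.p L'
  obtain ⟨ε, hε, he⟩ := pert hC (show 0 < v L - κ/2 by linarith)
  obtain ⟨ε', hε', he'⟩ := pert hC' (show 0 < -(κ/2) - v L' by linarith)
  set δ := min (min ε ε') (κ ^ 2 / 2) with hδ
  have hδ0 : 0 < δ := lt_min (lt_min hε hε') (by positivity)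
  have d1 : δ ≤ ε := (min_le_left _ _).trans (min_le_left _ _)
  have d2 : δ ≤ ε' := (min_le_left _ _).trans (min_le_right _ _)
  have d3 : δ ≤ κ ^ 2 / 2 := min_le_right _ _
  have hl0 : 0 < κ ^ 2 - δ := by nlinarith
  set κ' := Real.sqrt (κ ^ 2 - δ) with hκ'
  have hsq : κ' ^ 2 = κ ^ 2 - δ := Real.sq_sqrt hl0.le
  have hκ'0 : 0 < κ' := Real.sqrt_pos.2 hl0
  refine ⟨κ', hκ'0, ?_, ?_⟩
  · exact lt_of_pow_lt_pow_left₀ 2 hκ.le (by linarith)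
  have hv' := hv.tr hM
  obtain ⟨z, hz0, hz⟩ := Tr.ex hu.bd hM.p (κ' ^ 2) (v 0)
  have hM' : Lev u M (κ' ^ 2) := hM.mono (by linarith)
  have hdl : |κ ^ 2 - κ' ^ 2| = δ := by rw [hsq, sub_sub_cancel, abs_of_pos hδ0]
  have a1 := hd _ _ _ _ hv' hz
  have a2 := hd' _ _ _ _ hv' hz
  rw [hz0, sub_self, abs_zero, zero_add, hdl] at a1 a2
  have hzL : κ/2 ≤ z L := by
    have := (abs_le.1 a1).2
    nlinarith
  have hzL' : z L' ≤ -(κ/2) := by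
    have := (abs_le.1 a2).1
    nlinarith
  refine ⟨z, hz.ric hM' ⟨L', fun x hx => ?_⟩ ⟨L, fun x hx => ?_⟩⟩
  · have := hz.trap_bot (η := -(κ/2)) (a := L') (by rw [abs_neg, abs_of_pos (by linarith)]; exact hMk)
      (fun y hy => by
        have := abs_lt.1 (hR' y (hy.trans (min_le_right _ _)))
        nlinarith) hzL' hx
    linarith [hM.p]
  · have := hz.trap_top (η := κ/2) (a := L) (by rw [abs_of_pos (by linarith)]; exact hMk)
      (fun y hy => by
        have := abs_lt.1 (hR y ((le_max_right _ _).trans hy))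
        nlinarith) hzL hx
    linarith [hM.p]

theorem excl {u : ℝ → ℝ} (hu : XC u) {κ κ' : ℝ} (hκ' : 0 < κ') (hlt : κ' < κ) {w v : ℝ → ℝ}
    (h : Ric u κ w) (ht : Tendsto w atTop (𝓝 (-κ))) (hb : Tendsto w atBot (𝓝 κ))
    (hv : Ric u κ' v) : False := by
  have hd : ∀ x, HasDerivAt (fun x => w x - v x) ((u x + κ ^ 2 - w x ^ 2) - (u x + κ' ^ 2 - v x ^ 2)) x :=
    fun x => (h.d x).sub (hv.d x)
  have hs := hv.sgn hu hκ'
  have hbot : ∃ a, 0 < w a - v a := by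
    rcases hs.2 with e | e
    · exact ((hb.sub e).eventually (lt_mem_nhds (show 0 < κ - κ' by linarith))).exists
    · exact ((hb.sub e).eventually (lt_mem_nhds (show 0 < κ - (-κ') by linarith))).exists
  obtain ⟨a, ha⟩ := hbot
  have hge : ∀ x, a ≤ x → 0 ≤ w x - v x := fun x hx => up_top hd (m := 0) (a := a) (fun y _ e => by
    have : w y = v y := by linarith
    rw [this]; nlinarith) ha.le hx
  have hev : ∀ᶠ x in atTop, 0 ≤ w x - v x := eventually_atTop.2 ⟨a, hge⟩
  rcases hs.1 with e | e
  · have := ge_of_tendsto (ht.sub e) hev; linarith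
  · have := ge_of_tendsto (ht.sub e) hev; linarith

/-- Closedness of the set of admissible levels at the infimum. -/
theorem closed_sol {u : ℝ → ℝ} (hu : XC u) {κ : ℝ} (hκ : 0 < κ)
    (h : ∀ ε > 0, ∃ κ', κ ≤ κ' ∧ κ' < κ + ε ∧ ∃ w, Ric u κ' w) : ∃ w, Ric u κ w := by
  obtain ⟨M, hM⟩ := Lev.ex hu.bd ((κ + 1) ^ 2)
  have h1 : ∀ n : ℕ, ∃ κ', κ ≤ κ' ∧ κ' < κ + 1 / ((n : ℝ) + 1) ∧ ∃ w, Ric u κ' w :=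
    fun n => h _ (by positivity)
  choose k hk1 hk2 w hw using h1
  have hlev : ∀ n, Lev u M (k n ^ 2) := fun n => hM.mono (by
    have : k n ≤ κ + 1 := (hk2 n).le.trans (by
      have : 1 / ((n : ℝ) + 1) ≤ 1 := by
        rw [div_le_one (by positivity)]; linarith [Nat.cast_nonneg (α := ℝ) n]
      linarith)
    exact pow_le_pow_left₀ (hκ.le.trans (hk1 n)) this 2)
  have hwb : ∀ n x, |w n x| ≤ M := fun n x =>
    abs_le.2 ⟨((hw n).gt_M (hlev n) x).le, ((hw n).lt_M (hlev n) x).le⟩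
  obtain ⟨s, -, φ, hφ, hlim⟩ := (isCompact_Icc (a := -M) (b := M)).tendsto_subseq
    (x := fun n => w n 0) (fun n => abs_le.1 (hwb n 0))
  have hkl : Tendsto k atTop (𝓝 κ) := by
    refine tendsto_of_tendsto_of_tendsto_of_le_of_le tendsto_const_nhds
      (g := fun _ => κ) (h := fun n : ℕ => κ + 1 / ((n : ℝ) + 1)) ?_ hk1 (fun n => (hk2 n).le)
    simpa using (tendsto_one_div_add_atTop_nhds_zero_nat (𝕜 := ℝ)).const_add κ
  have hk2l : Tendsto (fun n => k (φ n) ^ 2) atTop (𝓝 (κ ^ 2)) :=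
    (hkl.comp hφ.tendsto_atTop).pow 2
  obtain ⟨v, hv0, hv⟩ := Tr.ex hu.bd hM.p (κ ^ 2) s
  refine ⟨v, hv.ric_of (hv.closed hM.p hv0 fun ε hε => ?_)⟩
  have e1 := Metric.tendsto_nhds.1 hk2l ε hε
  have e2 := Metric.tendsto_nhds.1 hlim ε hε
  obtain ⟨n, n1, n2⟩ := (e1.and e2).exists
  rw [Real.dist_eq, abs_sub_comm] at n1 n2
  exact ⟨_, w (φ n), n1, n2, (hw _).tr (hlev _), hwb _⟩

/-- One step of the bottom-up Darboux reduction. -/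
structure Step (u : ℝ → ℝ) (κ : ℝ) (u' : ℝ → ℝ) : Prop where
  k0 : 0 ≤ κ
  xc : XC u'
  e1 : E1 u = E1 u' + 8/3 * κ ^ 3
  e2 : E2 u = E2 u' - 32/5 * κ ^ 5
  e3 : E3 u = E3 u' + 128/7 * κ ^ 7
  f2 : 0 ≤ E2 u' + 4 * κ ^ 2 * E1 u'
  f3 : 0 ≤ E3 u' + 8 * κ ^ 2 * E2 u' + 16 * κ ^ 4 * E1 u'
  low : ∀ κ0, 0 < κ0 → (∃ w, Ric u κ0 w) → κ ≤ κ0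
  nxt : ∀ ε > 0, ∃ κ0, 0 < κ0 ∧ κ0 < κ + ε ∧ ∃ w, Ric u' κ0 w
  alt : (κ = 0 ∧ u' = u) ∨ (0 < κ ∧ ∃ w, Ric u κ w ∧ Tendsto w atBot (𝓝 κ) ∧
    Tendsto w atTop (𝓝 (-κ)) ∧ u' = dar u κ w)

theorem step_ex {u : ℝ → ℝ} (hu : XC u) : ∃ κ u', Step u κ u' := by
  set K : Set ℝ := {κ | 0 < κ ∧ ∃ w, Ric u κ w} with hK
  have hne : K.Nonempty := by
    obtain ⟨κ, h1, h2⟩ := ex_large hu.bd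
    exact ⟨κ, h1, h2⟩
  have hbd : BddBelow K := ⟨0, fun κ h => h.1.le⟩
  have hlow : ∀ κ0, 0 < κ0 → (∃ w, Ric u κ0 w) → sInf K ≤ κ0 := fun κ0 h1 h2 => csInf_le hbd ⟨h1, h2⟩
  have hap : ∀ ε > 0, ∃ κ0 ∈ K, κ0 < sInf K + ε := fun ε hε =>
    exists_lt_of_csInf_lt hne (lt_add_of_pos_right _ hε)
  have h0 : 0 ≤ sInf K := Real.sInf_nonneg fun κ h => h.1.le
  rcases h0.eq_or_lt with h0 | h0
  · have key : ∀ ε > 0, ∃ κ, 0 < κ ∧ κ < ε ∧ 0 ≤ E2 u + 4 * κ ^ 2 * E1 u ∧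
        0 ≤ E3 u + 8 * κ ^ 2 * E2 u + 16 * κ ^ 4 * E1 u := by
      intro ε hε
      obtain ⟨κ, ⟨k0, w0, hw0⟩, k1⟩ := hap ε hε
      obtain ⟨w, hw, wb, -⟩ := max_sol hu k0 hw0
      have wt : Tendsto w atTop (𝓝 κ) := by
        rcases (hw.sgn hu k0).1 with h | h
        · exact h
        exfalso
        obtain ⟨κ', ⟨k0', v, hv⟩, k1'⟩ := hap κ k0
        exact excl hu k0' (by linarith) hw h wb hv
      exact ⟨κ, k0, by linarith, F23 hu hw wt wb⟩
    have hs : ∀ n : ℕ, ∃ κ, 0 < κ ∧ κ < 1 / ((n : ℝ) + 1) ∧ 0 ≤ E2 u + 4 * κ ^ 2 * E1 u ∧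
        0 ≤ E3 u + 8 * κ ^ 2 * E2 u + 16 * κ ^ 4 * E1 u := fun n => key _ (by positivity)
    choose k k0 k1 k2 k3 using hs
    have hkl : Tendsto k atTop (𝓝 0) :=
      tendsto_of_tendsto_of_tendsto_of_le_of_le tendsto_const_nhds
        (tendsto_one_div_add_atTop_nhds_zero_nat (𝕜 := ℝ)) (fun n => (k0 n).le) (fun n => (k1 n).le)
    have c2 : Continuous (fun κ : ℝ => E2 u + 4 * κ ^ 2 * E1 u) := by fun_prop
    have c3 : Continuous (fun κ : ℝ => E3 u + 8 * κ ^ 2 * E2 u + 16 * κ ^ 4 * E1 u) := by fun_prop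
    have f2 := ge_of_tendsto ((c2.tendsto 0).comp hkl) (Eventually.of_forall k2)
    have f3 := ge_of_tendsto ((c3.tendsto 0).comp hkl) (Eventually.of_forall k3)
    refine ⟨0, u, le_rfl, hu, by simp, by simp, by simp, f2, f3, fun κ0 h _ => h.le, fun ε hε => ?_,
      Or.inl ⟨rfl, rfl⟩⟩
    obtain ⟨κ, ⟨a, b⟩, c⟩ := hap ε hε
    exact ⟨κ, a, by linarith, b⟩
  · set κ := sInf K with hκ
    obtain ⟨w0, hw0⟩ := closed_sol hu h0 fun ε hε => by
      obtain ⟨κ', ⟨a, b⟩, c⟩ := hap ε hε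
      exact ⟨κ', hlow κ' a b, c, b⟩
    obtain ⟨w, hw, wb, -⟩ := max_sol hu h0 hw0
    have wt : Tendsto w atTop (𝓝 (-κ)) := by
      rcases (hw.sgn hu h0).1 with h | h
      swap
      · exact h
      exfalso
      obtain ⟨κ', a, b, c⟩ := open_sol hu h0 hw h wb
      linarith [hlow κ' a c]
    obtain ⟨xc, d1, d2, d3⟩ := drop hu hw wt wb
    obtain ⟨z, hz, zb, hle⟩ := max_sol xc h0 hw.neg
    have zt : Tendsto z atTop (𝓝 κ) := by
      rcases (hz.sgn xc h0).1 with h | h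
      · exact h
      exfalso
      have := le_of_tendsto_of_tendsto wt.neg h (Eventually.of_forall hle)
      linarith
    obtain ⟨f2, f3⟩ := F23 xc hz zt zb
    exact ⟨κ, dar u κ w, h0.le, xc, d1, d2, d3, f2, f3, hlow,
      fun ε hε => ⟨κ, h0, by linarith, z, hz⟩, Or.inr ⟨h0, w, hw, wb, wt, rfl⟩⟩

theorem E1_nonneg (u : ℝ → ℝ) : 0 ≤ E1 u := integral_nonneg fun x => by positivity

theorem E1_zero {u : ℝ → ℝ} (hu : XC u) (h : E1 u = 0) : u = 0 := by
  obtain ⟨u1, u2, hu⟩ := hu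
  rw [hu.E1, integral_eq_zero_iff_of_nonneg (fun x => by positivity) hu.i1] at h
  have h2 := Continuous.ae_eq_iff_eq volume (f := fun x => (1/2) * u x ^ 2) (g := fun _ => 0)
    (by have := hu.l0.c; fun_prop) continuous_const |>.1 h
  funext x
  have := congrFun h2 x
  simpa using this

end KdV

namespace KdV

/-- `∫₀ˢ t² (t² - C²) dt`. -/
noncomputable def G (C s : ℝ) : ℝ := s ^ 5 / 5 - C ^ 2 * s ^ 3 / 3
/-- `∫₀ˢ t² (t² - y²) (t² - p²) dt`. -/
noncomputable def H (y p s : ℝ) : ℝ := s ^ 7 / 7 - (y ^ 2 + p ^ 2) * s ^ 5 / 5 + y ^ 2 * p ^ 2 * s ^ 3 / 3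

theorem G_deriv (C s : ℝ) : HasDerivAt (G C) (s ^ 2 * (s ^ 2 - C ^ 2)) s := by
  have := ((hasDerivAt_pow 5 s).div_const 5).sub (((hasDerivAt_pow 3 s).const_mul (C ^ 2)).div_const 3)
  refine this.congr_deriv ?_
  push_cast; ring

theorem H_deriv (y p s : ℝ) : HasDerivAt (H y p) (s ^ 2 * ((s ^ 2 - y ^ 2) * (s ^ 2 - p ^ 2))) s := by
  have := (((hasDerivAt_pow 7 s).div_const 7).sub
    (((hasDerivAt_pow 5 s).const_mul (y ^ 2 + p ^ 2)).div_const 5)).add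
    (((hasDerivAt_pow 3 s).const_mul (y ^ 2 * p ^ 2)).div_const 3)
  refine this.congr_deriv ?_
  push_cast; ring

theorem G_cont (C : ℝ) : Continuous (G C) :=
  continuous_iff_continuousAt.2 fun x => (G_deriv C x).continuousAt
theorem H_cont (y p : ℝ) : Continuous (H y p) :=
  continuous_iff_continuousAt.2 fun x => (H_deriv y p x).continuousAt

theorem G_mono {C : ℝ} (hC : 0 ≤ C) : StrictMonoOn (G C) (Ici C) :=
  strictMonoOn_of_deriv_pos (convex_Ici C) (G_cont C).continuousOn fun s hs => by
    rw [interior_Ici] at hs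
    rw [(G_deriv C s).deriv]
    have hs : C < s := hs
    have h1 : 0 < s := by linarith
    have : 0 < s ^ 2 - C ^ 2 := by nlinarith
    positivity

theorem G_anti {C : ℝ} : StrictAntiOn (G C) (Icc 0 C) :=
  strictAntiOn_of_deriv_neg (convex_Icc 0 C) (G_cont C).continuousOn fun s hs => by
    rw [interior_Icc] at hs
    rw [(G_deriv C s).deriv]
    have h1 : 0 < s := hs.1
    have h2 : s < C := hs.2
    have : s ^ 2 - C ^ 2 < 0 := by nlinarith
    exact mul_neg_of_pos_of_neg (by positivity) this

theorem H_mono {y p : ℝ} (hy : 0 ≤ y) (hyp : y < p) : StrictMonoOn (H y p) (Ici p) :=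
  strictMonoOn_of_deriv_pos (convex_Ici p) (H_cont y p).continuousOn fun s hs => by
    rw [interior_Ici] at hs
    rw [(H_deriv y p s).deriv]
    have hs : p < s := hs
    have h1 : 0 < s := by linarith
    have h2 : 0 < s ^ 2 - y ^ 2 := by nlinarith
    have h3 : 0 < s ^ 2 - p ^ 2 := by nlinarith
    positivity

theorem H_anti {y p : ℝ} (hy : 0 ≤ y) : StrictAntiOn (H y p) (Icc y p) :=
  strictAntiOn_of_deriv_neg (convex_Icc y p) (H_cont y p).continuousOn fun s hs => by
    rw [interior_Icc] at hs
    rw [(H_deriv y p s).deriv]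
    have h1 : y < s := hs.1
    have h2 : s < p := hs.2
    have h2' : 0 < s ^ 2 - y ^ 2 := by nlinarith
    have h3 : s ^ 2 - p ^ 2 < 0 := by nlinarith
    exact mul_neg_of_pos_of_neg (by have : 0 < s := by linarith
                                    positivity) (mul_neg_of_pos_of_neg h2' h3)

theorem H_mono' {y p : ℝ} (hyp : y < p) : StrictMonoOn (H y p) (Icc 0 y) :=
  strictMonoOn_of_deriv_pos (convex_Icc 0 y) (H_cont y p).continuousOn fun s hs => by
    rw [interior_Icc] at hs
    rw [(H_deriv y p s).deriv]
    have h1 : 0 < s := hs.1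
    have h2 : s < y := hs.2
    have h2' : s ^ 2 - y ^ 2 < 0 := by nlinarith
    have h3 : s ^ 2 - p ^ 2 < 0 := by nlinarith
    exact mul_pos (by positivity) (mul_pos_of_neg_of_neg h2' h3)

theorem pair_le {p q p' q' : ℝ} (hq : 0 ≤ q) (hpq : q ≤ p) (hq' : 0 ≤ q') (_hpq' : q' ≤ p')
    (h3 : p ^ 3 + q ^ 3 = p' ^ 3 + q' ^ 3) (h5 : p ^ 5 + q ^ 5 = p' ^ 5 + q' ^ 5) : p' ≤ p := by
  by_contra h
  push Not at h
  have c1 : p ^ 3 < p' ^ 3 := pow_lt_pow_left₀ h (by linarith) (by norm_num)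
  have hqq : q' < q := lt_of_pow_lt_pow_left₀ 3 hq (by linarith)
  have g1 : G q p < G q p' := G_mono hq hpq (show q ≤ p' by linarith) h
  have g2 : G q q < G q q' := G_anti (C := q) ⟨hq', hqq.le⟩ ⟨hq, le_rfl⟩ hqq
  unfold G at g1 g2
  nlinarith

theorem pair_unique {p q p' q' : ℝ} (hq : 0 ≤ q) (hpq : q ≤ p) (hq' : 0 ≤ q') (hpq' : q' ≤ p')
    (h3 : p ^ 3 + q ^ 3 = p' ^ 3 + q' ^ 3) (h5 : p ^ 5 + q ^ 5 = p' ^ 5 + q' ^ 5) :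
    p = p' ∧ q = q' := by
  have e : p = p' := le_antisymm (pair_le hq' hpq' hq hpq h3.symm h5.symm)
    (pair_le hq hpq hq' hpq' h3 h5)
  subst e
  refine ⟨rfl, ?_⟩
  exact (pow_left_inj₀ hq hq' (by norm_num : 3 ≠ 0)).1 (by linarith)

theorem pair_min {p q x y a b d : ℝ} (hq : 0 ≤ q) (hpq : q ≤ p) (hy : 0 ≤ y) (hxy : y ≤ x)
    (ha : 0 ≤ a) (hb : b ≤ y ^ 2 * a) (hd : 2 * y ^ 2 * b - y ^ 4 * a ≤ d)
    (h3 : x ^ 3 / 3 + y ^ 3 / 3 + a = p ^ 3 / 3 + q ^ 3 / 3)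
    (h5 : x ^ 5 / 5 + y ^ 5 / 5 + b = p ^ 5 / 5 + q ^ 5 / 5) :
    p ^ 7 / 7 + q ^ 7 / 7 < x ^ 7 / 7 + y ^ 7 / 7 + d ∨ (x = p ∧ y = q ∧ a = 0 ∧ b = 0 ∧ 0 ≤ d) := by
  have fin : y < p → H y p p + H y p q < H y p x + H y p y →
      p ^ 7 / 7 + q ^ 7 / 7 < x ^ 7 / 7 + y ^ 7 / 7 + d := by
    intro hyp hH
    have hr : 0 ≤ (p ^ 2 - y ^ 2) * (y ^ 2 * a - b) :=
      mul_nonneg (by nlinarith) (by linarith)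
    unfold H at hH
    have e3 : a = p ^ 3 / 3 + q ^ 3 / 3 - x ^ 3 / 3 - y ^ 3 / 3 := by linarith
    have e5 : b = p ^ 5 / 5 + q ^ 5 / 5 - x ^ 5 / 5 - y ^ 5 / 5 := by linarith
    have i1 : (y ^ 2 + p ^ 2) * b - y ^ 2 * p ^ 2 * a ≤ d := by nlinarith
    rw [e3, e5] at i1
    nlinarith
  rcases le_or_gt p x with h1 | h1
  · rcases le_or_gt q y with h2 | h2
    · right
      have c1 : p ^ 3 ≤ x ^ 3 := pow_le_pow_left₀ (by linarith) h1 3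
      have c2 : q ^ 3 ≤ y ^ 3 := pow_le_pow_left₀ hq h2 3
      have e1 : x = p := (pow_left_inj₀ (by linarith) (by linarith) (by norm_num : 3 ≠ 0)).1 (by linarith)
      have e2 : y = q := (pow_left_inj₀ (by linarith) (by linarith) (by norm_num : 3 ≠ 0)).1 (by linarith)
      subst e1; subst e2
      have ea : a = 0 := by linarith
      have eb : b = 0 := by linarith
      subst ea; subst eb
      exact ⟨rfl, rfl, rfl, rfl, by linarith⟩
    · left
      have hyp : y < p := by linarith
      refine fin hyp ?_
      have g1 : H y p p ≤ H y p x := (H_mono hy hyp).monotoneOn (self_mem_Ici) h1 h1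
      have g2 : H y p q < H y p y := H_anti hy ⟨le_rfl, hyp.le⟩ ⟨h2.le, hpq⟩ h2
      linarith
  · have hyp : y < p := by linarith
    rcases le_or_gt q y with h2 | h2
    · left
      refine fin hyp ?_
      have g1 : H y p p < H y p x := H_anti hy ⟨hxy, h1.le⟩ ⟨hyp.le, le_rfl⟩ h1
      have g2 : H y p q ≤ H y p y := (H_mono' hyp).monotoneOn ⟨hq, h2⟩ ⟨hy, le_rfl⟩ h2
      linarith
    · exfalso
      have g1 : G y x < G y p := G_mono hy hxy (show y ≤ p by linarith) h1
      have g2 : G y y < G y q := G_mono hy self_mem_Ici h2.le h2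
      unfold G at g1 g2
      nlinarith

theorem Step.le {u u' u'' : ℝ → ℝ} {κ κ' : ℝ} (h : Step u κ u') (h' : Step u' κ' u'') : κ' ≤ κ := by
  refine le_of_forall_pos_le_add fun ε hε => ?_
  obtain ⟨κ0, a, b, c⟩ := h.nxt ε hε
  exact (h'.low κ0 a c).trans b.le

theorem main_min {u : ℝ → ℝ} (hu : XC u) {p q : ℝ} (hq : 0 ≤ q) (hpq : q ≤ p)
    (h1 : E1 u = 8/3 * (p ^ 3 + q ^ 3)) (h2 : E2 u = -(32/5) * (p ^ 5 + q ^ 5)) :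
    128/7 * (p ^ 7 + q ^ 7) ≤ E3 u ∧ (E3 u = 128/7 * (p ^ 7 + q ^ 7) →
      ∃ u', Step u p u' ∧ Step u' q 0) := by
  obtain ⟨x, u1, s1⟩ := step_ex hu
  obtain ⟨y, u2, s2⟩ := step_ex s1.xc
  have hxy := s1.le s2
  have := pair_min (a := E1 u2 / 8) (b := - E2 u2 / 32) (d := E3 u2 / 128) hq hpq s2.k0 hxy
    (by linarith [E1_nonneg u2]) (by linarith [s2.f2]) (by linarith [s2.f3])
    (by linarith [s1.e1, s2.e1]) (by linarith [s1.e2, s2.e2])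
  rcases this with h | ⟨rfl, rfl, ha, hb, hd⟩
  · have e : 128/7 * (p ^ 7 + q ^ 7) < E3 u := by linarith [s1.e3, s2.e3]
    exact ⟨e.le, fun h => absurd h (by linarith)⟩
  · refine ⟨by linarith [s1.e3, s2.e3], fun _ => ⟨u1, s1, ?_⟩⟩
    have := E1_zero s2.xc (by linarith)
    rwa [this] at s2

end KdV

namespace KdV

/-- `e^{kx} + g e^{-kx}`. -/
noncomputable def psi (k g x : ℝ) : ℝ := Real.exp (k * x) + g * Real.exp (-(k * x))
/-- The logarithmic derivative of `psi`. -/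
noncomputable def th (k g x : ℝ) : ℝ :=
  k * (Real.exp (k * x) - g * Real.exp (-(k * x))) / psi k g x

theorem psi_pos {g : ℝ} (hg : 0 < g) (k x : ℝ) : 0 < psi k g x := by unfold psi; positivity

theorem hexp (k x : ℝ) : HasDerivAt (fun x => Real.exp (k * x)) (k * Real.exp (k * x)) x := by
  have := ((hasDerivAt_id x).const_mul k).exp
  refine this.congr_deriv ?_
  simp; ring

theorem hexp' (k x : ℝ) : HasDerivAt (fun x => Real.exp (-(k * x))) (-k * Real.exp (-(k * x))) x := by
  have := ((hasDerivAt_id x).const_mul k).neg.exp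
  refine this.congr_deriv ?_
  simp; ring

theorem psi_deriv {g : ℝ} (hg : 0 < g) (k x : ℝ) :
    HasDerivAt (psi k g) (th k g x * psi k g x) x := by
  refine ((hexp k x).add ((hexp' k x).const_mul g)).congr_deriv ?_
  have := (psi_pos hg k x).ne'
  unfold th
  rw [div_mul_cancel₀ _ this]; ring

theorem th_deriv {g : ℝ} (hg : 0 < g) (k x : ℝ) :
    HasDerivAt (th k g) (k ^ 2 - th k g x ^ 2) x := by
  have h0 := (psi_pos hg k x).ne'
  refine ((((hexp k x).sub ((hexp' k x).const_mul g)).const_mul k).div (psi_deriv hg k x) h0).congr_deriv ?_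
  simp only [Pi.sub_apply]
  have e : th k g x * psi k g x = k * (Real.exp (k * x) - g * Real.exp (-(k * x))) := by
    unfold th; rw [div_mul_cancel₀ _ h0]
  have e2 : k * Real.exp (k * x) - g * (-k * Real.exp (-(k * x))) = k * psi k g x := by
    unfold psi; ring
  rw [e2, ← e]
  field_simp

theorem th_abs {g k : ℝ} (hg : 0 < g) (hk : 0 < k) (x : ℝ) : |th k g x| < k := by
  have h0 := psi_pos hg k x
  have e1 : 0 < Real.exp (k * x) := Real.exp_pos _
  have e2 : 0 < g * Real.exp (-(k * x)) := by positivity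
  rw [abs_lt]; unfold th
  constructor
  · rw [lt_div_iff₀ h0]; unfold psi; nlinarith
  · rw [div_lt_iff₀ h0]; unfold psi; nlinarith

theorem th_zero (k g : ℝ) : th k g 0 = k * (1 - g) / (1 + g) := by
  unfold th psi; simp

theorem th_top {g k : ℝ} (hg : 0 < g) (hk : 0 < k) : Tendsto (th k g) atTop (𝓝 k) := by
  have h1 : Tendsto (fun x => Real.exp (-(2 * k * x))) atTop (𝓝 0) :=
    Real.tendsto_exp_neg_atTop_nhds_zero.comp (tendsto_id.const_mul_atTop (by linarith))
  have h2 := ((h1.const_mul g).const_sub 1 |>.const_mul k).div ((h1.const_mul g).const_add 1)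
    (by simp)
  simp only [mul_zero, sub_zero, add_zero, mul_one, div_one] at h2
  refine h2.congr fun x => ?_
  have e : Real.exp (-(2 * k * x)) = Real.exp (-(k * x)) / Real.exp (k * x) := by
    rw [← Real.exp_sub]; congr 1; ring
  have h0 := psi_pos hg k x
  simp only [Pi.div_apply]
  rw [e]; unfold th; unfold psi at *
  have := Real.exp_pos (k * x)
  field_simp

theorem th_bot {g k : ℝ} (hg : 0 < g) (hk : 0 < k) : Tendsto (th k g) atBot (𝓝 (-k)) := by
  have h1 : Tendsto (fun x => Real.exp (2 * k * x)) atBot (𝓝 0) :=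
    Real.tendsto_exp_atBot.comp (tendsto_id.const_mul_atBot (by linarith))
  have h2 := ((h1.sub_const g).const_mul k).div (h1.add_const g) (by simp; exact hg.ne')
  have e0 : k * (0 - g) / (0 + g) = -k := by field_simp; ring
  rw [e0] at h2
  refine h2.congr fun x => ?_
  have e : Real.exp (2 * k * x) = Real.exp (k * x) / Real.exp (-(k * x)) := by
    rw [← Real.exp_sub]; congr 1; ring
  have h0 := psi_pos hg k x
  simp only [Pi.div_apply]
  rw [e]; unfold th; unfold psi at *
  have := Real.exp_pos (-(k * x))
  field_simp

theorem th_ric {g k : ℝ} (hg : 0 < g) (hk : 0 < k) : Ric 0 k (th k g) :=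
  ⟨⟨k, fun x => (th_abs hg hk x).le⟩, fun x => (th_deriv hg k x).congr_deriv (by simp)⟩

theorem Ric.unique {u w v : ℝ → ℝ} {κ : ℝ} (hu : Bd u) (hw : Ric u κ w) (hv : Ric u κ v)
    (e : w 0 = v 0) : w = v := by
  obtain ⟨M, hM⟩ := Lev.ex hu (κ ^ 2)
  exact (hw.tr hM).unique hM.p (hv.tr hM) e

theorem Ric.le {u w v : ℝ → ℝ} {κ : ℝ} (hu : Bd u) (hw : Ric u κ w) (hv : Ric u κ v)
    (e : w 0 ≤ v 0) (x : ℝ) : w x ≤ v x := by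
  obtain ⟨M, hM⟩ := Lev.ex hu (κ ^ 2)
  exact (hw.tr hM).le hM.p (hv.tr hM) e x

theorem XC_zero : XC 0 := by
  have h0 : L2 (fun _ : ℝ => (0:ℝ)) := ⟨continuous_const, by simp⟩
  exact ⟨fun _ => 0, fun _ => 0, fun x => hasDerivAt_const x 0, fun x => hasDerivAt_const x 0, h0, h0, h0⟩

theorem E1_of_zero : E1 0 = 0 := by simp [E1]
theorem E2_of_zero : E2 0 = 0 := by simp [E2]
theorem E3_of_zero : E3 0 = 0 := by
  have : deriv (0 : ℝ → ℝ) = 0 := by ext x; simp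
  simp [E3, this]

theorem const_ric {k p : ℝ} (hp : p ^ 2 = k ^ 2) : Ric 0 k (fun _ => p) :=
  ⟨⟨|p|, fun _ => le_rfl⟩, fun x => (hasDerivAt_const x p).congr_deriv (by simp [hp])⟩

theorem th_of {k : ℝ} (hk : 0 < k) {v : ℝ → ℝ} (h : Ric 0 k v) (ht : Tendsto v atTop (𝓝 k))
    (hb : Tendsto v atBot (𝓝 (-k))) : ∃ g, 0 < g ∧ v = th k g := by
  have h1 : v 0 < k := by
    by_contra hc
    push Not at hc
    have := (const_ric (k := k) (p := k) rfl).le XC_zero.bd h hc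
    have := ge_of_tendsto hb (Eventually.of_forall this)
    linarith
  have h2 : -k < v 0 := by
    by_contra hc
    push Not at hc
    have := h.le XC_zero.bd (const_ric (k := k) (p := -k) (by ring)) hc
    have := le_of_tendsto ht (Eventually.of_forall this)
    linarith
  have hg : 0 < (k - v 0) / (k + v 0) := div_pos (by linarith) (by linarith)
  refine ⟨_, hg, h.unique XC_zero.bd (th_ric hg hk) ?_⟩
  rw [th_zero]
  have n1 : k + v 0 ≠ 0 := by linarith
  have e1 : 1 - (k - v 0) / (k + v 0) = 2 * v 0 / (k + v 0) := by field_simp; ring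
  have e2 : 1 + (k - v 0) / (k + v 0) = 2 * k / (k + v 0) := by field_simp; ring
  rw [e1, e2]
  field_simp

/-- Nonlinear superposition. -/
noncomputable def sup (p q : ℝ) (z v : ℝ → ℝ) (x : ℝ) : ℝ :=
  (p ^ 2 - q ^ 2) * z x / (p ^ 2 - z x * v x) - v x

theorem den_pos {p q a b : ℝ} (hq : 0 < q) (hpq : q < p) (ha : |a| ≤ p) (hb : |b| ≤ q) :
    0 < p ^ 2 - a * b := by
  have : a * b ≤ |a| * |b| := (le_abs_self _).trans (abs_mul _ _).le
  have : |a| * |b| ≤ p * q := mul_le_mul ha hb (abs_nonneg _) (by linarith)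
  nlinarith

theorem r_deriv {p q : ℝ} (hq : 0 < q) (hpq : q < p) {z v : ℝ → ℝ} {x : ℝ}
    (hz : HasDerivAt z (p ^ 2 - z x ^ 2) x) (hv : HasDerivAt v (q ^ 2 - v x ^ 2) x)
    (ha : |z x| ≤ p) (hb : |v x| ≤ q) :
    HasDerivAt (fun x => (p ^ 2 - q ^ 2) * z x / (p ^ 2 - z x * v x))
      ((p ^ 2 - q ^ 2) - ((p ^ 2 - q ^ 2) * z x / (p ^ 2 - z x * v x)) ^ 2
        + 2 * ((p ^ 2 - q ^ 2) * z x / (p ^ 2 - z x * v x)) * v x) x := by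
  have h0 := (den_pos hq hpq ha hb).ne'
  refine ((hz.const_mul (p ^ 2 - q ^ 2)).div ((hz.mul hv).const_sub (p ^ 2)) h0).congr_deriv ?_
  simp only [Pi.mul_apply]
  field_simp
  ring

theorem sup_deriv {p q : ℝ} (hq : 0 < q) (hpq : q < p) {z v : ℝ → ℝ} {x : ℝ}
    (hz : HasDerivAt z (p ^ 2 - z x ^ 2) x) (hv : HasDerivAt v (q ^ 2 - v x ^ 2) x)
    (ha : |z x| ≤ p) (hb : |v x| ≤ q) :
    HasDerivAt (sup p q z v) (dar 0 q v x + p ^ 2 - sup p q z v x ^ 2) x := by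
  refine ((r_deriv hq hpq hz hv ha hb).sub hv).congr_deriv ?_
  simp only [dar, sup, Pi.zero_apply]
  ring

theorem sup_lim {p q a b c : ℝ} {z v : ℝ → ℝ} {l : Filter ℝ}
    (hz : Tendsto z l (𝓝 a)) (hv : Tendsto v l (𝓝 b)) (h0 : p ^ 2 - a * b ≠ 0)
    (hc : (p ^ 2 - q ^ 2) * a / (p ^ 2 - a * b) - b = c) : Tendsto (sup p q z v) l (𝓝 c) := by
  rw [← hc]
  exact ((hz.const_mul _).div ((hz.mul hv).const_sub _) h0).sub hv

theorem sup_ric {p q g : ℝ} (hq : 0 < q) (hpq : q < p) (hg : 0 < g) {z : ℝ → ℝ} (hz : Ric 0 p z) (ha : ∀ x, |z x| ≤ p) {c d : ℝ}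
    (ht : Tendsto (sup p q z (th q g)) atTop (𝓝 c)) (hb : Tendsto (sup p q z (th q g)) atBot (𝓝 d)) :
    Ric (dar 0 q (th q g)) p (sup p q z (th q g)) := by
  have hd : ∀ x, HasDerivAt (sup p q z (th q g))
      (dar 0 q (th q g) x + p ^ 2 - sup p q z (th q g) x ^ 2) x := fun x =>
    sup_deriv hq hpq ((hz.d x).congr_deriv (by simp)) (th_deriv hg q x) (ha x) (th_abs hg hq x).le
  exact ⟨(bd_of_lim (continuous_iff_continuousAt.2 fun x => (hd x).continuousAt) ht hb).b, hd⟩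

theorem sup_limits {p q g : ℝ} (hq : 0 < q) (hpq : q < p) (hg : 0 < g) {B : ℝ} (hB : 0 < B) :
    Tendsto (sup p q (th p B) (th q g)) atTop (𝓝 p) ∧
    Tendsto (sup p q (th p B) (th q g)) atBot (𝓝 (-p)) := by
  have hp : 0 < p := by linarith
  have h0 : p ^ 2 - p * q ≠ 0 := by nlinarith
  have i1 : p - q ≠ 0 := by linarith
  constructor
  · refine sup_lim (th_top hB hp) (th_top hg hq) h0 ?_
    field_simp; ring
  · refine sup_lim (th_bot hB hp) (th_bot hg hq) (by simpa using h0) ?_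
    have : p ^ 2 - -p * -q = p ^ 2 - p * q := by ring
    rw [this]; field_simp; ring

theorem sup_ric_th {p q g : ℝ} (hq : 0 < q) (hpq : q < p) (hg : 0 < g) {B : ℝ} (hB : 0 < B) :
    Ric (dar 0 q (th q g)) p (sup p q (th p B) (th q g)) :=
  sup_ric hq hpq hg (th_ric hB (by linarith)) (fun x => (th_abs hB (by linarith) x).le)
    (sup_limits hq hpq hg hB).1 (sup_limits hq hpq hg hB).2

theorem sup_limits_p {p q g : ℝ} (hq : 0 < q) (hpq : q < p) (hg : 0 < g) {e : ℝ} (he : e = p ∨ e = -p) :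
    Tendsto (sup p q (fun _ => e) (th q g)) atTop (𝓝 e) ∧
    Tendsto (sup p q (fun _ => e) (th q g)) atBot (𝓝 e) := by
  have hp : 0 < p := by linarith
  have h0 : p ^ 2 - p * q ≠ 0 := by nlinarith
  have h1 : p ^ 2 + p * q ≠ 0 := by nlinarith
  have i1 : p - q ≠ 0 := by linarith
  have i2 : p + q ≠ 0 := by linarith
  have j1 : p ^ 2 - -p * -q = p ^ 2 - p * q := by ring
  have j2 : p ^ 2 - p * -q = p ^ 2 + p * q := by ring
  have j3 : p ^ 2 - -p * q = p ^ 2 + p * q := by ring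
  rcases he with rfl | rfl
  · constructor
    · exact sup_lim tendsto_const_nhds (th_top hg hq) h0 (by field_simp; ring)
    · refine sup_lim tendsto_const_nhds (th_bot hg hq) (by rwa [j2]) ?_
      rw [j2]; field_simp; ring
  · constructor
    · refine sup_lim tendsto_const_nhds (th_top hg hq) (by rwa [j3]) ?_
      rw [j3]; field_simp; ring
    · refine sup_lim tendsto_const_nhds (th_bot hg hq) (by rwa [j1]) ?_
      rw [j1]; field_simp; ring

theorem sup_ric_p {p q g : ℝ} (hq : 0 < q) (hpq : q < p) (hg : 0 < g) {e : ℝ} (he : e = p ∨ e = -p) :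
    Ric (dar 0 q (th q g)) p (sup p q (fun _ => e) (th q g)) := by
  have hp : 0 < p := by linarith
  refine sup_ric hq hpq hg (const_ric (by rcases he with rfl | rfl <;> ring)) (fun x => ?_)
    (sup_limits_p hq hpq hg he).1 (sup_limits_p hq hpq hg he).2
  rcases he with rfl | rfl
  · rw [abs_of_pos hp]
  · rw [abs_neg, abs_of_pos hp]

theorem sup_of {p q g : ℝ} (hq : 0 < q) (hpq : q < p) (hg : 0 < g) {v : ℝ → ℝ} (hX : XC (dar 0 q (th q g))) (h : Ric (dar 0 q (th q g)) p v)
    (ht : Tendsto v atTop (𝓝 p))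
    (hb : Tendsto v atBot (𝓝 (-p))) : ∃ B, 0 < B ∧ v = sup p q (th p B) (th q g) := by
  have hp : 0 < p := by linarith
  have h1 : v 0 < sup p q (fun _ => p) (th q g) 0 := by
    by_contra hc
    push Not at hc
    have := (sup_ric_p hq hpq hg (Or.inl rfl)).le hX.bd h hc
    have := le_of_tendsto_of_tendsto (sup_limits_p hq hpq hg (Or.inl rfl)).2 hb (Eventually.of_forall this)
    linarith
  have h2 : sup p q (fun _ => -p) (th q g) 0 < v 0 := by
    by_contra hc
    push Not at hc
    have := h.le hX.bd (sup_ric_p hq hpq hg (Or.inr rfl)) hc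
    have := le_of_tendsto_of_tendsto ht (sup_limits_p hq hpq hg (Or.inr rfl)).1 (Eventually.of_forall this)
    linarith
  set σ := th q g 0 with hσ
  obtain ⟨s1, s2⟩ := abs_lt.1 (th_abs hg hq 0)
  rw [← hσ] at s1 s2
  simp only [sup, ← hσ] at h1 h2
  have d1 : 0 < p - σ := by linarith
  have d2 : 0 < p + σ := by linarith
  have f1 : (p ^ 2 - q ^ 2) * p / (p ^ 2 - p * σ) = (p ^ 2 - q ^ 2) / (p - σ) := by
    have : p ^ 2 - p * σ = p * (p - σ) := by ring
    rw [this]; field_simp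
  have f2 : (p ^ 2 - q ^ 2) * -p / (p ^ 2 - -p * σ) = -((p ^ 2 - q ^ 2) / (p + σ)) := by
    have : p ^ 2 - -p * σ = p * (p + σ) := by ring
    rw [this]; field_simp
  rw [f1] at h1
  rw [f2] at h2
  set r := v 0 + σ with hr
  have h1' : r < (p ^ 2 - q ^ 2) / (p - σ) := by linarith
  have h2' : -r < (p ^ 2 - q ^ 2) / (p + σ) := by linarith
  rw [lt_div_iff₀ d1] at h1'
  rw [lt_div_iff₀ d2] at h2'
  have k1 : 0 < p ^ 2 - q ^ 2 := by nlinarith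
  have kd : 0 < p ^ 2 - q ^ 2 + r * σ := by
    by_contra hc
    push Not at hc
    nlinarith
  have hB : 0 < (p ^ 2 - q ^ 2 + r * σ - p * r) / (p ^ 2 - q ^ 2 + r * σ + p * r) :=
    div_pos (by nlinarith) (by nlinarith)
  refine ⟨_, hB, h.unique hX.bd (sup_ric_th hq hpq hg hB) ?_⟩
  have n1 : 0 < p ^ 2 - q ^ 2 + r * σ + p * r := by nlinarith
  have t : th p ((p ^ 2 - q ^ 2 + r * σ - p * r) / (p ^ 2 - q ^ 2 + r * σ + p * r)) 0
      = p ^ 2 * r / (p ^ 2 - q ^ 2 + r * σ) := by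
    rw [th_zero]
    have e1 : 1 - (p ^ 2 - q ^ 2 + r * σ - p * r) / (p ^ 2 - q ^ 2 + r * σ + p * r)
      = 2 * p * r / (p ^ 2 - q ^ 2 + r * σ + p * r) := by field_simp; ring
    have e2 : 1 + (p ^ 2 - q ^ 2 + r * σ - p * r) / (p ^ 2 - q ^ 2 + r * σ + p * r)
      = 2 * (p ^ 2 - q ^ 2 + r * σ) / (p ^ 2 - q ^ 2 + r * σ + p * r) := by field_simp; ring
    rw [e1, e2]; field_simp
  simp only [sup, ← hσ, t]
  have e3 : p ^ 2 - p ^ 2 * r / (p ^ 2 - q ^ 2 + r * σ) * σ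
      = p ^ 2 * (p ^ 2 - q ^ 2) / (p ^ 2 - q ^ 2 + r * σ) := by field_simp; ring
  rw [e3]
  have e4 : (p ^ 2 - q ^ 2) * (p ^ 2 * r / (p ^ 2 - q ^ 2 + r * σ)) /
      (p ^ 2 * (p ^ 2 - q ^ 2) / (p ^ 2 - q ^ 2 + r * σ)) = r := by field_simp
  rw [e4]; linarith

theorem sol2 {p q g : ℝ} (hq : 0 < q) (hpq : q < p) (hg : 0 < g) {B : ℝ} (hB : 0 < B) :
    E1 (dar (dar 0 q (th q g)) p (sup p q (th p B) (th q g))) = 8/3 * (p ^ 3 + q ^ 3) ∧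
    E2 (dar (dar 0 q (th q g)) p (sup p q (th p B) (th q g))) = -(32/5) * (p ^ 5 + q ^ 5) ∧
    E3 (dar (dar 0 q (th q g)) p (sup p q (th p B) (th q g))) = 128/7 * (p ^ 7 + q ^ 7) := by
  obtain ⟨x, a1, a2, a3⟩ := grow XC_zero (th_ric hg hq) (th_top hg hq) (th_bot hg hq)
  obtain ⟨_, b1, b2, b3⟩ := grow x (sup_ric_th hq hpq hg hB) (sup_limits hq hpq hg hB).1
    (sup_limits hq hpq hg hB).2
  rw [E1_of_zero] at a1; rw [E2_of_zero] at a2; rw [E3_of_zero] at a3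
  refine ⟨by linarith, by linarith, by linarith⟩

theorem sol1 {q g : ℝ} (hq : 0 < q) (hg : 0 < g) :
    E1 (dar 0 q (th q g)) = 8/3 * q ^ 3 ∧
    E2 (dar 0 q (th q g)) = -(32/5) * q ^ 5 ∧
    E3 (dar 0 q (th q g)) = 128/7 * q ^ 7 := by
  obtain ⟨x, a1, a2, a3⟩ := grow XC_zero (th_ric hg hq) (th_top hg hq) (th_bot hg hq)
  rw [E1_of_zero] at a1; rw [E2_of_zero] at a2; rw [E3_of_zero] at a3
  refine ⟨by linarith, by linarith, by linarith⟩

theorem Step.inv {u u' : ℝ → ℝ} {κ : ℝ} (h : Step u κ u') (hκ : 0 < κ) :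
    ∃ v, Ric u' κ v ∧ Tendsto v atTop (𝓝 κ) ∧ Tendsto v atBot (𝓝 (-κ)) ∧ u = dar u' κ v := by
  rcases h.alt with ⟨h0, -⟩ | ⟨-, w, hw, wb, wt, rfl⟩
  · linarith
  · exact ⟨_, hw.neg, by simpa using wt.neg, wb.neg, dar_dar.symm⟩

theorem Step.inv0 {u u' : ℝ → ℝ} (h : Step u 0 u') : u' = u := by
  rcases h.alt with ⟨-, h⟩ | ⟨h, -⟩
  · exact h
  · exact absurd h (lt_irrefl _)

theorem Step.one {u : ℝ → ℝ} {q : ℝ} (h : Step u q 0) (hq : 0 < q) :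
    ∃ g, 0 < g ∧ u = dar 0 q (th q g) := by
  obtain ⟨v, hv, vt, vb, rfl⟩ := h.inv hq
  obtain ⟨g, hg, rfl⟩ := th_of hq hv vt vb
  exact ⟨g, hg, rfl⟩

theorem Step.two {u u' : ℝ → ℝ} {p q : ℝ} (h : Step u p u') (h' : Step u' q 0) (hq : 0 < q)
    (hpq : q < p) :
    ∃ g B, 0 < g ∧ 0 < B ∧ u = dar (dar 0 q (th q g)) p (sup p q (th p B) (th q g)) := by
  obtain ⟨g, hg, rfl⟩ := h'.one hq
  obtain ⟨v, hv, vt, vb, rfl⟩ := h.inv (by linarith)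
  obtain ⟨B, hB, rfl⟩ := sup_of hq hpq hg h.xc hv vt vb
  exact ⟨g, B, hg, hB, rfl⟩

end KdV

namespace KdV

theorem Qsol_eq {N : ℕ} {β c : Fin N → ℝ} {g g' : ℝ → ℝ}
    (h1 : ∀ y, HasDerivAt (fun y => Real.log (solitonMatrix N β c y).det) (g y) y)
    (h2 : ∀ y, HasDerivAt g (g' y) y) : Qsol N β c = fun x => -2 * g' x := by
  have e : (deriv fun y => Real.log (solitonMatrix N β c y).det) = g := funext fun y => (h1 y).deriv
  funext x
  unfold Qsol
  rw [e, (h2 x).deriv]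

theorem Qsol_zero (β c : Fin 0 → ℝ) : Qsol 0 β c = 0 := by
  have := Qsol_eq (β := β) (c := c) (g := fun _ => 0) (g' := fun _ => 0)
    (fun y => by simpa using hasDerivAt_const y (0 : ℝ)) (fun y => hasDerivAt_const y 0)
  rw [this]; funext x; simp

/-- One-soliton phase. -/
noncomputable def g1 (k c : ℝ) : ℝ := Real.exp (2 * k * c) / (2 * k)

theorem Qsol_one (β c : Fin 1 → ℝ) (hk : 0 < β 0) :
    Qsol 1 β c = dar 0 (β 0) (th (β 0) (g1 (β 0) (c 0))) := by
  set k := β 0 with hkd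
  have hg : 0 < g1 k (c 0) := by unfold g1; positivity
  set g := g1 k (c 0) with hgd
  have hdet : ∀ y, (solitonMatrix 1 β c y).det = Real.exp (-(k * y)) * psi k g y := by
    intro y
    rw [Matrix.det_fin_one]
    simp only [solitonMatrix, if_true, ← hkd]
    rw [hgd]; unfold psi g1
    have e1 : Real.exp (-k * (y - c 0) - k * (y - c 0))
        = Real.exp (-(k * y)) * Real.exp (-(k * y)) * Real.exp (2 * k * c 0) := by
      rw [← Real.exp_add, ← Real.exp_add]; congr 1; ring
    have e2 : Real.exp (-(k * y)) * Real.exp (k * y) = 1 := by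
      rw [← Real.exp_add]; simp
    rw [e1, mul_add, e2]; field_simp; ring
  have hlog : (fun y => Real.log (solitonMatrix 1 β c y).det)
      = fun y => -(k * y) + Real.log (psi k g y) := by
    funext y
    rw [hdet, Real.log_mul (Real.exp_pos _).ne' (psi_pos hg k y).ne', Real.log_exp]
  have := Qsol_eq (β := β) (c := c) (g := fun y => -k + th k g y)
    (g' := fun y => k ^ 2 - th k g y ^ 2) (fun y => by
      rw [hlog]
      have h0 := (psi_pos hg k y).ne'
      refine (((hasDerivAt_id y).const_mul k).neg.add ((psi_deriv hg k y).log h0)).congr_deriv ?_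
      field_simp)
    (fun y => (th_deriv hg k y).const_add _)
  rw [this]; funext x; simp [dar]

theorem g1_surj {k g : ℝ} (hk : 0 < k) (hg : 0 < g) : ∃ c, g1 k c = g := by
  refine ⟨Real.log (2 * k * g) / (2 * k), ?_⟩
  unfold g1
  have : 2 * k * (Real.log (2 * k * g) / (2 * k)) = Real.log (2 * k * g) := by field_simp
  rw [this, Real.exp_log (by positivity)]; field_simp

/-- Phases for the two-soliton. -/
noncomputable def g2 (p q k c : ℝ) : ℝ := g1 k c * ((p - q) / (p + q))

theorem det_identity {p q s t a b : ℝ} (hq : 0 < q) (hpq : q < p) (X Y : ℝ) (hX : X ≠ 0) (hY : Y ≠ 0)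
    (hs : s = X⁻¹ * X⁻¹ * a) (ht : t = Y⁻¹ * Y⁻¹ * b) :
    (1 + s / (2 * p)) * (1 + t / (2 * q)) - s * t / (p + q) ^ 2
     = 1 / (p * (p - q)) * (X⁻¹ * Y⁻¹) *
      (p ^ 2 * (X + a / (2 * p) * ((p - q) / (p + q)) * X⁻¹) * (Y + b / (2 * q) * ((p - q) / (p + q)) * Y⁻¹)
        - p * (X - a / (2 * p) * ((p - q) / (p + q)) * X⁻¹) * (q * (Y - b / (2 * q) * ((p - q) / (p + q)) * Y⁻¹))) := by
  have hp : 0 < p := by linarith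
  have h1 : p - q ≠ 0 := by linarith
  have h2 : p + q ≠ 0 := by linarith
  subst hs ht
  field_simp
  ring

theorem Qsol_two (β c : Fin 2 → ℝ) (hq : 0 < β 1) (hpq : β 1 < β 0) :
    Qsol 2 β c = dar (dar 0 (β 1) (th (β 1) (g2 (β 0) (β 1) (β 1) (c 1)))) (β 0)
      (sup (β 0) (β 1) (th (β 0) (g2 (β 0) (β 1) (β 0) (c 0)))
        (th (β 1) (g2 (β 0) (β 1) (β 1) (c 1)))) := by
  set p := β 0 with hpd
  set q := β 1 with hqd
  have hp : 0 < p := by linarith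
  have hpq' : 0 < p - q := by linarith
  have hB : 0 < g2 p q p (c 0) := by unfold g2 g1; positivity
  have hg : 0 < g2 p q q (c 1) := by unfold g2 g1; positivity
  set B := g2 p q p (c 0) with hBd
  set g := g2 p q q (c 1) with hgd
  have hden : ∀ y, 0 < p ^ 2 - th p B y * th q g y := fun y =>
    den_pos hq hpq (th_abs hB hp y).le (th_abs hg hq y).le
  have hdet : ∀ y, (solitonMatrix 2 β c y).det = 1 / (p * (p - q)) * Real.exp (-((p + q) * y)) *
      (psi p B y * psi q g y * (p ^ 2 - th p B y * th q g y)) := by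
    intro y
    have t1 : th p B y * psi p B y = p * (Real.exp (p * y) - B * Real.exp (-(p * y))) := by
      unfold th; rw [div_mul_cancel₀ _ (psi_pos hB p y).ne']
    have t2 : th q g y * psi q g y = q * (Real.exp (q * y) - g * Real.exp (-(q * y))) := by
      unfold th; rw [div_mul_cancel₀ _ (psi_pos hg q y).ne']
    have t3 : psi p B y * psi q g y * (p ^ 2 - th p B y * th q g y)
        = p ^ 2 * psi p B y * psi q g y
          - p * (Real.exp (p * y) - B * Real.exp (-(p * y)))
            * (q * (Real.exp (q * y) - g * Real.exp (-(q * y)))) := by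
      rw [← t1, ← t2]; ring
    rw [t3, Matrix.det_fin_two]
    simp only [solitonMatrix, if_true, ← hpd, ← hqd, zero_ne_one, one_ne_zero, if_false]
    have e1 : Real.exp (-p * (y - c 0) - p * (y - c 0))
        = (Real.exp (p * y))⁻¹ * (Real.exp (p * y))⁻¹ * Real.exp (2 * p * c 0) := by
      rw [← Real.exp_neg, ← Real.exp_add, ← Real.exp_add]; congr 1; ring
    have e2 : Real.exp (-q * (y - c 1) - q * (y - c 1))
        = (Real.exp (q * y))⁻¹ * (Real.exp (q * y))⁻¹ * Real.exp (2 * q * c 1) := by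
      rw [← Real.exp_neg, ← Real.exp_add, ← Real.exp_add]; congr 1; ring
    have e3 : Real.exp (-p * (y - c 0) - q * (y - c 1)) * Real.exp (-q * (y - c 1) - p * (y - c 0))
        = Real.exp (-p * (y - c 0) - p * (y - c 0)) * Real.exp (-q * (y - c 1) - q * (y - c 1)) := by
      rw [← Real.exp_add, ← Real.exp_add]; congr 1; ring
    have e4 : Real.exp (-((p + q) * y)) = (Real.exp (p * y))⁻¹ * (Real.exp (q * y))⁻¹ := by
      rw [← Real.exp_neg, ← Real.exp_neg, ← Real.exp_add]; congr 1; ring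
    have key := det_identity hq hpq (Real.exp (p * y)) (Real.exp (q * y)) (Real.exp_pos _).ne'
      (Real.exp_pos _).ne' e1 e2
    rw [hBd, hgd]
    unfold psi g2 g1
    rw [Real.exp_neg (p * y), Real.exp_neg (q * y), e4, ← key]
    have h2 : p + q ≠ 0 := by linarith
    have e5 : (0 + (p + q)⁻¹ * Real.exp (-p * (y - c 0) - q * (y - c 1)))
        * (0 + (q + p)⁻¹ * Real.exp (-q * (y - c 1) - p * (y - c 0)))
        = Real.exp (-p * (y - c 0) - p * (y - c 0)) * Real.exp (-q * (y - c 1) - q * (y - c 1))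
          / (p + q) ^ 2 := by
      rw [← e3, add_comm q p]; field_simp; ring
    rw [e5]
    rw [← two_mul, ← two_mul]
    ring
  set r : ℝ → ℝ := fun x => (p ^ 2 - q ^ 2) * th p B x / (p ^ 2 - th p B x * th q g x) with hr
  have hlog : (fun y => Real.log (solitonMatrix 2 β c y).det)
      = fun y => Real.log (1 / (p * (p - q))) + -((p + q) * y) +
        (Real.log (psi p B y) + Real.log (psi q g y) +
          Real.log (p ^ 2 - th p B y * th q g y)) := by
    funext y
    have a1 := (psi_pos hB p y).ne'
    have a2 := (psi_pos hg q y).ne'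
    have a3 := (hden y).ne'
    have a4 : 1 / (p * (p - q)) ≠ 0 := by positivity
    have a5 := (Real.exp_pos (-((p + q) * y))).ne'
    rw [hdet, Real.log_mul (mul_ne_zero a4 a5) (mul_ne_zero (mul_ne_zero a1 a2) a3),
      Real.log_mul a4 a5, Real.log_mul (mul_ne_zero a1 a2) a3, Real.log_mul a1 a2, Real.log_exp]
  have := Qsol_eq (β := β) (c := c) (g := fun y => -(p + q) + r y)
    (g' := fun y => (p ^ 2 - q ^ 2) - r y ^ 2 + 2 * r y * th q g y) (fun y => by
      rw [hlog]
      have a1 := (psi_pos hB p y).ne'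
      have a2 := (psi_pos hg q y).ne'
      have a3 := (hden y).ne'
      refine (((((hasDerivAt_id y).const_mul (p + q)).neg.const_add _).add
        ((((psi_deriv hB p y).log a1).add ((psi_deriv hg q y).log a2)).add
          ((((th_deriv hB p y).mul (th_deriv hg q y)).const_sub (p ^ 2)).log a3)))).congr_deriv ?_
      simp only [hr, Pi.mul_apply]
      rw [mul_div_cancel_right₀ _ a1, mul_div_cancel_right₀ _ a2]
      field_simp
      ring)
    (fun y => (r_deriv hq hpq (th_deriv hB p y) (th_deriv hg q y) (th_abs hB hp y).le
      (th_abs hg hq y).le).const_add _)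
  rw [this]; funext x
  simp only [dar, sup, Pi.zero_apply, hr]
  ring

theorem g2_surj {p q k g : ℝ} (hq : 0 < q) (hpq : q < p) (hk : 0 < k) (hg : 0 < g) :
    ∃ c, g2 p q k c = g := by
  have h : 0 < p - q := by linarith
  have h' : 0 < p + q := by linarith
  obtain ⟨c, hc⟩ := g1_surj hk (show 0 < g * ((p + q) / (p - q)) by positivity)
  exact ⟨c, by unfold g2; rw [hc]; field_simp⟩

theorem g2_pos {p q k c : ℝ} (hq : 0 < q) (hpq : q < p) (hk : 0 < k) : 0 < g2 p q k c := by
  have h : 0 < p - q := by linarith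
  have h' : 0 < p + q := by linarith
  unfold g2 g1; positivity

/-- What we need to know about the soliton manifold with padded parameters `(p, q)`. -/
structure Fam (N : ℕ) (β : Fin N → ℝ) (p q : ℝ) : Prop where
  q0 : 0 ≤ q
  pq : q ≤ p
  e1 : ∀ c, E1 (Qsol N β c) = 8/3 * (p ^ 3 + q ^ 3)
  e2 : ∀ c, E2 (Qsol N β c) = -(32/5) * (p ^ 5 + q ^ 5)
  e3 : ∀ c, E3 (Qsol N β c) = 128/7 * (p ^ 7 + q ^ 7)
  st : ∀ u u', Step u p u' → Step u' q 0 → ∃ c, u = Qsol N β c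

theorem fam0 (β : Fin 0 → ℝ) : Fam 0 β 0 0 where
  q0 := le_rfl
  pq := le_rfl
  e1 c := by rw [Qsol_zero, E1_of_zero]; norm_num
  e2 c := by rw [Qsol_zero, E2_of_zero]; norm_num
  e3 c := by rw [Qsol_zero, E3_of_zero]; norm_num
  st u u' h h' := ⟨fun _ => 0, by rw [Qsol_zero, h'.inv0, h.inv0]⟩

theorem g1_pos {k c : ℝ} (hk : 0 < k) : 0 < g1 k c := by unfold g1; positivity

theorem fam1 (β : Fin 1 → ℝ) (hp : 0 < β 0) : Fam 1 β (β 0) 0 where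
  q0 := le_rfl
  pq := hp.le
  e1 c := by rw [Qsol_one β c hp, (sol1 hp (g1_pos hp)).1]; norm_num
  e2 c := by rw [Qsol_one β c hp, (sol1 hp (g1_pos hp)).2.1]; norm_num
  e3 c := by rw [Qsol_one β c hp, (sol1 hp (g1_pos hp)).2.2]; norm_num
  st u u' h h' := by
    rw [← h'.inv0] at h
    obtain ⟨g, hg, e⟩ := h.one hp
    obtain ⟨c, hc⟩ := g1_surj hp hg
    exact ⟨fun _ => c, by rw [Qsol_one _ _ hp, hc, e]⟩

theorem fam2 (β : Fin 2 → ℝ) (hq : 0 < β 1) (hpq : β 1 < β 0) : Fam 2 β (β 0) (β 1) where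
  q0 := hq.le
  pq := hpq.le
  e1 c := by
    rw [Qsol_two β c hq hpq]
    exact (sol2 hq hpq (g2_pos hq hpq hq) (g2_pos hq hpq (hq.trans hpq))).1
  e2 c := by
    rw [Qsol_two β c hq hpq]
    exact (sol2 hq hpq (g2_pos hq hpq hq) (g2_pos hq hpq (hq.trans hpq))).2.1
  e3 c := by
    rw [Qsol_two β c hq hpq]
    exact (sol2 hq hpq (g2_pos hq hpq hq) (g2_pos hq hpq (hq.trans hpq))).2.2
  st u u' h h' := by
    obtain ⟨g, B, hg, hB, e⟩ := h.two h' hq hpq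
    obtain ⟨c1, hc1⟩ := g2_surj hq hpq hq hg
    obtain ⟨c0, hc0⟩ := g2_surj hq hpq (hq.trans hpq) hB
    refine ⟨![c0, c1], ?_⟩
    rw [Qsol_two _ _ hq hpq]
    simp only [Matrix.cons_val_zero, Matrix.cons_val_one]
    rw [hc0, hc1, e]

/-- First and second padded parameters. -/
noncomputable def pad (N : ℕ) (β : Fin N → ℝ) (i : ℕ) : ℝ := if h : i < N then β ⟨i, h⟩ else 0

theorem fam (N : ℕ) (hN : N ≤ 2) (β : Fin N → ℝ) (ha : StrictAnti β) (hp : ∀ i, 0 < β i) :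
    Fam N β (pad N β 0) (pad N β 1) := by
  interval_cases N
  · simpa [pad] using fam0 β
  · simpa [pad] using fam1 β (hp 0)
  · simpa [pad] using fam2 β (hp 1) (ha (by decide : (0 : Fin 2) < 1))

theorem pad_inj (N N' : ℕ) (hN : N ≤ 2) (hN' : N' ≤ 2) (β : Fin N → ℝ) (β' : Fin N' → ℝ)
    (hp : ∀ i, 0 < β i) (hp' : ∀ i, 0 < β' i) (h0 : pad N β 0 = pad N' β' 0)
    (h1 : pad N β 1 = pad N' β' 1) : ∃ h : N' = N, ∀ i, β' i = β (Fin.cast h i) := by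
  have h : ∀ i, i < 2 → pad N β i = pad N' β' i := by
    intro i hi; interval_cases i <;> assumption
  have hiff : ∀ i, i < 2 → (i < N ↔ i < N') := by
    intro i hi
    have := h i hi
    unfold pad at this
    split_ifs at this with a b b
    · tauto
    · exact absurd this (hp _).ne'
    · exact absurd this.symm (hp' _).ne'
    · tauto
  have e : N' = N := by
    have i0 := hiff 0 (by norm_num)
    have i1 := hiff 1 (by norm_num)
    omega
  refine ⟨e, fun i => ?_⟩
  subst e
  have := h i (by omega)
  simp only [pad, i.2, dif_pos] at this
  exact this.symm

end KdV

/-- **Variational characterization of multisolitons (`n = 2` case).**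
Suppose `N ≤ 2`, `β_1 > ⋯ > β_N > 0`, `c ∈ ℝ^N` and `E₁(Q_{β,c}) = e₁`,
`E₂(Q_{β,c}) = e₂`.  Then:
(i) `N` and `β` are uniquely determined by `(e₁, e₂)`, and the values `E₁, E₂, E₃` at
`Q_{β,c}` do not depend on `c`;
(ii) every `C²` function `u` with `u, u′, u″` square-integrable, `E₁(u) = e₁` and
`E₂(u) = e₂` satisfies `E₃(u) ≥ E₃(Q_{β,c})`, with equality iff `u = Q_{β,c'}` for
some `c' ∈ ℝ^N`. -/
theorem stmt_17 (e₁ e₂ : ℝ) (N : ℕ) (hN : N ≤ 2)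
    (β : Fin N → ℝ) (hβanti : StrictAnti β) (hβpos : ∀ i, 0 < β i)
    (c : Fin N → ℝ)
    (h1 : E1 (Qsol N β c) = e₁) (h2 : E2 (Qsol N β c) = e₂) :
    (∀ N' : ℕ, N' ≤ 2 → ∀ β' : Fin N' → ℝ, StrictAnti β' → (∀ i, 0 < β' i) →
      ∀ c' : Fin N' → ℝ, E1 (Qsol N' β' c') = e₁ → E2 (Qsol N' β' c') = e₂ →
        ∃ h : N' = N, ∀ i, β' i = β (Fin.cast h i)) ∧
    (∀ c' : Fin N → ℝ, E1 (Qsol N β c') = e₁ ∧ E2 (Qsol N β c') = e₂ ∧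
      E3 (Qsol N β c') = E3 (Qsol N β c)) ∧
    (∀ u : ℝ → ℝ, ContDiff ℝ 2 u →
      Integrable (fun x => u x ^ 2) →
      Integrable (fun x => deriv u x ^ 2) →
      Integrable (fun x => deriv (deriv u) x ^ 2) →
      E1 u = e₁ → E2 u = e₂ →
        E3 (Qsol N β c) ≤ E3 u ∧
        (E3 u = E3 (Qsol N β c) ↔ ∃ c' : Fin N → ℝ, u = Qsol N β c')) := by
  have F := KdV.fam N hN β hβanti hβpos
  refine ⟨?_, ?_, ?_⟩
  · intro N' hN' β' ha' hp' c' h1' h2'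
    have F' := KdV.fam N' hN' β' ha' hp'
    rw [F.e1] at h1
    rw [F.e2] at h2
    rw [F'.e1] at h1'
    rw [F'.e2] at h2'
    obtain ⟨k0, k1⟩ := KdV.pair_unique F.q0 F.pq F'.q0 F'.pq (by linarith) (by linarith)
    exact KdV.pad_inj N N' hN hN' β β' hβpos hp' k0 k1
  · intro c'
    refine ⟨?_, ?_, ?_⟩
    · rw [F.e1, ← h1, F.e1]
    · rw [F.e2, ← h2, F.e2]
    · rw [F.e3, F.e3]
  · intro u hu i0 i1 i2 a1 a2
    have hX := KdV.XC.of hu i0 i1 i2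
    rw [← h1, F.e1] at a1
    rw [← h2, F.e2] at a2
    obtain ⟨m1, m2⟩ := KdV.main_min hX F.q0 F.pq a1 a2
    rw [F.e3]
    refine ⟨m1, fun h => ?_, ?_⟩
    · obtain ⟨u', s1, s2⟩ := m2 h
      exact F.st u u' s1 s2
    · rintro ⟨c', rfl⟩
      rw [F.e3]
end

section
/- Fix integers n ≥ 1 and N ≥ 1. Let 𝓐 ⊂ ℝ^n be the set of all e = (e_1, …, e_n) for which Γ_e = { x ∈ ℝ^N : x_1, …, x_N ≥ 0 and (−1)^{m+1}(2^{2m+1}/(2m+1)) Σ_{j=1}^{N} x_j^{2m+1} = e_m for m = 1, …, n } is nonempty, and define C_N : 𝓐 → ℝ by C_N(e) = min { (−1)^n (2^{2n+3}/(2n+3)) Σ_{j=1}^{N} x_j^{2n+3} : x ∈ Γ_e } (the minimum is attained since Γ_e is compact and nonempty). Then C_N is continuous on 𝓐, and C_N is decreasing in each variable: if e, ẽ ∈ 𝓐 with ẽ_m ≤ e_m for every m = 1, …, n, then C_N(ẽ) ≥ C_N(e). -/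
open Polynomial

noncomputable section KdVHelpers

/-- The normalised odd power sum (index shifted by one). -/
def kE {k : ℕ} (m : ℕ) (x : Fin k → ℝ) : ℝ :=
  (-1 : ℝ) ^ m * 2 ^ (2 * m + 3) / (2 * m + 3 : ℝ) * ∑ j, x j ^ (2 * m + 3)

/-- Existence of an alternating chain of length `L` in `d`, starting with the sign of `s`,
using indices at least `a`. -/
def HasAlt {N : ℕ} (d : Fin N → ℝ) : ℕ → ℝ → Fin N → Prop
  | 0, _, _ => True
  | L + 1, s, a => ∃ j, a ≤ j ∧ 0 < s * d j ∧ HasAlt d L (-s) j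

theorem hasAlt_seq {N : ℕ} (d : Fin N → ℝ) (L : ℕ) : ∀ (s : ℝ) (a : Fin N), HasAlt d L s a →
    ∃ j : Fin L → Fin N, StrictMono j ∧ (∀ i, a ≤ j i) ∧
      ∀ i : Fin L, 0 < s * (-1) ^ (i : ℕ) * d (j i) := by
  induction L with
  | zero => intro s a _; exact ⟨Fin.elim0, fun i => i.elim0, fun i => i.elim0, fun i => i.elim0⟩
  | succ L ih =>
    rintro s a ⟨j, haj, hj, h⟩
    obtain ⟨g, hg, hge, hgs⟩ := ih _ _ h
    refine ⟨Fin.cons j g, ?_, ?_, ?_⟩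
    · have key : ∀ i, j < g i := by
        intro i
        have h0 : j < g ⟨0, i.pos⟩ := by
          refine lt_of_le_of_ne (hge _) ?_
          intro heq
          have := hgs ⟨0, i.pos⟩
          rw [← heq] at this
          simp at this
          linarith
        exact h0.trans_le (hg.monotone (by simp [Fin.le_def]))
      intro p q hpq
      induction p using Fin.cases with
      | zero =>
        induction q using Fin.cases with
        | zero => exact absurd hpq (lt_irrefl _)
        | succ q => simpa using key q
      | succ p =>
        induction q using Fin.cases with
        | zero => exact absurd hpq (by simp)
        | succ q => simpa using hg (by simpa using hpq)
    · intro i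
      induction i using Fin.cases with
      | zero => simpa using haj
      | succ i => simpa using haj.trans (hge i)
    · intro i
      induction i using Fin.cases with
      | zero => simpa using hj
      | succ i =>
        have := hgs i
        simp only [Fin.cons_succ, Fin.val_succ, pow_succ]
        linarith

theorem exists_poly {N : ℕ} (x z : Fin N → ℝ) (hx : Monotone x) (hz : Monotone z)
    (hx0 : ∀ i, 0 ≤ x i) (hz0 : ∀ i, 0 ≤ z i) (L : ℕ) : ∀ (s : ℝ) (a : Fin N), s ≠ 0 →
    ¬ HasAlt (fun i => z i - x i) (L + 1) s a →
    ∃ S : ℝ[X], (∀ m, 0 ≤ S.coeff m) ∧ S.natDegree ≤ L ∧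
      (∀ u, 0 ≤ u → (∀ i, a ≤ i → u < min (x i) (z i)) → 0 < S.eval (-u ^ 2)) ∧
      ∀ i, a ≤ i → ∀ u, min (x i) (z i) < u → u < max (x i) (z i) →
        (z i - x i) * s * S.eval (-u ^ 2) < 0 := by
  have base : ∀ (s : ℝ) (a : Fin N), s ≠ 0 → (¬ ∃ j, a ≤ j ∧ 0 < s * (z j - x j)) → ∀ i, a ≤ i →
      ∀ u, min (x i) (z i) < u → u < max (x i) (z i) → (z i - x i) * s < 0 := by
    intro s a hs h i hi u h1 h2
    have h3 : s * (z i - x i) ≤ 0 := by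
      by_contra hc
      exact h ⟨i, hi, not_le.1 hc⟩
    have h4 : z i - x i ≠ 0 := by
      intro h0
      have : z i = x i := by linarith
      rw [this, min_self] at h1
      rw [this, max_self] at h2
      linarith
    rcases lt_or_eq_of_le h3 with h5 | h5
    · linarith
    · rcases mul_eq_zero.1 h5 with h6 | h6
      · exact absurd h6 hs
      · exact absurd h6 h4
  induction L with
  | zero =>
    intro s a hs h
    refine ⟨1, ?_, by simp, by simp, ?_⟩
    · intro m; rw [Polynomial.coeff_one]; split_ifs <;> norm_num
    · intro i hi u h1 h2
      have := base s a hs (fun ⟨j, hj, hj'⟩ => h ⟨j, hj, hj', trivial⟩) i hi u h1 h2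
      simpa using this
  | succ L ih =>
    intro s a hs h
    by_cases hex : ∃ j, a ≤ j ∧ 0 < s * (z j - x j)
    · obtain ⟨j, ⟨haj, hj⟩, hmin⟩ : ∃ j, (a ≤ j ∧ 0 < s * (z j - x j)) ∧
          ∀ i, i < j → ¬ (a ≤ i ∧ 0 < s * (z i - x i)) := by
        obtain ⟨j, hj1, hj2⟩ := WellFounded.has_min (wellFounded_lt (α := Fin N))
          {j | a ≤ j ∧ 0 < s * (z j - x j)} hex
        exact ⟨j, hj1, fun i hi hc => hj2 i hc hi⟩
      have hna : ¬ HasAlt (fun i => z i - x i) (L + 1) (-s) j := fun hc => h ⟨j, haj, hj, hc⟩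
      obtain ⟨S, hS1, hS2, hS3, hS4⟩ := ih (-s) j (neg_ne_zero.2 hs) hna
      set τ := min (x j) (z j) with hτ
      have hτ0 : 0 ≤ τ := le_min (hx0 j) (hz0 j)
      have hmono : ∀ k, j ≤ k → τ ≤ min (x k) (z k) := fun k hk => min_le_min (hx hk) (hz hk)
      have hev : ∀ u : ℝ, (S * (X + C (τ ^ 2))).eval (-u ^ 2)
          = S.eval (-u ^ 2) * (τ ^ 2 - u ^ 2) := by
        intro u; simp; ring_nf; simp
      refine ⟨S * (X + C (τ ^ 2)), ?_, ?_, ?_, ?_⟩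
      · intro m
        rw [mul_add, coeff_add, coeff_mul_C]
        have h2 : 0 ≤ S.coeff m * τ ^ 2 := mul_nonneg (hS1 m) (sq_nonneg _)
        cases m with
        | zero => simpa using h2
        | succ m => rw [coeff_mul_X]; exact add_nonneg (hS1 m) h2
      · refine natDegree_mul_le.trans ?_
        rw [natDegree_X_add_C]; omega
      · intro u hu hlt
        rw [hev]
        have h1 : u < τ := hlt j haj
        refine mul_pos (hS3 u hu fun i hi => h1.trans_le (hmono i hi)) ?_
        nlinarith
      · intro i hi u h1 h2
        rw [hev]
        have hu0 : 0 ≤ u := (le_min (hx0 i) (hz0 i)).trans h1.le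
        rcases lt_or_ge i j with hij | hij
        · have h3 : (z i - x i) * s < 0 := by
            have h3 : s * (z i - x i) ≤ 0 := by
              by_contra hc
              exact hmin i hij ⟨hi, not_le.1 hc⟩
            rcases lt_or_eq_of_le h3 with h5 | h5
            · linarith
            · rcases mul_eq_zero.1 h5 with h6 | h6
              · exact absurd h6 hs
              · have : z i = x i := by linarith
                rw [this, min_self] at h1
                rw [this, max_self] at h2
                linarith
          have hxx := hx hij.le
          have hzz := hz hij.le
          have h4 : u < τ := by
            refine h2.trans_le ?_
            rcases lt_or_gt_of_ne hs with hs' | hs'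
            · have : x i < z i := by nlinarith
              have : z j < x j := by nlinarith
              exact max_le (le_min (by linarith) (by linarith)) (le_min (by linarith) (by linarith))
            · have : z i < x i := by nlinarith
              have : x j < z j := by nlinarith
              exact max_le (le_min (by linarith) (by linarith)) (le_min (by linarith) (by linarith))
          have h5 : 0 < S.eval (-u ^ 2) := hS3 u hu0 fun i hi => h4.trans_le (hmono i hi)
          have h6 : 0 < τ ^ 2 - u ^ 2 := by nlinarith
          exact mul_neg_of_neg_of_pos h3 (mul_pos h5 h6)
        · have h3 := hS4 i hij u h1 h2
          have h4 : τ < u := (hmono i hij).trans_lt h1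
          have h6 : τ ^ 2 - u ^ 2 < 0 := by nlinarith
          nlinarith
    · refine ⟨1, ?_, by simp, by simp, ?_⟩
      · intro m; rw [Polynomial.coeff_one]; split_ifs <;> norm_num
      · intro i hi u h1 h2
        have := base s a hs hex i hi u h1 h2
        simpa using this

/-- `x` admits no `-,+,-,…` chain of length `n+1` in `z - x`, for each admissible `z`. -/
def NoChain {N : ℕ} (n : ℕ) (x z : Fin N → ℝ) : Prop :=
  ¬ ∃ j : Fin (n + 1) → Fin N, StrictMono j ∧
    ∀ i : Fin (n + 1), 0 < (-1) * (-1) ^ (i : ℕ) * (z (j i) - x (j i))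

theorem core {N n : ℕ} (x z : Fin N → ℝ) (hx : Monotone x) (hz : Monotone z)
    (hx0 : ∀ i, 0 ≤ x i) (hz0 : ∀ i, 0 ≤ z i) (hno : NoChain n x z) (hne : z ≠ x)
    (hE : ∀ m, m < n → kE m z ≤ kE m x) : kE n x < kE n z := by
  obtain ⟨i0, hi0⟩ := Function.ne_iff.1 hne
  have hNpos : 0 < N := i0.pos
  set a : Fin N := ⟨0, hNpos⟩
  have ha : ∀ i, a ≤ i := fun i => by simp [a, Fin.le_def]
  obtain ⟨S, hS1, hS2, -, hS4⟩ := exists_poly x z hx hz hx0 hz0 n (-1) a (by norm_num) (by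
    intro hc
    obtain ⟨j, hj, -, hjs⟩ := hasAlt_seq _ _ _ _ hc
    exact hno ⟨j, hj, hjs⟩)
  let G : ℝ → ℝ := fun u => ∑ m ∈ Finset.range (n + 1),
    S.coeff m * ((-1) ^ m * (u ^ (2 * m + 3) / (2 * m + 3)))
  have hG : ∀ u, HasDerivAt G (u ^ 2 * S.eval (-u ^ 2)) u := by
    intro u
    have h1 : u ^ 2 * S.eval (-u ^ 2) = ∑ m ∈ Finset.range (n + 1),
        S.coeff m * ((-1) ^ m * (((2 * m + 3 : ℕ) : ℝ) * u ^ (2 * m + 3 - 1) / (2 * m + 3))) := by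
      rw [Polynomial.eval_eq_sum_range' (Nat.lt_succ_of_le hS2), Finset.mul_sum]
      refine Finset.sum_congr rfl fun m _ => ?_
      have : (2 * (m : ℝ) + 3) ≠ 0 := by positivity
      have h2 : 2 * m + 3 - 1 = 2 * m + 2 := by omega
      rw [h2, neg_pow, ← pow_mul]
      push_cast
      field_simp
      ring
    rw [h1]
    apply HasDerivAt.fun_sum
    intro m _
    exact (((hasDerivAt_pow _ _).div_const _).const_mul _).const_mul _
  have hGc : Continuous G := continuous_iff_continuousAt.2 fun u => (hG u).continuousAt
  have hlt : ∀ i, z i ≠ x i → G (x i) < G (z i) := by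
    intro i hi
    rcases lt_or_gt_of_ne hi with h | h
    · have := strictAntiOn_of_deriv_neg (convex_Icc (z i) (x i)) hGc.continuousOn (by
        intro u hu
        rw [interior_Icc] at hu
        rw [(hG u).deriv]
        have h1 := hS4 i (ha i) u (by rw [min_eq_right h.le]; exact hu.1)
          (by rw [max_eq_left h.le]; exact hu.2)
        have hu0 : 0 < u := (hz0 i).trans_lt hu.1
        have : S.eval (-u ^ 2) < 0 := by nlinarith
        exact mul_neg_of_pos_of_neg (by positivity) this)
      exact this (Set.left_mem_Icc.2 h.le) (Set.right_mem_Icc.2 h.le) h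
    · have := strictMonoOn_of_deriv_pos (convex_Icc (x i) (z i)) hGc.continuousOn (by
        intro u hu
        rw [interior_Icc] at hu
        rw [(hG u).deriv]
        have h1 := hS4 i (ha i) u (by rw [min_eq_left h.le]; exact hu.1)
          (by rw [max_eq_right h.le]; exact hu.2)
        have hu0 : 0 < u := (hx0 i).trans_lt hu.1
        have : 0 < S.eval (-u ^ 2) := by nlinarith
        exact mul_pos (by positivity) this)
      exact this (Set.left_mem_Icc.2 h.le) (Set.right_mem_Icc.2 h.le) h
  have hsum : ∑ i, G (x i) < ∑ i, G (z i) := by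
    apply Finset.sum_lt_sum
    · intro i _
      by_cases h : z i = x i
      · rw [h]
      · exact (hlt i h).le
    · exact ⟨i0, Finset.mem_univ _, hlt i0 hi0⟩
  have hconv : ∀ y : Fin N → ℝ, ∑ i, G (y i) = ∑ m ∈ Finset.range (n + 1),
      (S.coeff m / 2 ^ (2 * m + 3)) * kE m y := by
    intro y
    simp only [G]
    rw [Finset.sum_comm]
    refine Finset.sum_congr rfl fun m _ => ?_
    unfold kE
    rw [Finset.mul_sum, Finset.mul_sum]
    refine Finset.sum_congr rfl fun i _ => ?_
    have : (2 * (m : ℝ) + 3) ≠ 0 := by positivity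
    field_simp
  rw [hconv, hconv, Finset.sum_range_succ, Finset.sum_range_succ] at hsum
  have hle : ∑ m ∈ Finset.range n, (S.coeff m / 2 ^ (2 * m + 3)) * kE m z ≤
      ∑ m ∈ Finset.range n, (S.coeff m / 2 ^ (2 * m + 3)) * kE m x := by
    refine Finset.sum_le_sum fun m hm => ?_
    exact mul_le_mul_of_nonneg_left (hE m (Finset.mem_range.1 hm))
      (div_nonneg (hS1 m) (by positivity))
  have hfin : (S.coeff n / 2 ^ (2 * n + 3)) * kE n x < (S.coeff n / 2 ^ (2 * n + 3)) * kE n z := by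
    linarith
  exact lt_of_mul_lt_mul_left hfin (div_nonneg (hS1 n) (by positivity))

theorem cl_imp {Y : Type*} [TopologicalSpace Y] {p : Prop} {P : Y → Prop}
    (h : p → IsClosed {y | P y}) : IsClosed {y | p → P y} := by
  by_cases hp : p
  · simpa [hp] using h hp
  · simp [hp]

theorem cl_all {ι Y : Type*} [TopologicalSpace Y] {P : ι → Y → Prop}
    (h : ∀ i, IsClosed {y | P i y}) : IsClosed {y | ∀ i, P i y} := by
  have : {y | ∀ i, P i y} = ⋂ i, {y | P i y} := by ext y; simp
  rw [this]; exact isClosed_iInter h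

theorem op_all {ι Y : Type*} [Finite ι] [TopologicalSpace Y] {P : ι → Y → Prop}
    (h : ∀ i, IsOpen {y | P i y}) : IsOpen {y | ∀ i, P i y} := by
  have : {y | ∀ i, P i y} = ⋂ i, {y | P i y} := by ext y; simp
  rw [this]; exact isOpen_iInter_of_finite h

theorem kE_continuous {k : ℕ} (m : ℕ) : Continuous (kE m : (Fin k → ℝ) → ℝ) := by
  unfold kE; fun_prop

theorem kE_bound {k : ℕ} (w : Fin k → ℝ) (hw : ∀ i, 0 ≤ w i) (i : Fin k) : w i ≤ 1 + kE 0 w := by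
  have h1 : w i ^ 3 ≤ ∑ j, w j ^ 3 :=
    Finset.single_le_sum (f := fun j => w j ^ 3) (fun j _ => pow_nonneg (hw j) 3)
      (Finset.mem_univ i)
  have h2 : kE 0 w = 8 / 3 * ∑ j, w j ^ 3 := by unfold kE; norm_num
  rw [h2]
  have h0 := hw i
  have h3 : 0 ≤ w i ^ 3 := pow_nonneg h0 3
  rcases le_total (w i) 1 with h | h
  · linarith
  · have : w i ≤ w i ^ 3 := le_self_pow₀ h (by norm_num)
    linarith

/-- Sorted nonnegative configurations with the extremal coincidence pattern. -/
def TT (n N : ℕ) : Set (Fin N → ℝ) :=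
  {x | Monotone x ∧ (∀ i, 0 ≤ x i) ∧ ∀ j : Fin (n + 1) → Fin N, StrictMono j →
    (x (j 0) = 0 ∨ ∃ i : Fin n, Odd (i : ℕ) ∧ x (j i.castSucc) = x (j i.succ))}

theorem noChain_of_TT {n N : ℕ} (x z : Fin N → ℝ) (hx : x ∈ TT n N) (hz : Monotone z)
    (hz0 : ∀ i, 0 ≤ z i) : NoChain n x z := by
  rintro ⟨j, hj, hs⟩
  rcases hx.2.2 j hj with h | ⟨i, hi, h⟩
  · have := hs 0
    rw [h] at this
    have h2 := hz0 (j 0)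
    simp at this
    linarith
  · have h1 := hs i.castSucc
    have h2 := hs i.succ
    have h3 : z (j i.castSucc) ≤ z (j i.succ) := hz (hj.monotone i.castSucc_le_succ)
    simp only [Fin.val_castSucc, Fin.val_succ, pow_succ, hi.neg_one_pow] at h1 h2
    linarith

theorem perturb {n : ℕ} (w : Fin (n + 1) → ℝ) (hw : StrictMono w) (hw0 : ∀ i, 0 < w i)
    (U : Set (Fin (n + 1) → ℝ)) (hU : U ∈ nhds w) :
    ∃ w' ∈ U, (∀ m, m < n → kE m w' = kE m w) ∧ kE n w' < kE n w := by
  let Φ : (Fin (n + 1) → ℝ) → (Fin (n + 1) → ℝ) := fun w m => kE (m : ℕ) w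
  let D : Fin (n + 1) → ((Fin (n + 1) → ℝ) →L[ℝ] ℝ) := fun m =>
    ((-1 : ℝ) ^ (m : ℕ) * 2 ^ (2 * (m : ℕ) + 3) / (2 * (m : ℕ) + 3 : ℝ)) •
      ∑ j, (((2 * (m : ℕ) + 3 : ℕ) : ℝ) * w j ^ (2 * (m : ℕ) + 2)) •
        (ContinuousLinearMap.proj j : (Fin (n + 1) → ℝ) →L[ℝ] ℝ)
  have hD : HasStrictFDerivAt Φ (ContinuousLinearMap.pi D) w := by
    rw [hasStrictFDerivAt_pi]
    intro m
    refine HasStrictFDerivAt.const_mul (HasStrictFDerivAt.fun_sum fun j _ => ?_) _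
    have h1 : HasStrictFDerivAt (fun v : Fin (n + 1) → ℝ => v j)
      (ContinuousLinearMap.proj j : (Fin (n + 1) → ℝ) →L[ℝ] ℝ) w := hasStrictFDerivAt_apply j w
    have h2 := h1.pow (2 * (m : ℕ) + 3)
    have h3 : (2 * (m : ℕ) + 3) • w j ^ (2 * (m : ℕ) + 3 - 1) =
        ((2 * (m : ℕ) + 3 : ℕ) : ℝ) * w j ^ (2 * (m : ℕ) + 2) := by
      rw [nsmul_eq_mul]; rfl
    rw [h3] at h2
    exact h2
  have hinj : Function.Injective (ContinuousLinearMap.pi D : _ →L[ℝ] (Fin (n + 1) → ℝ)) := by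
    rw [injective_iff_map_eq_zero]
    intro v hv
    have h1 : (fun j => w j ^ 2 * v j) = 0 := by
      refine Matrix.eq_zero_of_forall_pow_sum_mul_pow_eq_zero (f := fun j => w j ^ 2) ?_ ?_
      · intro p q hpq
        have : w p = w q := (sq_eq_sq₀ (hw0 p).le (hw0 q).le).1 hpq
        exact hw.injective this
      · intro m
        have h2 := congrFun hv m
        simp only [D, ContinuousLinearMap.coe_pi', smul_apply,
          sum_apply, ContinuousLinearMap.proj_apply, smul_eq_mul,
          Pi.zero_apply] at h2
        have h3 : (2 * ((m : ℕ) : ℝ) + 3) ≠ 0 := by positivity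
        rcases mul_eq_zero.1 h2 with h4 | h4
        · exfalso
          have : ((-1 : ℝ) ^ (m : ℕ) * 2 ^ (2 * (m : ℕ) + 3) / (2 * (m : ℕ) + 3 : ℝ)) ≠ 0 :=
            div_ne_zero (mul_ne_zero (pow_ne_zero _ (by norm_num)) (by positivity)) h3
          exact this h4
        · have h5 : ∑ j, ((2 * (m : ℕ) + 3 : ℕ) : ℝ) * w j ^ (2 * (m : ℕ) + 2) * v j =
              ((2 * (m : ℕ) + 3 : ℕ) : ℝ) * ∑ j, w j ^ 2 * v j * (w j ^ 2) ^ (m : ℕ) := by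
            rw [Finset.mul_sum]
            refine Finset.sum_congr rfl fun j _ => ?_
            rw [← pow_mul]
            ring
          rw [h5] at h4
          rcases mul_eq_zero.1 h4 with h6 | h6
          · exfalso
            push_cast at h6
            exact h3 h6
          · exact h6
    funext j
    have h2 := congrFun h1 j
    simp only [Pi.zero_apply] at h2
    rcases mul_eq_zero.1 h2 with h3 | h3
    · exact absurd h3 (pow_ne_zero _ (hw0 j).ne')
    · exact h3
  have hsurj : Function.Surjective (ContinuousLinearMap.pi D : _ →L[ℝ] (Fin (n + 1) → ℝ)) :=
    (LinearMap.injective_iff_surjective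
      (f := ((ContinuousLinearMap.pi D : _ →L[ℝ] (Fin (n + 1) → ℝ)) :
        (Fin (n + 1) → ℝ) →ₗ[ℝ] (Fin (n + 1) → ℝ)))).1 hinj
  have hmap := hD.map_nhds_eq_of_surj (LinearMap.range_eq_top.2 hsurj)
  have himg : Φ '' U ∈ nhds (Φ w) := by
    rw [← hmap]; exact Filter.image_mem_map hU
  have hcurve : Filter.Tendsto (fun s : ℝ => Φ w - s • (Pi.single (Fin.last n) (1 : ℝ)))
      (nhdsWithin 0 (Set.Ioi 0)) (nhds (Φ w)) := by
    have : Continuous (fun s : ℝ => Φ w - s • (Pi.single (Fin.last n) (1 : ℝ))) := by fun_prop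
    have h2 := this.tendsto 0
    simp only [zero_smul, sub_zero] at h2
    exact h2.mono_left nhdsWithin_le_nhds
  obtain ⟨s, hs, hs0⟩ := ((hcurve.eventually himg).and self_mem_nhdsWithin).exists
  obtain ⟨w', hw'U, hw'⟩ := hs
  refine ⟨w', hw'U, ?_, ?_⟩
  · intro m hm
    have h1 := congrFun hw' ⟨m, by omega⟩
    have h2 : (⟨m, by omega⟩ : Fin (n + 1)) ≠ Fin.last n := by
      intro h; rw [Fin.ext_iff] at h; simp at h; omega
    simpa [Φ, h2] using h1
  · have h1 := congrFun hw' (Fin.last n)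
    simp [Φ] at h1
    have : 0 < s := hs0
    linarith

theorem strictMono_eq {k : ℕ} (j : Fin k → Fin k) (hj : StrictMono j) (i : Fin k) : j i = i := by
  have h : j = id := by
    have h2 : (OrderEmbedding.ofStrictMono j hj).toOrderHom = OrderHom.id := by
      ext i
      have h1 : i ≤ j i := hj.le_apply
      have h3 : j i ≤ i := hj.apply_le
      simp [le_antisymm h3 h1]
    funext i
    exact congrArg (fun f => f i) h2
  rw [h]; rfl

theorem exists_TT_strict {n : ℕ} (hn : 1 ≤ n) (z : Fin (n + 1) → ℝ) (hz : StrictMono z)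
    (hz0 : ∀ i, 0 < z i) : ∃ w ∈ TT n (n + 1), ∀ m, m < n → kE m w = kE m z := by
  let K : Set (Fin (n + 1) → ℝ) := {w | w ∈ Set.Icc (0 : Fin (n + 1) → ℝ) (fun _ => 1 + kE 0 z) ∧
    (∀ i : Fin n, Odd (i : ℕ) → w i.castSucc ≤ w i.succ) ∧
    (∀ i : Fin (n + 1), 0 ≤ (-1) * (-1) ^ (i : ℕ) * (w i - z i)) ∧ ∀ m, m < n → kE m w = kE m z}
  have hKc : IsCompact K := by
    refine isCompact_Icc.inter_right ?_
    refine IsClosed.inter ?_ (IsClosed.inter ?_ ?_)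
    · exact cl_all fun i => cl_imp fun _ =>
        isClosed_le (continuous_apply _) (continuous_apply _)
    · exact cl_all fun i => isClosed_le continuous_const (by fun_prop)
    · exact cl_all fun i => cl_imp fun _ =>
        isClosed_eq (kE_continuous _) continuous_const
  have hKne : K.Nonempty := by
    refine ⟨z, ⟨fun i => (hz0 i).le, fun i => kE_bound z (fun i => (hz0 i).le) i⟩, ?_, ?_, ?_⟩
    · intro i _; exact hz.monotone i.castSucc_le_succ
    · intro i; simp
    · intro m _; rfl
  obtain ⟨w, hwK, hwmin⟩ := hKc.exists_isMinOn hKne (kE_continuous n).continuousOn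
  obtain ⟨hwI, hwodd, hwsgn, hwE⟩ := hwK
  have heven : ∀ i : Fin n, Even (i : ℕ) → w i.castSucc < w i.succ := by
    intro i hi
    have h1 := hwsgn i.castSucc
    have h2 := hwsgn i.succ
    have h3 := hz i.castSucc_lt_succ
    simp only [Fin.val_castSucc, Fin.val_succ, pow_succ, hi.neg_one_pow] at h1 h2
    linarith
  have hwm : Monotone w := by
    rw [Fin.monotone_iff_le_succ]
    intro i
    rcases Nat.even_or_odd (i : ℕ) with hi | hi
    · exact (heven i hi).le
    · exact hwodd i hi
  refine ⟨w, ⟨hwm, fun i => hwI.1 i, ?_⟩, hwE⟩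
  intro j hj
  have hjid : ∀ i, j i = i := strictMono_eq j hj
  simp only [hjid]
  by_contra hcon
  push Not at hcon
  obtain ⟨hc0, hc1⟩ := hcon
  have hws : StrictMono w := by
    rw [Fin.strictMono_iff_lt_succ]
    intro i
    rcases Nat.even_or_odd (i : ℕ) with hi | hi
    · exact heven i hi
    · exact lt_of_le_of_ne (hwodd i hi) (hc1 i hi)
  have hwpos : ∀ i, 0 < w i := by
    intro i
    have h1 : 0 < w 0 := lt_of_le_of_ne (hwI.1 0) (Ne.symm hc0)
    exact h1.trans_le (hwm (Fin.zero_le i))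
  have hU : {v : Fin (n + 1) → ℝ | (∀ i : Fin n, v i.castSucc < v i.succ) ∧ ∀ i, 0 < v i}
      ∈ nhds w := by
    refine IsOpen.mem_nhds ?_ ⟨fun i => hws i.castSucc_lt_succ, hwpos⟩
    refine IsOpen.inter ?_ ?_
    · exact op_all fun i => isOpen_lt (continuous_apply _) (continuous_apply _)
    · exact op_all fun i => isOpen_lt continuous_const (continuous_apply _)
  obtain ⟨v, ⟨hv1, hv2⟩, hvE, hvlt⟩ := perturb w hws hwpos _ hU
  have hvs : StrictMono v := Fin.strictMono_iff_lt_succ.2 hv1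
  have hch : ¬ NoChain n w v := by
    intro hno
    have hne : v ≠ w := by
      intro h; rw [h] at hvlt; exact lt_irrefl _ hvlt
    have := core w v hwm hvs.monotone (fun i => (hwpos i).le) (fun i => (hv2 i).le) hno hne
      (fun m hm => (hvE m hm).le)
    linarith
  unfold NoChain at hch
  push Not at hch
  obtain ⟨g, hg, hgs⟩ := hch
  have hgid : ∀ i, g i = i := strictMono_eq g hg
  simp only [hgid] at hgs
  have hvK : v ∈ K := by
    refine ⟨⟨fun i => (hv2 i).le, fun i => ?_⟩, ?_, ?_, ?_⟩
    · have h1 := kE_bound v (fun i => (hv2 i).le) i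
      rw [hvE 0 (by omega), hwE 0 (by omega)] at h1
      exact h1
    · intro i _; exact (hv1 i).le
    · intro i
      have h1 := hgs i
      have h2 := hwsgn i
      nlinarith
    · intro m hm; rw [hvE m hm, hwE m hm]
  have := hwmin hvK
  simp only [Set.mem_ofPred_eq] at this
  linarith

theorem TT_closed (n N : ℕ) : IsClosed (TT n N) := by
  refine IsClosed.inter ?_ (IsClosed.inter ?_ ?_)
  · exact isClosed_monotone
  · exact cl_all fun i => isClosed_le continuous_const (continuous_apply _)
  · refine cl_all fun j => cl_imp fun _ => ?_
    refine IsClosed.union (isClosed_eq (continuous_apply _) continuous_const) ?_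
    have : {x : Fin N → ℝ | ∃ i : Fin n, Odd (i : ℕ) ∧ x (j i.castSucc) = x (j i.succ)} =
        ⋃ i : Fin n, {x : Fin N → ℝ | Odd (i : ℕ) ∧ x (j i.castSucc) = x (j i.succ)} := by
      ext x; simp
    change IsClosed {x : Fin N → ℝ | ∃ i : Fin n, Odd (i : ℕ) ∧ x (j i.castSucc) = x (j i.succ)}
    rw [this]
    refine isClosed_iUnion_of_finite fun i => ?_
    exact IsClosed.inter isClosed_const (isClosed_eq (continuous_apply _) (continuous_apply _))

theorem exists_TT {n : ℕ} (hn : 1 ≤ n) (z : Fin (n + 1) → ℝ) (hz : Monotone z)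
    (hz0 : ∀ i, 0 ≤ z i) : ∃ w ∈ TT n (n + 1), ∀ m, m < n → kE m w = kE m z := by
  let Φ : (Fin (n + 1) → ℝ) → (Fin n → ℝ) := fun w m => kE (m : ℕ) w
  have hΦ : Continuous Φ := continuous_pi fun m => kE_continuous _
  let zz : ℝ → Fin (n + 1) → ℝ := fun s i => z i + s * ((i : ℕ) + 1)
  have hzz : Continuous zz := by
    refine continuous_pi fun i => ?_
    simp only [zz]; fun_prop
  have hzz0 : zz 0 = z := by funext i; simp [zz]
  let B : ℝ := 2 + kE 0 z
  let S : Set (Fin (n + 1) → ℝ) := Set.Icc (0 : Fin (n + 1) → ℝ) (fun _ => B) ∩ TT n (n + 1)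
  have hS : IsCompact S := isCompact_Icc.inter_right (TT_closed _ _)
  have hcl : IsClosed (Φ '' S) := (hS.image hΦ).isClosed
  have ht : Filter.Tendsto (fun s => Φ (zz s)) (nhdsWithin 0 (Set.Ioi 0)) (nhds (Φ z)) := by
    have h := (hΦ.comp hzz).tendsto 0
    simp only [Function.comp, hzz0] at h
    exact h.mono_left nhdsWithin_le_nhds
  have hb : ∀ᶠ s in nhdsWithin (0 : ℝ) (Set.Ioi 0), kE 0 (zz s) < kE 0 z + 1 := by
    have h := (((kE_continuous 0).comp hzz).tendsto 0)
    simp only [Function.comp, hzz0] at h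
    exact (h.mono_left nhdsWithin_le_nhds).eventually (gt_mem_nhds (by linarith))
  have hmem : Φ z ∈ Φ '' S := by
    refine hcl.mem_of_tendsto ht ?_
    filter_upwards [hb, self_mem_nhdsWithin] with s hs hs0
    have hs0' : 0 < s := hs0
    obtain ⟨w, hw, hwE⟩ := exists_TT_strict hn (zz s) (by
      intro p q hpq
      have h1 := hz hpq.le
      have h2 : ((p : ℕ) : ℝ) < ((q : ℕ) : ℝ) := by exact_mod_cast hpq
      simp only [zz]
      nlinarith) (by
      intro i
      have h1 := hz0 i
      simp only [zz]
      positivity)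
    refine ⟨w, ⟨⟨hw.2.1, fun i => ?_⟩, hw⟩, ?_⟩
    · have h1 := kE_bound w hw.2.1 i
      rw [hwE 0 (by omega)] at h1
      simp only [B]
      linarith
    · funext m; exact hwE m m.2
  obtain ⟨w, hw, hwE⟩ := hmem
  exact ⟨w, hw.2, fun m hm => congrFun hwE ⟨m, hm⟩⟩

theorem min_mem_TT {n N : ℕ} (hn : 1 ≤ n) (x : Fin N → ℝ) (hx : Monotone x) (hx0 : ∀ i, 0 ≤ x i)
    (hmin : ∀ y : Fin N → ℝ, (∀ i, 0 ≤ y i) → (∀ m, m < n → kE m y = kE m x) →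
      kE n x ≤ kE n y) : x ∈ TT n N := by
  refine ⟨hx, hx0, fun j hj => ?_⟩
  by_contra hcon
  have hzm : Monotone (x ∘ j) := hx.comp hj.monotone
  obtain ⟨w, hw, hwE⟩ := exists_TT hn (x ∘ j) hzm (fun i => hx0 _)
  have hne : x ∘ j ≠ w := by
    rintro rfl
    exact hcon (hw.2.2 id strictMono_id)
  have hlt := core w (x ∘ j) hw.1 hzm hw.2.1 (fun i => hx0 _)
    (noChain_of_TT w _ hw hzm fun i => hx0 _) hne (fun m hm => (hwE m hm).ge)
  classical
  let y : Fin N → ℝ := Function.extend j w x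
  have hyj : ∀ i, y (j i) = w i := fun i => hj.injective.extend_apply _ _ _
  have hyn : ∀ k, k ∉ Finset.univ.image j → y k = x k := by
    intro k hk
    refine Function.extend_apply' _ _ _ ?_
    rintro ⟨i, rfl⟩
    exact hk (Finset.mem_image_of_mem _ (Finset.mem_univ _))
  have hdiff : ∀ m, kE m y - kE m x = kE m w - kE m (x ∘ j) := by
    intro m
    unfold kE
    rw [← mul_sub, ← mul_sub, ← Finset.sum_sub_distrib, ← Finset.sum_sub_distrib]
    congr 1
    rw [← Finset.sum_subset (Finset.subset_univ (Finset.univ.image j))]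
    · rw [Finset.sum_image (fun p _ q _ h => hj.injective h)]
      simp [hyj]
    · intro k _ hk
      rw [hyn k hk, sub_self]
  have h1 := hmin y (by
    intro k
    by_cases hk : k ∈ Finset.univ.image j
    · obtain ⟨i, -, rfl⟩ := Finset.mem_image.1 hk
      rw [hyj]; exact hw.2.1 i
    · rw [hyn k hk]; exact hx0 k) (by
    intro m hm
    have h1 := hdiff m
    rw [hwE m hm] at h1
    linarith)
  have h2 := hdiff n
  linarith

theorem kE_perm {N : ℕ} (m : ℕ) (x : Fin N → ℝ) (σ : Equiv.Perm (Fin N)) :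
    kE m (x ∘ σ) = kE m x := by
  unfold kE
  congr 1
  exact Equiv.sum_comp σ (fun j => x j ^ (2 * m + 3))

end KdVHelpers

/-- **Continuity and monotonicity of the relaxed minimal-energy function `C_N`.**
Fix `n ≥ 1` and `N ≥ 1`.  For `e ∈ ℝⁿ` let
`Γ_e = { x ∈ ℝ^N : x_j ≥ 0 and (-1)^{m+1} (2^{2m+1}/(2m+1)) ∑_j x_j^{2m+1} = e_m }`
(the index `m : Fin n` corresponds to the mathematical index `m + 1`), let
`𝓐 = { e : Γ_e ≠ ∅ }`, and suppose `C : ℝⁿ → ℝ` satisfies, for each `e ∈ 𝓐`, that `C e`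
is the minimum of `(-1)^n (2^{2n+3}/(2n+3)) ∑_j x_j^{2n+3}` over `Γ_e`.  Then `C` is
continuous on `𝓐` and decreasing in each variable on `𝓐`. -/
theorem stmt_18 (n N : ℕ) (hn : 1 ≤ n) (hN : 1 ≤ N)
    (Γ : (Fin n → ℝ) → Set (Fin N → ℝ))
    (hΓ : ∀ e, Γ e = {x | (∀ j, 0 ≤ x j) ∧ ∀ m : Fin n,
      (-1 : ℝ) ^ (m : ℕ) * 2 ^ (2 * (m : ℕ) + 3) / (2 * (m : ℕ) + 3 : ℝ) *
        ∑ j, x j ^ (2 * (m : ℕ) + 3) = e m})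
    (A : Set (Fin n → ℝ)) (hA : A = {e | (Γ e).Nonempty})
    (C : (Fin n → ℝ) → ℝ)
    (hC : ∀ e ∈ A, IsLeast ((fun x : Fin N → ℝ =>
      (-1 : ℝ) ^ n * 2 ^ (2 * n + 3) / (2 * n + 3 : ℝ) *
        ∑ j, x j ^ (2 * n + 3)) '' Γ e) (C e)) :
    ContinuousOn C A ∧
    ∀ e ∈ A, ∀ e' ∈ A, (∀ m, e' m ≤ e m) → C e ≤ C e' := by
  have hex : ∀ e ∈ A, ∃ x ∈ TT n N, (∀ m : Fin n, kE (m : ℕ) x = e m) ∧ kE n x = C e := by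
    intro e he
    obtain ⟨⟨x, hx, hxC⟩, hlow⟩ := hC e he
    rw [hΓ] at hx
    obtain ⟨hx0, hxE⟩ := hx
    have hmono := Tuple.monotone_sort x
    refine ⟨x ∘ Tuple.sort x, ?_, ?_, ?_⟩
    · refine min_mem_TT hn _ hmono (fun i => hx0 _) ?_
      intro y hy hyE
      have h1 : kE n (x ∘ Tuple.sort x) = C e := by rw [kE_perm]; exact hxC
      rw [h1]
      refine hlow ⟨y, ?_, rfl⟩
      rw [hΓ]
      refine ⟨hy, fun m => ?_⟩
      have h2 := hyE m m.2
      rw [kE_perm] at h2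
      exact h2.trans (hxE m)
    · intro m; rw [kE_perm]; exact hxE m
    · rw [kE_perm]; exact hxC
  have hcmp : ∀ x ∈ TT n N, ∀ z ∈ TT n N, (∀ m, m < n → kE m z ≤ kE m x) → kE n x ≤ kE n z := by
    intro x hx z hz h
    by_cases hzx : z = x
    · rw [hzx]
    · exact (core x z hx.1 hz.1 hx.2.1 hz.2.1 (noChain_of_TT x z hx hz.1 hz.2.1) hzx h).le
  constructor
  · intro e he
    obtain ⟨x, hx, hxE, hxC⟩ := hex e he
    choose! ξ hξT hξE hξC using hex
    refine Filter.tendsto_of_subseq_tendsto ?_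
    intro u hu
    have huA : ∀ᶠ k in Filter.atTop, u k ∈ A := hu.eventually self_mem_nhdsWithin
    have hue : Filter.Tendsto u Filter.atTop (nhds e) := hu.mono_right nhdsWithin_le_nhds
    have h0 : ∀ᶠ k in Filter.atTop, u k ⟨0, hn⟩ < e ⟨0, hn⟩ + 1 :=
      (((continuous_apply _).tendsto e).comp hue).eventually (gt_mem_nhds (by simp))
    have hbd : ∀ᶠ k in Filter.atTop,
        ξ (u k) ∈ Set.Icc (0 : Fin N → ℝ) (fun _ => 2 + e ⟨0, hn⟩) := by
      filter_upwards [huA, h0] with k hk hk0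
      refine ⟨(hξT _ hk).2.1, fun i => ?_⟩
      have h1 := kE_bound (ξ (u k)) (hξT _ hk).2.1 i
      have h2 := hξE _ hk ⟨0, hn⟩
      simp only at h2
      rw [h2] at h1
      linarith
    obtain ⟨y, -, φ, hφ, hy⟩ := isCompact_Icc.tendsto_subseq' hbd.frequently
    refine ⟨φ, ?_⟩
    have huAφ : ∀ᶠ k in Filter.atTop, u (φ k) ∈ A := hφ.tendsto_atTop.eventually huA
    have hyT : y ∈ TT n N := (TT_closed n N).mem_of_tendsto hy
      (huAφ.mono fun k hk => hξT _ hk)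
    have hyE : ∀ m : Fin n, kE (m : ℕ) y = e m := by
      intro m
      have h1 : Filter.Tendsto (fun k => kE (m : ℕ) (ξ (u (φ k)))) Filter.atTop
        (nhds (kE (m : ℕ) y)) := ((kE_continuous (m : ℕ)).tendsto y).comp hy
      have h2 : Filter.Tendsto (fun k => u (φ k) m) Filter.atTop (nhds (e m)) :=
        ((continuous_apply m).tendsto e).comp (hue.comp hφ.tendsto_atTop)
      refine tendsto_nhds_unique (h1.congr' ?_) h2
      exact huAφ.mono fun k hk => hξE _ hk m
    have hyC : kE n y = C e := by
      rw [← hxC]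
      apply le_antisymm
      · exact hcmp y hyT x hx fun m hm => by rw [hxE ⟨m, hm⟩, hyE ⟨m, hm⟩]
      · exact hcmp x hx y hyT fun m hm => by rw [hxE ⟨m, hm⟩, hyE ⟨m, hm⟩]
    rw [← hyC]
    have h1 : Filter.Tendsto (fun k => kE n (ξ (u (φ k)))) Filter.atTop
        (nhds (kE n y)) := ((kE_continuous n).tendsto y).comp hy
    exact h1.congr' (huAφ.mono fun k hk => hξC _ hk)
  · intro e he e' he' hle
    obtain ⟨x, hx, hxE, hxC⟩ := hex e he
    obtain ⟨z, hz, hzE, hzC⟩ := hex e' he'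
    rw [← hxC, ← hzC]
    refine hcmp x hx z hz fun m hm => ?_
    have h1 := hxE ⟨m, hm⟩
    have h2 := hzE ⟨m, hm⟩
    simp only at h1 h2
    rw [h1, h2]
    exact hle _
end
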